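/- Let Φ ∈ 𝔠(H), X = ran Φ, and let U ⊆ B(K) be a completely hyperreflexive weak* closed subspace. Then the weak* closed span W of X ⊗ U in B(H⊗K) is hyperreflexive, and k(W) ≤ λ_c(Φ)·‖id − Φ‖ + k_c(U)·‖Φ‖. -/

import Mathlib

open scoped InnerProductSpace Pointwise

noncomputable section

namespace SchurHyper

/-- `B H` is the algebra of bounded linear operators on `H`. -/
abbrev B (H : Type*) [NormedAddCommGroup H] [InnerProductSpace ℂ H] : Type _ := H →L[ℂ] H

variable (H : Type*) [NormedAddCommGroup H] [InnerProductSpace ℂ H]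

/-- A linear functional on `B H` is *normal* (weak* continuous) if it arises from
the duality with the trace class, i.e. it is of the form
`T ↦ ∑ₙ ⟪yₙ, T xₙ⟫` for square-summable sequences `(xₙ)`, `(yₙ)`
(recall that the inner product is conjugate-linear in its first slot). -/
def IsNormalFunctional (ω : B H →ₗ[ℂ] ℂ) : Prop :=
  ∃ x y : ℕ → H, Summable (fun n => ‖x n‖ ^ 2) ∧ Summable (fun n => ‖y n‖ ^ 2) ∧
    ∀ T : B H, ω T = ∑' n, ⟪y n, T (x n)⟫_ℂ

/-- The weak* topology on `B H`: the topology induced by the normal functionals. -/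
def weakStarTopology : TopologicalSpace (B H) :=
  TopologicalSpace.induced
    (fun (T : B H) (ω : {ω : B H →ₗ[ℂ] ℂ // IsNormalFunctional H ω}) => ω.1 T)
    inferInstance

/-- A set of operators is weak* closed if it is closed in the weak* topology. -/
def WStarClosed (X : Set (B H)) : Prop := @IsClosed _ (weakStarTopology H) X

/-- The weak* closure of a set of operators. -/
def wStarClosure (X : Set (B H)) : Set (B H) := @closure _ (weakStarTopology H) X

/-- A map on `B H` is weak* continuous if it is continuous with respect to the
weak* topology on both sides. -/
def WStarContinuous (Φ : B H →L[ℂ] B H) : Prop :=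
  @Continuous _ _ (weakStarTopology H) (weakStarTopology H) Φ

variable {H}
variable [CompleteSpace H]

/-- A maximal abelian selfadjoint subalgebra of `B H`: an abelian selfadjoint
subalgebra which contains every operator commuting with it (equivalently, it
coincides with its own commutant). -/
def IsMasa (D : StarSubalgebra ℂ (B H)) : Prop :=
  (∀ A ∈ D, ∀ C ∈ D, A * C = C * A) ∧
  (∀ T : B H, (∀ A ∈ D, T * A = A * T) → T ∈ D)

/-- A Schur multiplier: a weak* continuous `D`-bimodule map on `B H`. -/
def IsSchurMultiplier (D : StarSubalgebra ℂ (B H)) (Φ : B H →L[ℂ] B H) : Prop :=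
  WStarContinuous H Φ ∧ ∀ A ∈ D, ∀ C ∈ D, ∀ T : B H, Φ (A * T * C) = A * Φ T * C

/-- A Schur idempotent: an idempotent Schur multiplier. -/
def IsSchurIdempotent (D : StarSubalgebra ℂ (B H)) (Φ : B H →L[ℂ] B H) : Prop :=
  IsSchurMultiplier D Φ ∧ Φ.comp Φ = Φ

/-- A subspace `X ⊆ B H` is a `D`-bimodule if `D X D ⊆ X`. -/
def IsBimodule (D : StarSubalgebra ℂ (B H)) (X : Submodule ℂ (B H)) : Prop :=
  ∀ A ∈ D, ∀ C ∈ D, ∀ T ∈ X, A * T * C ∈ X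

/-- The Arveson distance `α(T, X)`. -/
def arveson (T : B H) (X : Set (B H)) : ℝ :=
  ⨆ ξ : {ξ : H // ‖ξ‖ = 1}, ⨅ S : X, ‖T ξ.1 - S.1 ξ.1‖

/-- The set of hyperreflexivity constants of `X`. -/
def hyperSet (X : Set (B H)) : Set ℝ :=
  {k | 0 < k ∧ ∀ T : B H, Metric.infDist T X ≤ k * arveson T X}

/-- A subspace is hyperreflexive if `d(T, X) ≤ k ⬝ α(T, X)` for some `k > 0`. -/
def Hyperreflexive (X : Set (B H)) : Prop := (hyperSet X).Nonempty

/-- The hyperreflexivity constant `k(X)`: the least constant that works. -/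
def hyperConst (X : Set (B H)) : ℝ := sInf (hyperSet X)

/-- The set of constants `λ` witnessing that a Schur idempotent lies in `𝔉H`. -/
def lamSet (Φ : B H →L[ℂ] B H) : Set ℝ :=
  {l | 0 < l ∧ ∀ T : B H, ‖T - Φ T‖ ≤ l * arveson T (Set.range Φ)}

/-- The class `𝔉H` of Schur idempotents `Φ` such that
`‖T - Φ T‖ ≤ λ ⬝ α(T, ran Φ)` for some `λ > 0` and all `T`. -/
def MemFH (D : StarSubalgebra ℂ (B H)) (Φ : B H →L[ℂ] B H) : Prop :=
  IsSchurIdempotent D Φ ∧ (lamSet Φ).Nonempty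

/-- The constant `λ(Φ)`: the least constant witnessing membership of `𝔉H`. -/
def lam (Φ : B H →L[ℂ] B H) : ℝ := sInf (lamSet Φ)

/-- A ternary masa-bimodule condition: `S T* R ∈ M` whenever `S, T, R ∈ M`. -/
def IsTernary (M : Submodule ℂ (B H)) : Prop :=
  ∀ S ∈ M, ∀ T ∈ M, ∀ R ∈ M, S * star T * R ∈ M

end SchurHyper

open SchurHyper

/-- `t : H →ₗ K →ₗ HK` realises `HK` as the Hilbert-space tensor product `H ⊗ K`:
inner products of elementary tensors multiply, and elementary tensors are total. -/
def IsElemTensor {H K HK : Type*} [NormedAddCommGroup H] [InnerProductSpace ℂ H]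
    [NormedAddCommGroup K] [InnerProductSpace ℂ K]
    [NormedAddCommGroup HK] [InnerProductSpace ℂ HK]
    (t : H →ₗ[ℂ] K →ₗ[ℂ] HK) : Prop :=
  (∀ (x₁ x₂ : H) (y₁ y₂ : K), ⟪t x₁ y₁, t x₂ y₂⟫_ℂ = ⟪x₁, x₂⟫_ℂ * ⟪y₁, y₂⟫_ℂ) ∧
  Dense ((Submodule.span ℂ {z : HK | ∃ x y, z = t x y} : Submodule ℂ HK) : Set HK)

/-- `τ` sends a pair of operators `A ∈ B(H)`, `C ∈ B(K)` to the tensor product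
operator `A ⊗ C ∈ B(H ⊗ K)`, characterised by its action on elementary tensors. -/
def IsOpTensor {H K HK : Type*} [NormedAddCommGroup H] [InnerProductSpace ℂ H]
    [NormedAddCommGroup K] [InnerProductSpace ℂ K]
    [NormedAddCommGroup HK] [InnerProductSpace ℂ HK]
    (t : H →ₗ[ℂ] K →ₗ[ℂ] HK) (τ : B H →ₗ[ℂ] B K →ₗ[ℂ] B HK) : Prop :=
  ∀ (A : B H) (C : B K) (x : H) (y : K), τ A C (t x y) = t (A x) (C y)

/-- The linear span of the elementary tensors `a ⊗ c` with `a ∈ X`, `c ∈ Y`. -/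
def tensorSpan {H K HK : Type*} [NormedAddCommGroup H] [InnerProductSpace ℂ H]
    [NormedAddCommGroup K] [InnerProductSpace ℂ K]
    [NormedAddCommGroup HK] [InnerProductSpace ℂ HK]
    (τ : B H →ₗ[ℂ] B K →ₗ[ℂ] B HK) (X : Set (B H)) (Y : Set (B K)) : Set (B HK) :=
  (Submodule.span ℂ {z : B HK | ∃ a ∈ X, ∃ c ∈ Y, z = τ a c} : Submodule ℂ (B HK))

/-- A separable infinite-dimensional Hilbert space, namely `ℓ²`. -/
abbrev ell2 : Type := lp (fun _ : ℕ => ℂ) 2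

/-- A weak* closed subspace `X ⊆ B(E)` is completely hyperreflexive if the weak*
closed span of `X ⊗ B(ℓ²)` is hyperreflexive (in any realisation of the Hilbert
space tensor product `E ⊗ ℓ²`). -/
def CompletelyHyperreflexive {E : Type*} [NormedAddCommGroup E] [InnerProductSpace ℂ E]
    (X : Set (B E)) : Prop :=
  ∀ (W : Type*) [NormedAddCommGroup W] [InnerProductSpace ℂ W] [CompleteSpace W],
    ∀ (t : E →ₗ[ℂ] ell2 →ₗ[ℂ] W) (τ : B E →ₗ[ℂ] B ell2 →ₗ[ℂ] B W),
    IsElemTensor t → IsOpTensor t τ →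
    Hyperreflexive (wStarClosure W (tensorSpan τ X Set.univ))

/-- The Boolean lattice `𝔠(H)` of Schur idempotents generated by the contractive
Schur idempotents, under meet `Φ∧Ψ = Φ∘Ψ`, join `Φ∨Ψ = Φ+Ψ−Φ∘Ψ` and
complement `Φ^⊥ = id − Φ`. -/
inductive InC {H : Type*} [NormedAddCommGroup H] [InnerProductSpace ℂ H] [CompleteSpace H]
    (D : StarSubalgebra ℂ (B H)) : (B H →L[ℂ] B H) → Prop
  | base (Φ : B H →L[ℂ] B H) (h : IsSchurIdempotent D Φ) (hc : ‖Φ‖ ≤ 1) : InC D Φ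
  | compl (Φ : B H →L[ℂ] B H) (h : InC D Φ) : InC D (ContinuousLinearMap.id ℂ (B H) - Φ)
  | meet (Φ Ψ : B H →L[ℂ] B H) (h1 : InC D Φ) (h2 : InC D Ψ) : InC D (Φ.comp Ψ)
  | join (Φ Ψ : B H →L[ℂ] B H) (h1 : InC D Φ) (h2 : InC D Ψ) : InC D (Φ + Ψ - Φ.comp Ψ)

namespace SchurHyper

set_option linter.unusedSectionVars false

section RankOne

variable {E : Type*} [NormedAddCommGroup E] [InnerProductSpace ℂ E]

/-- The rank-one operator `x ↦ ⟪u, x⟫ • v`. -/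
def rk (v u : E) : B E := InnerProductSpace.rankOne ℂ v u

@[simp] lemma rk_apply (v u x : E) : rk v u x = ⟪u, x⟫_ℂ • v := rfl

@[simp] lemma norm_rk (v u : E) : ‖rk v u‖ = ‖v‖ * ‖u‖ := InnerProductSpace.norm_rankOne v u

lemma continuous_rk : Continuous fun p : E × E => rk p.1 p.2 := by
  have h : Continuous fun p : E × E => (innerSL ℂ p.2, p.1) :=
    ((innerSL ℂ (E := E)).continuous.comp continuous_snd).prodMk continuous_fst
  exact (ContinuousLinearMap.smulRightL ℂ E E).continuous₂.comp h

lemma rk_add_left (v v' u : E) : rk (v + v') u = rk v u + rk v' u := by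
  ext x; simp [smul_add]

lemma rk_add_right (v u u' : E) : rk v (u + u') = rk v u + rk v u' := by
  ext x; simp [add_smul]

lemma tendsto_rk {ι : Type*} {l : Filter ι} {y z : ι → E} {v u : E}
    (hy : Filter.Tendsto y l (nhds v)) (hz : Filter.Tendsto z l (nhds u)) :
    Filter.Tendsto (fun n => rk (y n) (z n)) l (nhds (rk v u)) := by
  have h := continuous_rk (E := E)
  generalize hf : (fun p : E × E => rk p.1 p.2) = f at h
  have h1 : ∀ p, f p = rk p.1 p.2 := fun p => by rw [← hf]
  have h2 := (h.tendsto (v, u)).comp (hy.prodMk_nhds hz)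
  rw [h1] at h2
  exact h2.congr fun n => h1 _

end RankOne

section WeakStar

variable {E F : Type*} [NormedAddCommGroup E] [InnerProductSpace ℂ E]
  [NormedAddCommGroup F] [InnerProductSpace ℂ F]

/-- The functional `T ↦ ⟪y, T x⟫`. -/
def vecFunctional (x y : E) : B E →ₗ[ℂ] ℂ :=
  (innerSL ℂ y).toLinearMap ∘ₗ (ContinuousLinearMap.apply ℂ E x).toLinearMap

@[simp] lemma vecFunctional_apply (x y : E) (T : B E) :
    vecFunctional x y T = ⟪y, T x⟫_ℂ := rfl

lemma isNormal_vecFunctional (x y : E) : IsNormalFunctional E (vecFunctional x y) := by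
  refine ⟨fun n => if n = 0 then x else 0, fun n => if n = 0 then y else 0, ?_, ?_, ?_⟩
  · refine summable_of_ne_finset_zero (s := {0}) fun n hn => ?_
    simp_all
  · refine summable_of_ne_finset_zero (s := {0}) fun n hn => ?_
    simp_all
  · intro T
    rw [tsum_eq_single 0]
    · simp
    · intro n hn
      simp [hn]

lemma IsNormalFunctional.continuous {ω : B E →ₗ[ℂ] ℂ} (h : IsNormalFunctional E ω) :
    @Continuous _ _ (weakStarTopology E) _ ω := by
  let _ := weakStarTopology E
  have h1 : Continuous
      (fun (T : B E) (ω : {ω : B E →ₗ[ℂ] ℂ // IsNormalFunctional E ω}) => ω.1 T) :=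
    continuous_induced_dom
  exact (continuous_apply (⟨ω, h⟩ : {ω : B E →ₗ[ℂ] ℂ // IsNormalFunctional E ω})).comp h1

lemma continuous_weakStar_inner (x y : E) :
    @Continuous _ _ (weakStarTopology E) _ fun T : B E => ⟪y, T x⟫_ℂ :=
  (isNormal_vecFunctional x y).continuous

lemma continuous_weakStar_of_normal {X : Type*} [TopologicalSpace X] (f : X → B E)
    (h : ∀ ω : B E →ₗ[ℂ] ℂ, IsNormalFunctional E ω → Continuous fun z => ω (f z)) :
    @Continuous _ _ _ (weakStarTopology E) f := by
  rw [weakStarTopology, continuous_induced_rng]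
  exact continuous_pi fun ω => h ω.1 ω.2

variable [CompleteSpace E] [CompleteSpace F]

lemma IsNormalFunctional.compress {ω : B F →ₗ[ℂ] ℂ} (h : IsNormalFunctional F ω)
    (A : E →L[ℂ] F) (C : F →L[ℂ] E) :
    IsNormalFunctional E
      ({ toFun := fun T => ω (A ∘L T ∘L C)
         map_add' := fun S T => by
          rw [← map_add]; congr 1; ext x; simp
         map_smul' := fun c T => by
          rw [RingHom.id_apply, ← map_smul]; congr 1; ext x; simp } : B E →ₗ[ℂ] ℂ) := by
  obtain ⟨x, y, hx, hy, hω⟩ := h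
  have key : ∀ {G G' : Type _} [NormedAddCommGroup G] [InnerProductSpace ℂ G]
      [NormedAddCommGroup G'] [InnerProductSpace ℂ G'] (L : G →L[ℂ] G') (z : ℕ → G),
      Summable (fun n => ‖z n‖ ^ 2) → Summable (fun n => ‖L (z n)‖ ^ 2) := by
    intro G G' _ _ _ _ L z hz
    refine Summable.of_nonneg_of_le (fun n => by positivity) (fun n => ?_) (hz.mul_left (‖L‖ ^ 2))
    rw [← mul_pow]
    gcongr
    exact L.le_opNorm _
  refine ⟨fun n => C (x n), fun n => ContinuousLinearMap.adjoint A (y n), key C x hx, key _ y hy,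
    fun T => ?_⟩
  simp only [LinearMap.coe_mk, AddHom.coe_mk, hω, ContinuousLinearMap.adjoint_inner_left]
  rfl

/-- Compressions `T ↦ A T C` are weak* continuous. -/
lemma continuous_weakStar_compress (A : E →L[ℂ] F) (C : F →L[ℂ] E) :
    @Continuous _ _ (weakStarTopology E) (weakStarTopology F) fun T : B E => A ∘L T ∘L C := by
  let _ := weakStarTopology E
  refine continuous_weakStar_of_normal _ fun ω hω => ?_
  exact (hω.compress A C).continuous

/-- Every operator is a bounded strong and weak* limit of finite-rank operators. -/
lemma exists_finiteRank_filter (T : B E) : ∃ l : Filter (B E), l.NeBot ∧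
    (∀ᶠ R in l, R ∈ Submodule.span ℂ {R : B E | ∃ u v, R = rk v u}) ∧
    (∀ᶠ R in l, ∀ x, ‖R x‖ ≤ ‖T x‖) ∧
    (∀ x, Filter.Tendsto (fun R : B E => R x) l (nhds (T x))) := by
  obtain ⟨w, b, -⟩ := exists_hilbertBasis ℂ E
  have happ : ∀ (s : Finset w) (v : E), (∑ i ∈ s, rk (b i)
        (ContinuousLinearMap.adjoint T (b i))) v = ∑ i ∈ s, b.repr (T v) i • b i := by
    intro s v
    simp [rk_apply,
      ContinuousLinearMap.adjoint_inner_left, HilbertBasis.repr_apply_apply]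
  refine ⟨Filter.map (fun s : Finset w => ∑ i ∈ s, rk (b i)
        (ContinuousLinearMap.adjoint T (b i))) Filter.atTop, inferInstance, ?_, ?_, ?_⟩
  · refine Filter.eventually_map.2 (Filter.Eventually.of_forall fun s => ?_)
    exact Submodule.sum_mem _ fun i _ => Submodule.subset_span ⟨_, _, rfl⟩
  · refine Filter.eventually_map.2 (Filter.Eventually.of_forall fun s x => ?_)
    rw [happ]
    refine le_of_sq_le_sq ?_ (norm_nonneg _)
    have h5 : ‖∑ i ∈ s, b.repr (T x) i • b i‖ ^ 2 = ∑ i ∈ s, ‖b.repr (T x) i‖ ^ 2 := by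
      have := b.orthonormal.inner_sum (b.repr (T x)) (b.repr (T x)) s
      rw [inner_self_eq_norm_sq_to_K] at this
      have h6 := congrArg Complex.re this
      simp only [Complex.re_sum, Complex.conj_mul'] at h6
      norm_cast at h6
    rw [h5]
    have := b.orthonormal.sum_inner_products_le (T x) (s := s)
    simpa [HilbertBasis.repr_apply_apply] using this
  · intro x
    rw [Filter.tendsto_map'_iff]
    have h1 : HasSum (fun i => b.repr (T x) i • b i) (T x) := b.hasSum_repr _
    refine Filter.Tendsto.congr (fun s => (happ s x).symm) h1

/-- Bounded strong convergence implies weak* convergence. -/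
lemma le_nhds_weakStar {T : B E} {l : Filter (B E)}
    (hb : ∀ᶠ R in l, ∀ x, ‖R x‖ ≤ ‖T x‖)
    (hl : ∀ x, Filter.Tendsto (fun R : B E => R x) l (nhds (T x))) :
    l ≤ @nhds _ (weakStarTopology E) T := by
  rw [weakStarTopology, nhds_induced, ← Filter.tendsto_iff_comap, tendsto_pi_nhds]
  rintro ⟨ω, x, y, hx, hy, hω⟩
  simp only [hω]
  have hb' : Summable fun n => ‖T‖ * (‖x n‖ ^ 2 + ‖y n‖ ^ 2) := (hx.add hy).mul_left ‖T‖
  refine tendsto_tsum_of_dominated_convergence hb' (fun n => tendsto_const_nhds.inner (hl _)) ?_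
  filter_upwards [hb] with R hR n
  calc ‖⟪y n, R (x n)⟫_ℂ‖ ≤ ‖y n‖ * (‖T‖ * ‖x n‖) :=
        (norm_inner_le_norm _ _).trans (by gcongr; exact (hR _).trans (T.le_opNorm _))
    _ = ‖T‖ * (‖x n‖ * ‖y n‖) := by ring
    _ ≤ ‖T‖ * (‖x n‖ ^ 2 + ‖y n‖ ^ 2) := by
        gcongr
        nlinarith [sq_nonneg (‖x n‖ - ‖y n‖), sq_nonneg (‖x n‖), sq_nonneg (‖y n‖)]

end WeakStar

section WeakStarExt

variable {E F : Type*} [NormedAddCommGroup E] [InnerProductSpace ℂ E]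
  [NormedAddCommGroup F] [InnerProductSpace ℂ F] [CompleteSpace E]

/-- Weak* continuous functionals agreeing on rank-one operators are equal. -/
lemma eq_of_eq_rankOne {ω ω' : B E →ₗ[ℂ] ℂ}
    (h : @Continuous _ _ (weakStarTopology E) _ ω)
    (h' : @Continuous _ _ (weakStarTopology E) _ ω')
    (heq : ∀ u v : E, ω (rk v u) = ω' (rk v u))
    (T : B E) : ω T = ω' T := by
  obtain ⟨l, hl, hsp, hb, hlim⟩ := exists_finiteRank_filter T
  have hle := le_nhds_weakStar hb hlim
  let _ := weakStarTopology E
  have h1 := (h.tendsto T).mono_left hle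
  have h2 := (h'.tendsto T).mono_left hle
  refine tendsto_nhds_unique_of_eventuallyEq h1 h2 ?_
  filter_upwards [hsp] with R hR
  refine LinearMap.eqOn_span (f := ω) (g := ω') ?_ hR
  rintro _ ⟨u, v, rfl⟩
  exact heq u v

/-- Weak* continuous maps agreeing on rank-one operators are equal. -/
lemma map_eq_of_eq_rankOne {f g : B E →ₗ[ℂ] B F}
    (h : @Continuous _ _ (weakStarTopology E) (weakStarTopology F) f)
    (h' : @Continuous _ _ (weakStarTopology E) (weakStarTopology F) g)
    (heq : ∀ u v : E, f (rk v u) = g (rk v u))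
    (T : B E) : f T = g T := by
  ext x
  refine ext_inner_left ℂ fun y => ?_
  let _ := weakStarTopology E
  let _ := weakStarTopology F
  refine eq_of_eq_rankOne (ω := vecFunctional x y ∘ₗ f) (ω' := vecFunctional x y ∘ₗ g)
    ((isNormal_vecFunctional x y).continuous.comp h)
    ((isNormal_vecFunctional x y).continuous.comp h') (fun u v => ?_) T
  simp [heq]

lemma isClosed_weakStar_eq {f g : B E → B F}
    (h : @Continuous _ _ (weakStarTopology E) (weakStarTopology F) f)
    (h' : @Continuous _ _ (weakStarTopology E) (weakStarTopology F) g) :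
    WStarClosed E {T | f T = g T} := by
  let _ := weakStarTopology E
  let _ := weakStarTopology F
  have : {T | f T = g T} = ⋂ x : F, ⋂ y : F, {T : B E | ⟪y, f T x⟫_ℂ = ⟪y, g T x⟫_ℂ} := by
    ext T
    simp only [Set.mem_ofPred_eq, Set.mem_iInter]
    refine ⟨fun h x y => by rw [h], fun h => ?_⟩
    ext x
    exact ext_inner_left ℂ fun y => h x y
  rw [WStarClosed, this]
  exact isClosed_iInter fun x => isClosed_iInter fun y =>
    isClosed_eq ((continuous_weakStar_inner x y).comp h) ((continuous_weakStar_inner x y).comp h')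

lemma mem_span_normal {ω : B E →ₗ[ℂ] ℂ} (h : @Continuous _ _ (weakStarTopology E) _ ω) :
    ω ∈ Submodule.span ℂ {ω : B E →ₗ[ℂ] ℂ | IsNormalFunctional E ω} := by
  have := (LinearMap.mem_span_iff_continuous
    (f := fun ω : {ω : B E →ₗ[ℂ] ℂ // IsNormalFunctional E ω} => ω.1) ω).2 (by
      convert h
      rw [weakStarTopology, induced_to_pi])
  simpa [Subtype.range_coe_subtype] using this

end WeakStarExt

section Cyclic

variable {H : Type*} [NormedAddCommGroup H] [InnerProductSpace ℂ H] [CompleteSpace H]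
variable {D : StarSubalgebra ℂ (B H)}

/-- The closed cyclic subspace `[D x]`. -/
def cyc (D : StarSubalgebra ℂ (B H)) (x : H) : Submodule ℂ H :=
  (Submodule.map (ContinuousLinearMap.apply ℂ H x).toLinearMap
    (Subalgebra.toSubmodule D.toSubalgebra)).topologicalClosure

instance (D : StarSubalgebra ℂ (B H)) (x : H) : CompleteSpace (cyc D x) :=
  inferInstanceAs (CompleteSpace (Submodule.topologicalClosure _))

lemma isClosed_cyc (x : H) : IsClosed (cyc D x : Set H) :=
  Submodule.isClosed_topologicalClosure _

lemma coe_cyc (x : H) : (cyc D x : Set H) = closure {y | ∃ a ∈ D, a x = y} := by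
  rw [cyc, Submodule.topologicalClosure_coe]
  rfl

lemma apply_mem_cyc {a : B H} (ha : a ∈ D) (x : H) : a x ∈ cyc D x :=
  Submodule.le_topologicalClosure _ ⟨a, ha, rfl⟩

lemma self_mem_cyc (x : H) : x ∈ cyc D x := apply_mem_cyc (one_mem D) x

/-- A subspace invariant under `D`. -/
def Inv (D : StarSubalgebra ℂ (B H)) (S : Submodule ℂ H) : Prop :=
  ∀ a ∈ D, ∀ x ∈ S, a x ∈ S

lemma inv_cyc (x : H) : Inv D (cyc D x) := by
  intro a ha y hy
  have hy' : y ∈ closure {y | ∃ a ∈ D, a x = y} := by rw [← coe_cyc]; exact hy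
  have : a y ∈ closure {y | ∃ a ∈ D, a x = y} := by
    refine map_mem_closure a.continuous hy' ?_
    rintro _ ⟨c, hc, rfl⟩
    exact ⟨a * c, mul_mem ha hc, rfl⟩
  rwa [← coe_cyc] at this

lemma cyc_le {S : Submodule ℂ H} (hS : Inv D S) (hcl : IsClosed (S : Set H)) {x : H}
    (hx : x ∈ S) : cyc D x ≤ S := by
  intro y hy
  have hy' : y ∈ closure {y | ∃ a ∈ D, a x = y} := by rw [← coe_cyc]; exact hy
  refine closure_minimal ?_ hcl hy'
  rintro _ ⟨c, hc, rfl⟩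
  exact hS c hc x hx

lemma Inv.orthogonal {S : Submodule ℂ H} (hS : Inv D S) : Inv D Sᗮ := by
  intro a ha x hx
  rw [Submodule.mem_orthogonal] at hx ⊢
  intro u hu
  rw [← ContinuousLinearMap.adjoint_inner_left]
  exact hx _ (hS _ (star_mem ha) u hu)

lemma starProjection_mem (hD : IsMasa D) {S : Submodule ℂ H} [S.HasOrthogonalProjection]
    (hS : Inv D S) : S.starProjection ∈ D := by
  refine hD.2 _ fun a ha => ?_
  ext x
  refine (Submodule.eq_starProjection_of_mem_orthogonal
    (hS a ha _ (Submodule.starProjection_apply_mem S x)) ?_)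
  change a x - a (S.starProjection x) ∈ _
  rw [← map_sub]
  exact hS.orthogonal a ha _ (Submodule.sub_starProjection_mem_orthogonal x)

lemma exists_cyc_pair (hD : IsMasa D) (e x : H) : ∃ e', e ∈ cyc D e' ∧ x ∈ cyc D e' := by
  set E := (cyc D e).starProjection with hE
  have hED : E ∈ D := starProjection_mem hD (inv_cyc e)
  have hEe : E e = e := Submodule.starProjection_eq_self_iff.2 (self_mem_cyc e)
  have hEE : ∀ z, E (E z) = E z := fun z =>
    Submodule.starProjection_eq_self_iff.2 (Submodule.starProjection_apply_mem _ z)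
  refine ⟨e + (x - E x), ?_, ?_⟩
  · have : E (e + (x - E x)) = e := by simp [hEe, hEE]
    have h2 := apply_mem_cyc hED (e + (x - E x))
    rwa [this] at h2
  · have h1 : e ∈ cyc D (e + (x - E x)) := by
      have : E (e + (x - E x)) = e := by simp [hEe, hEE]
      have h2 := apply_mem_cyc hED (e + (x - E x))
      rwa [this] at h2
    have h2 : E x ∈ cyc D (e + (x - E x)) :=
      cyc_le (inv_cyc _) (isClosed_cyc _) h1 (Submodule.starProjection_apply_mem _ x)
    have h3 := sub_mem (self_mem_cyc (D := D) (e + (x - E x))) h1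
    have h4 := add_mem h3 h2
    simpa using h4

lemma exists_cyc (hD : IsMasa D) {ι : Type*} (s : Finset ι) (x : ι → H) :
    ∃ e, ∀ i ∈ s, x i ∈ cyc D e := by
  classical
  induction s using Finset.induction_on with
  | empty => exact ⟨0, by simp⟩
  | insert i s _ ih =>
    obtain ⟨e, he⟩ := ih
    obtain ⟨e', h1, h2⟩ := exists_cyc_pair hD e (x i)
    refine ⟨e', fun j hj => ?_⟩
    rcases Finset.mem_insert.1 hj with rfl | hj
    · exact h2
    · exact cyc_le (inv_cyc _) (isClosed_cyc _) h1 (he j hj)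

lemma norm_star_apply (hD : IsMasa D) {a : B H} (ha : a ∈ D) (x : H) :
    ‖(star a) x‖ = ‖a x‖ := by
  have h : star a * a = a * star a := hD.1 _ (star_mem ha) _ ha
  have h1 : ⟪(star a) x, (star a) x⟫_ℂ = ⟪a x, a x⟫_ℂ := by
    rw [ContinuousLinearMap.star_eq_adjoint, ContinuousLinearMap.adjoint_inner_left,
      ← ContinuousLinearMap.adjoint_inner_right, ← ContinuousLinearMap.star_eq_adjoint]
    have := congrArg (fun T : B H => T x) h
    simp only [mul_apply_eq_comp] at this
    rw [this]
  rw [inner_self_eq_norm_sq_to_K, inner_self_eq_norm_sq_to_K] at h1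
  norm_cast at h1
  exact (sq_eq_sq₀ (norm_nonneg _) (norm_nonneg _)).1 h1

/-- The canonical conjugation on a cyclic subspace. -/
lemma exists_conj (hD : IsMasa D) (e x : H) : ∃ x' : H, ‖x'‖ ≤ ‖x‖ ∧
    ∀ b ∈ D, ⟪(star b) e, x⟫_ℂ = ⟪x', b e⟫_ℂ := by
  set P := (cyc D e).starProjection with hP
  have hPx : P x ∈ closure {y | ∃ a ∈ D, a e = y} := by
    rw [← coe_cyc]; exact Submodule.starProjection_apply_mem _ x
  obtain ⟨y, hy, hlim⟩ := mem_closure_iff_seq_limit.1 hPx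
  choose a ha hay using hy
  have hc : CauchySeq fun n => (star (a n)) e := by
    have h1 := hlim.cauchySeq
    rw [Metric.cauchySeq_iff'] at h1 ⊢
    intro ε hε
    obtain ⟨N, hN⟩ := h1 ε hε
    refine ⟨N, fun n hn => ?_⟩
    have := hN n hn
    rw [dist_eq_norm] at this ⊢
    rw [← hay, ← hay, ← sub_apply,
      ← norm_star_apply hD (sub_mem (ha n) (ha N)), star_sub] at this
    simpa using this
  obtain ⟨x', hx'⟩ := cauchySeq_tendsto_of_complete hc
  refine ⟨x', ?_, fun b hb => ?_⟩
  · have h1 : Filter.Tendsto (fun n => ‖y n‖) Filter.atTop (nhds ‖P x‖) := hlim.norm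
    have h2 : Filter.Tendsto (fun n => ‖y n‖) Filter.atTop (nhds ‖x'‖) := by
      refine hx'.norm.congr fun n => ?_
      rw [norm_star_apply hD (ha n), hay]
    rw [tendsto_nhds_unique h2 h1]
    exact Submodule.norm_starProjection_apply_le _ _
  · have h0 : ⟪(star b) e, x⟫_ℂ = ⟪(star b) e, P x⟫_ℂ := by
      have hmem := apply_mem_cyc (star_mem hb) e
      rw [hP, ← Submodule.inner_starProjection_left_eq_right,
        Submodule.starProjection_eq_self_iff.2 hmem]
    rw [h0]
    have h1 : Filter.Tendsto (fun n => ⟪(star b) e, y n⟫_ℂ) Filter.atTop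
      (nhds ⟪(star b) e, P x⟫_ℂ) := tendsto_const_nhds.inner hlim
    have h2 : Filter.Tendsto (fun n => ⟪(star (a n)) e, b e⟫_ℂ) Filter.atTop
      (nhds ⟪x', b e⟫_ℂ) := hx'.inner tendsto_const_nhds
    refine tendsto_nhds_unique h1 (h2.congr fun n => ?_)
    rw [← hay, ContinuousLinearMap.star_eq_adjoint, ContinuousLinearMap.adjoint_inner_left,
      ContinuousLinearMap.star_eq_adjoint, ContinuousLinearMap.adjoint_inner_left]
    have := congrArg (fun T : B H => T e) (hD.1 _ (ha n) _ hb)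
    simp only [mul_apply_eq_comp] at this
    rw [this]

end Cyclic

section CompactRange

variable {H : Type*} [NormedAddCommGroup H] [InnerProductSpace ℂ H] [CompleteSpace H]
variable {D : StarSubalgebra ℂ (B H)}

lemma isCompactOperator_rankOne (v u : H) :
    IsCompactOperator (rk v u : B H) := by
  have h : IsCompactOperator (ContinuousLinearMap.toSpanSingleton ℂ v) :=
    isCompactOperator_of_locallyCompactSpace_rng _
  rw [show rk v u = ContinuousLinearMap.toSpanSingleton ℂ v ∘L innerSL ℂ u from
    InnerProductSpace.rankOne_def' v u]
  exact h.comp_clm (innerSL ℂ u)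

lemma exists_compact_of_summable {x y : ℕ → H} (hx : Summable fun n => ‖x n‖ ^ 2)
    (hy : Summable fun n => ‖y n‖ ^ 2) :
    ∃ K : B H, IsCompactOperator K ∧
      ∀ u v : H, HasSum (fun n => ⟪v, y n⟫_ℂ * ⟪x n, u⟫_ℂ) ⟪v, K u⟫_ℂ := by
  have hs : Summable fun n => (rk (y n) (x n) : B H) := by
    refine Summable.of_norm_bounded (hx.add hy) fun n => ?_
    rw [norm_rk]
    nlinarith [sq_nonneg (‖x n‖ - ‖y n‖), sq_nonneg (‖x n‖), sq_nonneg (‖y n‖)]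
  obtain ⟨K, hK⟩ := hs
  refine ⟨K, ?_, fun u v => ?_⟩
  · refine isCompactOperator_of_tendsto hK (Filter.Eventually.of_forall fun s => ?_)
    refine Submodule.sum_mem (compactOperator (RingHom.id ℂ) H H) fun n _ => ?_
    exact isCompactOperator_rankOne (y n) (x n)
  · have h1 := (hK.mapL (ContinuousLinearMap.apply ℂ H u)).mapL (innerSL ℂ v)
    have h2 : (fun n => ⟪v, y n⟫_ℂ * ⟪x n, u⟫_ℂ) = fun n => (innerSL ℂ v)
        ((ContinuousLinearMap.apply ℂ H u) (rk (y n) (x n))) := by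
      funext n
      simp [rk_apply, mul_comm]
    rw [h2]
    exact h1

lemma rankOne_apply_apply (a c : B H) (v u : H) :
    (rk (a v) (c u) : B H)
      = a * rk v u * star c := by
  ext x
  simp [rk_apply, ContinuousLinearMap.star_eq_adjoint,
    ContinuousLinearMap.adjoint_inner_right]

lemma exists_compact_functional (hD : IsMasa D) (e : H) {ω : B H →ₗ[ℂ] ℂ}
    (hω : @Continuous _ _ (weakStarTopology H) _ ω) :
    ∃ K : B H, IsCompactOperator K ∧ ∀ a ∈ D, ∀ b ∈ D,
      ω (rk ((star a) e) ((star b) e)) = ⟪a e, K (b e)⟫_ℂ := by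
  refine Submodule.span_induction (p := fun (ω : B H →ₗ[ℂ] ℂ) _ =>
    ∃ K : B H, IsCompactOperator K ∧ ∀ a ∈ D, ∀ b ∈ D,
      ω (rk ((star a) e) ((star b) e)) = ⟪a e, K (b e)⟫_ℂ)
    ?_ ?_ ?_ ?_ (mem_span_normal hω)
  · rintro ω ⟨x, y, hx, hy, hω⟩
    choose x' hx' hx'' using fun n => exists_conj hD e (x n)
    choose y' hy' hy'' using fun n => exists_conj hD e (y n)
    have hsx : Summable fun n => ‖x' n‖ ^ 2 :=
      Summable.of_nonneg_of_le (fun _ => by positivity) (fun n => by gcongr; exact hx' n) hx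
    have hsy : Summable fun n => ‖y' n‖ ^ 2 :=
      Summable.of_nonneg_of_le (fun _ => by positivity) (fun n => by gcongr; exact hy' n) hy
    obtain ⟨K, hK, hK'⟩ := exists_compact_of_summable hsx hsy
    refine ⟨K, hK, fun a ha b hb => ?_⟩
    rw [hω, ← (hK' (b e) (a e)).tsum_eq]
    refine tsum_congr fun n => ?_
    rw [rk_apply, inner_smul_right, hx'' n b hb, mul_comm]
    congr 1
    rw [← inner_conj_symm, hy'' n a ha, inner_conj_symm]
  · exact ⟨0, isCompactOperator_zero, by simp⟩
  · rintro ω ω' _ _ ⟨K, hK, h⟩ ⟨K', hK', h'⟩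
    refine ⟨K + K', hK.add hK', fun a ha b hb => ?_⟩
    simp [h a ha b hb, h' a ha b hb]
  · rintro c ω _ ⟨K, hK, h⟩
    refine ⟨c • K, hK.smul c, fun a ha b hb => ?_⟩
    simp [h a ha b hb]

lemma isCompactOperator_map_rankOne_self (hD : IsMasa D) {φ : B H →L[ℂ] B H}
    (hφ : IsSchurMultiplier D φ) (e : H) :
    IsCompactOperator (φ (rk e e)) := by
  have hω : @Continuous _ _ (weakStarTopology H) _ (vecFunctional e e ∘ₗ φ.toLinearMap) := by
    let _ := weakStarTopology H
    exact (isNormal_vecFunctional e e).continuous.comp hφ.1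
  obtain ⟨K, hK, h⟩ := exists_compact_functional hD e hω
  set k := φ (rk e e) with hk
  set P := (cyc D e).starProjection with hP
  have hPD : P ∈ D := starProjection_mem hD (inv_cyc e)
  have h1 : ∀ a ∈ D, ∀ b ∈ D, ⟪a e, k (b e)⟫_ℂ = ⟪a e, K (b e)⟫_ℂ := by
    intro a ha b hb
    rw [← h a ha b hb, rankOne_apply_apply, star_star]
    simp only [LinearMap.comp_apply, ContinuousLinearMap.coe_coe, vecFunctional_apply]
    rw [hφ.2 _ (star_mem ha) _ hb]
    simp [← hk, ContinuousLinearMap.star_eq_adjoint, ContinuousLinearMap.adjoint_inner_right]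
  have h2 : ∀ v ∈ cyc D e, ∀ u ∈ cyc D e, ⟪v, k u⟫_ℂ = ⟪v, K u⟫_ℂ := by
    intro v hv u hu
    have hv' : v ∈ closure {y | ∃ a ∈ D, a e = y} := by rw [← coe_cyc]; exact hv
    have hu' : u ∈ closure {y | ∃ a ∈ D, a e = y} := by rw [← coe_cyc]; exact hu
    have hcl : IsClosed {p : H × H | ⟪p.1, k p.2⟫_ℂ = ⟪p.1, K p.2⟫_ℂ} :=
      isClosed_eq (by fun_prop) (by fun_prop)
    have hmem : (v, u) ∈ closure ({y | ∃ a ∈ D, a e = y} ×ˢ {y | ∃ a ∈ D, a e = y}) := by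
      rw [closure_prod_eq]; exact ⟨hv', hu'⟩
    refine closure_minimal ?_ hcl hmem
    rintro ⟨_, _⟩ ⟨⟨a, ha, rfl⟩, ⟨b, hb, rfl⟩⟩
    exact h1 a ha b hb
  have hPs : star P = P := by
    rw [ContinuousLinearMap.star_eq_adjoint]
    exact (Submodule.starProjection_isSymmetric (K := cyc D e)).isSelfAdjoint.adjoint_eq
  have h3 : k = P * k * P := by
    rw [hk, ← hφ.2 _ hPD _ hPD]
    congr 1
    conv_rhs => rw [← hPs, ← rankOne_apply_apply, hPs] 
    rw [hP, Submodule.starProjection_eq_self_iff.2 (self_mem_cyc e)]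
  have h4 : k = P ∘L K ∘L P := by
    rw [h3]
    ext x
    refine ext_inner_left ℂ fun y => ?_
    simp only [mul_apply_eq_comp, ContinuousLinearMap.comp_apply]
    rw [hP, ← Submodule.inner_starProjection_left_eq_right,
      ← Submodule.inner_starProjection_left_eq_right]
    exact h2 _ (Submodule.starProjection_apply_mem _ _) _ (Submodule.starProjection_apply_mem _ _)
  rw [h4]
  exact (hK.comp_clm P).clm_comp P

lemma isCompactOperator_map_rankOne (hD : IsMasa D) {φ : B H →L[ℂ] B H}
    (hφ : IsSchurMultiplier D φ) (v u : H) :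
    IsCompactOperator (φ (rk v u)) := by
  obtain ⟨e, hv, hu⟩ := exists_cyc_pair hD v u
  have hv' : v ∈ closure {y | ∃ a ∈ D, a e = y} := by rw [← coe_cyc]; exact hv
  have hu' : u ∈ closure {y | ∃ a ∈ D, a e = y} := by rw [← coe_cyc]; exact hu
  obtain ⟨y, hy, hylim⟩ := mem_closure_iff_seq_limit.1 hv'
  obtain ⟨z, hz, hzlim⟩ := mem_closure_iff_seq_limit.1 hu'
  have hR := tendsto_rk hylim hzlim
  have hlim : Filter.Tendsto (fun n => φ (rk (y n) (z n)))
      Filter.atTop (nhds (φ (rk v u))) :=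
    (φ.continuous.tendsto _).comp hR
  refine isCompactOperator_of_tendsto hlim (Filter.Eventually.of_forall fun n => ?_)
  obtain ⟨a, ha, hay⟩ := hy n
  obtain ⟨b, hb, hbz⟩ := hz n
  rw [← hay, ← hbz, rankOne_apply_apply, hφ.2 _ ha _ (star_mem hb), mul_assoc,
    ContinuousLinearMap.mul_def, ContinuousLinearMap.mul_def, ContinuousLinearMap.coe_comp,
    ContinuousLinearMap.coe_comp]
  have h1 := isCompactOperator_map_rankOne_self hD hφ e
  have h2 : IsCompactOperator (⇑(φ (rk e e)) ∘ ⇑(star b)) :=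
    h1.comp_clm (star b)
  exact h2.clm_comp a


end CompactRange

section TopSpace

variable {H : Type*} [NormedAddCommGroup H] [InnerProductSpace ℂ H] [CompleteSpace H]

/-- The space on which `A` is isometric, for a contraction `A`. -/
def topSpace (A : B H) : Submodule ℂ H :=
  Module.End.eigenspace ((star A * A : B H) : H →ₗ[ℂ] H) 1

lemma mem_topSpace {A : B H} {x : H} : x ∈ topSpace A ↔ (star A) (A x) = x := by
  rw [topSpace, Module.End.mem_eigenspace_iff]
  simp

lemma finiteDimensional_topSpace {A : B H} (hA : IsCompactOperator A) :
    FiniteDimensional ℂ (topSpace A) := by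
  have h : IsCompactOperator (star A * A : B H) := hA.clm_comp (star A)
  exact ContinuousLinearMap.finite_dimensional_eigenspace h 1 one_ne_zero

lemma inner_apply_apply_of_mem {A : B H} {x : H} (hx : x ∈ topSpace A) (y : H) :
    ⟪A x, A y⟫_ℂ = ⟪x, y⟫_ℂ := by
  rw [← ContinuousLinearMap.adjoint_inner_left, ← ContinuousLinearMap.star_eq_adjoint,
    mem_topSpace.1 hx]

lemma norm_apply_of_mem {A : B H} {x : H} (hx : x ∈ topSpace A) : ‖A x‖ = ‖x‖ := by
  have h := inner_apply_apply_of_mem hx x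
  rw [inner_self_eq_norm_sq_to_K, inner_self_eq_norm_sq_to_K] at h
  norm_cast at h
  exact (sq_eq_sq₀ (norm_nonneg _) (norm_nonneg _)).1 h

lemma norm_apply_le {A : B H} (hA : ‖A‖ ≤ 1) (x : H) : ‖A x‖ ≤ ‖x‖ := by
  have := A.le_of_opNorm_le hA x
  simpa using this

lemma norm_star_le {A : B H} (hA : ‖A‖ ≤ 1) : ‖star A‖ ≤ 1 := by rwa [norm_star]

lemma inner_star_apply (A : B H) (x y : H) : ⟪(star A) x, y⟫_ℂ = ⟪x, A y⟫_ℂ := by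
  rw [ContinuousLinearMap.star_eq_adjoint, ContinuousLinearMap.adjoint_inner_left]

lemma inner_star_apply_right (A : B H) (x y : H) : ⟪x, (star A) y⟫_ℂ = ⟪A x, y⟫_ℂ := by
  rw [ContinuousLinearMap.star_eq_adjoint, ContinuousLinearMap.adjoint_inner_right]

lemma mem_topSpace_of_norm {A : B H} (hA : ‖A‖ ≤ 1) {x : H} (hx : ‖A x‖ = ‖x‖) :
    x ∈ topSpace A := by
  rw [mem_topSpace, ← sub_eq_zero, ← norm_eq_zero, ← sq_eq_zero_iff]
  refine le_antisymm ?_ (by positivity)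
  rw [@norm_sub_sq ℂ, inner_star_apply, inner_self_eq_norm_sq]
  have h2 : ‖(star A) (A x)‖ ≤ ‖x‖ := (norm_apply_le (norm_star_le hA) _).trans hx.le
  have h3 : ‖(star A) (A x)‖ ^ 2 ≤ ‖x‖ ^ 2 := by gcongr
  rw [hx]
  linarith

/-- A compact operator attains its norm. -/
lemma exists_norm_attained {A : B H} (hA : IsCompactOperator A) (h0 : A ≠ 0) :
    ∃ x, ‖x‖ = 1 ∧ ‖A x‖ = ‖A‖ := by
  have hnt : Nontrivial (B H) := ⟨A, 0, h0⟩
  have hc : IsCompactOperator (star A * A : B H) := hA.clm_comp (star A)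
  have h1 : ‖star A * A‖ ∈ spectrum ℝ (star A * A) :=
    CStarAlgebra.norm_mem_spectrum_of_nonneg (star_mul_self_nonneg A)
  have h2 : ((‖star A * A‖ : ℝ) : ℂ) ∈ spectrum ℂ (star A * A) := by
    have := spectrum.algebraMap_mem ℂ h1
    simpa using this
  have hn : ‖star A * A‖ = ‖A‖ * ‖A‖ := CStarRing.norm_star_mul_self
  have hpos : 0 < ‖A‖ := norm_pos_iff.2 h0
  have h3 := (hc.hasEigenvalue_iff_mem_spectrum (by rw [hn]; norm_cast; positivity)).2 h2
  obtain ⟨v, hv⟩ := h3.exists_hasEigenvector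
  have hv0 : ‖v‖ ≠ 0 := norm_ne_zero_iff.2 hv.2
  have hv1 := hv.apply_eq_smul
  have h4 : ‖A v‖ = ‖A‖ * ‖v‖ := by
    have h5 : ⟪A v, A v⟫_ℂ = ((‖A‖ * ‖v‖) ^ 2 : ℝ) := by
      rw [← inner_star_apply_right]
      have : (star A) (A v) = ((‖star A * A‖ : ℝ) : ℂ) • v := hv1
      rw [this, inner_smul_right, inner_self_eq_norm_sq_to_K, hn]
      push_cast
      simp only [Complex.coe_algebraMap]
      ring
    rw [inner_self_eq_norm_sq_to_K] at h5
    have h6 : ‖A v‖ ^ 2 = (‖A‖ * ‖v‖) ^ 2 :=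
      Complex.ofReal_injective (by simpa using h5)
    exact (sq_eq_sq₀ (norm_nonneg _) (by positivity)).1 h6
  refine ⟨((‖v‖⁻¹ : ℝ) : ℂ) • v, ?_, ?_⟩
  · rw [norm_smul]; simp [hv0]
  · rw [map_smul, norm_smul, h4]
    simp
    field_simp

/-- A compact contraction is strictly contractive off its top space. -/
lemma exists_gap {A : B H} (hA : IsCompactOperator A) (hA1 : ‖A‖ ≤ 1) :
    ∃ s : ℝ, 0 ≤ s ∧ s < 1 ∧ ∀ w ∈ (topSpace A)ᗮ, ‖A w‖ ≤ s * ‖w‖ := by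
  have := finiteDimensional_topSpace hA
  set P := (topSpace A).starProjection with hP
  set C : B H := A * (1 - P) with hC
  have hCc : IsCompactOperator C := hA.comp_clm (1 - P)
  have hCw : ∀ w ∈ (topSpace A)ᗮ, C w = A w := by
    intro w hw
    have : P w = 0 := (Submodule.starProjection_apply_eq_zero_iff (topSpace A)).2 hw
    simp [hC, this]
  have hPn : ∀ x, ‖x - P x‖ ≤ ‖x‖ := by
    intro x
    have : x - P x = (topSpace A)ᗮ.starProjection x := by
      rw [Submodule.starProjection_orthogonal]; rfl
    rw [this]
    exact Submodule.norm_starProjection_apply_le _ _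
  refine ⟨‖C‖, norm_nonneg _, ?_, fun w hw => by rw [← hCw w hw]; exact C.le_opNorm w⟩
  by_contra hlt
  have hC0 : C ≠ 0 := by
    rintro h
    rw [h, norm_zero] at hlt
    exact hlt one_pos
  obtain ⟨x, hx1, hx⟩ := exists_norm_attained hCc hC0
  set w := x - P x with hw
  have hAw : C x = A w := rfl
  have h1 : ‖A w‖ ≤ ‖w‖ := norm_apply_le hA1 w
  have h2 : ‖w‖ ≤ 1 := (hPn x).trans hx1.le
  rw [hAw] at hx
  have h3 : ‖A w‖ = ‖w‖ := by linarith
  have h4 := mem_topSpace_of_norm hA1 h3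
  have h5 : w ∈ (topSpace A)ᗮ := Submodule.sub_starProjection_mem_orthogonal x
  have h6 : ⟪w, w⟫_ℂ = 0 := Submodule.inner_right_of_mem_orthogonal h4 h5
  have h7 : w = 0 := inner_self_eq_zero.1 h6
  rw [h7] at h3 hx
  simp at hx
  rw [← hx] at hlt
  exact hlt one_pos

/-- A perturbation vanishing on the top space changes the norm only to second order, so a
norming functional does not see it. -/
lemma killing_aux {A : B H} (hA1 : ‖A‖ ≤ 1) {E : Submodule ℂ H} [E.HasOrthogonalProjection]
    (hE : E ≤ topSpace A) {s : ℝ} (hs0 : 0 ≤ s) (hs1 : s < 1)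
    (hgap : ∀ w ∈ Eᗮ, ‖A w‖ ≤ s * ‖w‖)
    {ω : B H →ₗ[ℂ] ℂ} (hω : ∀ T, ‖ω T‖ ≤ ‖T‖) (hωA : ω A = 1)
    {T : B H} (hT : ∀ x ∈ E, T x = 0) : ω T = 0 := by
  have key : ∀ S : B H, (∀ x ∈ E, S x = 0) → (ω S).re ≤ 0 := by
    intro S hS
    set M := ‖S‖ with hM
    have hM0 : 0 ≤ M := norm_nonneg _
    set t0 := (1 - s) / (2 * (M + 1)) with ht0
    have ht0pos : 0 < t0 := by apply div_pos <;> linarith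
    set δ := 1 - ((1 + s) / 2) ^ 2 with hδ
    have hδpos : 0 < δ := by nlinarith
    have hbound : ∀ t : ℝ, 0 < t → t ≤ t0 →
        ‖A + (t : ℂ) • S‖ ^ 2 ≤ 1 + t ^ 2 * (M ^ 2 / δ) := by
      intro t ht htt
      have htM : s + t * M ≤ (1 + s) / 2 := by
        have h1 : t * M ≤ t0 * (M + 1) := by
          apply mul_le_mul htt (by linarith) hM0 ht0pos.le
        have h2 : t0 * (M + 1) = (1 - s) / 2 := by rw [ht0]; field_simp
        linarith
      have hpt : ∀ x, ‖(A + (t : ℂ) • S) x‖ ≤ Real.sqrt (1 + t ^ 2 * (M ^ 2 / δ)) * ‖x‖ := by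
        intro x
        set e := E.starProjection x with he
        set w := x - e with hw
        have heE : e ∈ E := Submodule.starProjection_apply_mem _ _
        have hwE : w ∈ Eᗮ := Submodule.sub_starProjection_mem_orthogonal x
        have hx : x = e + w := by simp [hw]
        have hew : ⟪e, w⟫_ℂ = 0 := Submodule.inner_right_of_mem_orthogonal heE hwE
        have hxn : ‖x‖ ^ 2 = ‖e‖ ^ 2 + ‖w‖ ^ 2 := by
          rw [hx, @norm_add_sq ℂ, hew]; simp
        have hsplit : (A + (t : ℂ) • S) x = A e + (A w + (t : ℂ) • S w) := by
          rw [hx]; simp [hS e heE]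
          abel
        have h1 : ⟪A e, A w + (t : ℂ) • S w⟫_ℂ = t * ⟪A e, S w⟫_ℂ := by
          rw [inner_add_right, inner_apply_apply_of_mem (hE heE), hew, inner_smul_right, zero_add]
        have h2 : RCLike.re ⟪A e, A w + (t : ℂ) • S w⟫_ℂ ≤ t * (‖e‖ * (M * ‖w‖)) := by
          refine (RCLike.re_le_norm _).trans ?_
          rw [h1, norm_mul, Complex.norm_real, Real.norm_of_nonneg ht.le]
          gcongr
          refine (norm_inner_le_norm _ _).trans ?_
          gcongr
          · exact norm_apply_le hA1 e
          · exact S.le_opNorm w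
        have h3 : ‖A w + (t : ℂ) • S w‖ ≤ (1 + s) / 2 * ‖w‖ := by
          calc ‖A w + (t : ℂ) • S w‖ ≤ ‖A w‖ + ‖(t : ℂ) • S w‖ := norm_add_le _ _
            _ ≤ s * ‖w‖ + t * (M * ‖w‖) := by
                rw [norm_smul, Complex.norm_real, Real.norm_of_nonneg ht.le]
                gcongr
                · exact hgap w hwE
                · exact S.le_opNorm w
            _ = (s + t * M) * ‖w‖ := by ring
            _ ≤ _ := by gcongr
        have h4 : ‖(A + (t : ℂ) • S) x‖ ^ 2 ≤ (1 + t ^ 2 * (M ^ 2 / δ)) * ‖x‖ ^ 2 := by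
          rw [hsplit, @norm_add_sq ℂ, hxn, norm_apply_of_mem (hE heE)]
          have h5 : ‖A w + (t : ℂ) • S w‖ ^ 2 ≤ ((1 + s) / 2 * ‖w‖) ^ 2 := by gcongr
          have h6 : 2 * (t * (‖e‖ * (M * ‖w‖))) ≤ δ * ‖w‖ ^ 2 + t ^ 2 * (M ^ 2 / δ) * ‖e‖ ^ 2 := by
            have h7 : 0 ≤ (δ * ‖w‖ - t * M * ‖e‖) ^ 2 / δ := by positivity
            have h8 : (δ * ‖w‖ - t * M * ‖e‖) ^ 2 / δ
                = δ * ‖w‖ ^ 2 + t ^ 2 * (M ^ 2 / δ) * ‖e‖ ^ 2 - 2 * (t * (‖e‖ * (M * ‖w‖))) := by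
              field_simp
              ring
            linarith
          have h9 : 0 ≤ t ^ 2 * (M ^ 2 / δ) * ‖w‖ ^ 2 := by positivity
          have h10 : ((1 + s) / 2 * ‖w‖) ^ 2 = ‖w‖ ^ 2 - δ * ‖w‖ ^ 2 := by rw [hδ]; ring
          nlinarith
        have h11 := Real.sqrt_le_sqrt h4
        rwa [Real.sqrt_sq (norm_nonneg _), Real.sqrt_mul (by positivity),
          Real.sqrt_sq (norm_nonneg _)] at h11
      have hop := ContinuousLinearMap.opNorm_le_bound _ (Real.sqrt_nonneg _) hpt
      calc ‖A + (t : ℂ) • S‖ ^ 2 ≤ (Real.sqrt (1 + t ^ 2 * (M ^ 2 / δ))) ^ 2 := by gcongr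
        _ = _ := Real.sq_sqrt (by positivity)
    by_contra hneg
    push Not at hneg
    set r := (ω S).re with hr
    set K := M ^ 2 / δ with hK
    have hK0 : 0 ≤ K := by positivity
    have hall : ∀ t : ℝ, 0 < t → t ≤ t0 → 2 * r ≤ t * K := by
      intro t ht htt
      have h1 := hbound t ht htt
      have h2 := hω (A + (t : ℂ) • S)
      rw [map_add, hωA, map_smul, smul_eq_mul] at h2
      have h3 : 1 + t * r ≤ ‖1 + (t : ℂ) * ω S‖ := by
        refine le_trans (le_of_eq ?_) (Complex.re_le_norm _)
        simp [hr]
      have h4 : 0 < 1 + t * r := by positivity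
      have h5 : (1 + t * r) ^ 2 ≤ 1 + t ^ 2 * K := by
        refine le_trans ?_ h1
        have := h3.trans h2
        gcongr
      have h6 : t * (2 * r) ≤ t * (t * K) := by nlinarith [sq_nonneg (t * r)]
      exact le_of_mul_le_mul_left h6 ht
    set t := min t0 (r / (K + 1)) with ht
    have htpos : 0 < t := lt_min ht0pos (by positivity)
    have h1 := hall t htpos (min_le_left _ _)
    have h2 : t * K ≤ r / (K + 1) * K := by gcongr; exact min_le_right _ _
    have h3 : r / (K + 1) * K ≤ r := by
      rw [div_mul_eq_mul_div, div_le_iff₀ (by positivity)]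
      nlinarith
    linarith
  have h := key ((starRingEnd ℂ (ω T)) • T) fun x hx => by simp [hT x hx]
  rw [map_smul, smul_eq_mul, Complex.conj_mul'] at h
  have h1 : ‖ω T‖ ^ 2 ≤ 0 := by exact_mod_cast h
  have h2 : ‖ω T‖ ^ 2 = 0 := le_antisymm h1 (by positivity)
  exact norm_eq_zero.1 (sq_eq_zero_iff.1 h2)

lemma killing_right {A : B H} (hA : IsCompactOperator A) (hA1 : ‖A‖ ≤ 1)
    {ω : B H →ₗ[ℂ] ℂ} (hω : ∀ T, ‖ω T‖ ≤ ‖T‖) (hωA : ω A = 1)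
    {T : B H} (hT : ∀ x ∈ topSpace A, T x = 0) : ω T = 0 := by
  have := finiteDimensional_topSpace hA
  obtain ⟨s, hs0, hs1, hgap⟩ := exists_gap hA hA1
  exact killing_aux hA1 le_rfl hs0 hs1 hgap hω hωA hT

lemma killing_left {A : B H} (hA : IsCompactOperator A) (hA1 : ‖A‖ ≤ 1)
    {ω : B H →ₗ[ℂ] ℂ} (hω : ∀ T, ‖ω T‖ ≤ ‖T‖) (hωA : ω A = 1)
    {T : B H} (hT : ∀ x ∈ topSpace A, ∀ y, ⟪A x, T y⟫_ℂ = 0) : ω T = 0 := by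
  have := finiteDimensional_topSpace hA
  obtain ⟨s, hs0, hs1, hgap⟩ := exists_gap hA hA1
  set E' := (topSpace A).map (A : H →ₗ[ℂ] H) with hE'
  let ω' : B H →ₗ[ℂ] ℂ :=
    { toFun := fun S => starRingEnd ℂ (ω (star S))
      map_add' := by simp
      map_smul' := by simp }
  have hω' : ∀ S, ‖ω' S‖ ≤ ‖S‖ := fun S => by
    change ‖starRingEnd ℂ (ω (star S))‖ ≤ _
    rw [RCLike.norm_conj]
    simpa using hω (star S)
  have hle : E' ≤ topSpace (star A) := by
    rintro _ ⟨x, hx, rfl⟩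
    rw [mem_topSpace, star_star]
    change A ((star A) (A x)) = A x
    rw [mem_topSpace.1 hx]
  have hgap' : ∀ w ∈ E'ᗮ, ‖(star A) w‖ ≤ s * ‖w‖ := by
    intro w hw
    have h1 : (star A) w ∈ (topSpace A)ᗮ := by
      rw [Submodule.mem_orthogonal]
      intro x hx
      rw [inner_star_apply_right]
      exact Submodule.inner_right_of_mem_orthogonal (K := E') ⟨x, hx, rfl⟩ hw
    have h2 : ‖(star A) w‖ * ‖(star A) w‖ ≤ (s * ‖w‖) * ‖(star A) w‖ := by
      calc ‖(star A) w‖ * ‖(star A) w‖ = ‖⟪(star A) w, (star A) w⟫_ℂ‖ := by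
            rw [inner_self_eq_norm_sq_to_K]; simp [sq]
        _ = ‖⟪w, A ((star A) w)⟫_ℂ‖ := by rw [inner_star_apply]
        _ ≤ ‖w‖ * (s * ‖(star A) w‖) :=
            (norm_inner_le_norm _ _).trans (by gcongr; exact hgap _ h1)
        _ = _ := by ring
    rcases eq_or_lt_of_le (norm_nonneg ((star A) w)) with h0 | h0
    · rw [← h0]; positivity
    · exact le_of_mul_le_mul_right h2 h0
  have h := killing_aux (norm_star_le hA1) hle hs0 hs1 hgap' hω'
    (by change starRingEnd ℂ (ω (star (star A))) = 1; simp [hωA]) (T := star T) (by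
      rintro _ ⟨x, hx, rfl⟩
      refine ext_inner_right ℂ fun y => ?_
      rw [inner_star_apply, inner_zero_left]
      exact hT x hx y)
  have h1 : starRingEnd ℂ (ω (star (star T))) = 0 := h
  simpa using h1

end TopSpace

section Rel

variable {H : Type*} [NormedAddCommGroup H] [InnerProductSpace ℂ H] [CompleteSpace H]
variable {D : StarSubalgebra ℂ (B H)}

lemma inner_self_of_norm_one {x : H} (hx : ‖x‖ = 1) : ⟪x, x⟫_ℂ = 1 := by
  rw [inner_self_eq_norm_sq_to_K, hx]; simp

/-- A contractive functional norming a compact contraction with one-dimensional top space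
is a vector functional. -/
lemma functional_eq_of_topSpace {A : B H} (hA : IsCompactOperator A) (hA1 : ‖A‖ ≤ 1)
    {ω : B H →ₗ[ℂ] ℂ} (hω : ∀ T, ‖ω T‖ ≤ ‖T‖) (hωA : ω A = 1) {x : H} (hx1 : ‖x‖ = 1)
    (hx : x ∈ topSpace A) (htop : ∀ y ∈ topSpace A, ∃ c : ℂ, y = c • x) (T : B H) :
    ω T = ⟪A x, T x⟫_ℂ := by
  have hxx := inner_self_of_norm_one hx1
  have hAx : ‖A x‖ = 1 := by rw [norm_apply_of_mem hx, hx1]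
  set c := ⟪A x, T x⟫_ℂ with hc
  set S : B H := T - c • A with hS
  have h1 : ω (S * (1 - rk x x)) = 0 := by
    refine killing_right hA hA1 hω hωA fun y hy => ?_
    obtain ⟨r, rfl⟩ := htop y hy
    have : (1 - rk x x : B H) (r • x) = 0 := by simp [hx1]
    rw [mul_apply_eq_comp, this, map_zero]
  have h2 : ω (S * rk x x) = 0 := by
    refine killing_left hA hA1 hω hωA fun y hy z => ?_
    obtain ⟨r, rfl⟩ := htop y hy
    have : ⟪A x, S x⟫_ℂ = 0 := by
      simp [hS, hAx, hc]
    rw [mul_apply_eq_comp, rk_apply, map_smul, map_smul, inner_smul_left, inner_smul_right, this]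
    simp
  have h3 : S * (1 - rk x x) + S * rk x x = S := by rw [← mul_add]; simp
  have h4 : ω S = 0 := by rw [← h3, map_add, h1, h2, add_zero]
  rw [hS, map_sub, map_smul, hωA, sub_eq_zero] at h4
  simpa using h4

lemma star_rk (v u : H) : star (rk v u) = rk u v := by
  refine ContinuousLinearMap.ext fun x => ext_inner_left ℂ fun y => ?_
  rw [inner_star_apply_right]
  simp only [rk_apply, inner_smul_left, inner_smul_right, inner_conj_symm]
  ring

lemma functional_eq_of_rk {ω : B H →ₗ[ℂ] ℂ} (hω : ∀ T, ‖ω T‖ ≤ ‖T‖) {v u : H} (hv : ‖v‖ = 1)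
    (hu : ‖u‖ = 1) (h : ω (rk v u) = 1) (T : B H) : ω T = ⟪v, T u⟫_ℂ := by
  have hAu : rk v u u = v := by simp [hu]
  rw [functional_eq_of_topSpace (isCompactOperator_rankOne v u) (by simp [hu, hv]) hω h hu ?_ ?_ T,
    hAu]
  · rw [mem_topSpace, star_rk, hAu]; simp [hv]
  · intro y hy
    rw [mem_topSpace, star_rk] at hy
    refine ⟨⟪u, y⟫_ℂ, ?_⟩
    conv_lhs => rw [← hy]
    simp [hv]

/-- `T ↦ ⟪v, φ(T) u⟫` coincides with `T ↦ ⟪v, T u⟫`. -/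
def Rel (φ : B H →L[ℂ] B H) (u v : H) : Prop := ∀ T, ⟪v, φ T u⟫_ℂ = ⟪v, T u⟫_ℂ

/-- The functional `T ↦ ⟪v, φ(T) u⟫`. -/
def relFunctional (φ : B H →L[ℂ] B H) (u v : H) : B H →ₗ[ℂ] ℂ :=
  vecFunctional u v ∘ₗ φ.toLinearMap

@[simp] lemma relFunctional_apply (φ : B H →L[ℂ] B H) (u v : H) (T : B H) :
    relFunctional φ u v T = ⟪v, φ T u⟫_ℂ := rfl

lemma norm_relFunctional_le {φ : B H →L[ℂ] B H} (hc : ‖φ‖ ≤ 1) {u v : H} (hu : ‖u‖ ≤ 1)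
    (hv : ‖v‖ ≤ 1) (T : B H) : ‖relFunctional φ u v T‖ ≤ ‖T‖ := by
  have h1 : ‖φ T‖ ≤ ‖T‖ := by simpa using φ.le_of_opNorm_le hc T
  calc ‖⟪v, φ T u⟫_ℂ‖ ≤ ‖v‖ * (‖φ T‖ * ‖u‖) :=
        (norm_inner_le_norm _ _).trans (by gcongr; exact (φ T).le_opNorm u)
    _ ≤ 1 * (‖T‖ * 1) := by gcongr
    _ = ‖T‖ := by ring

lemma IsSchurMultiplier.left {φ : B H →L[ℂ] B H} (h : IsSchurMultiplier D φ) {a : B H}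
    (ha : a ∈ D) (T : B H) : φ (a * T) = a * φ T := by
  simpa using h.2 a ha 1 (one_mem D) T

lemma IsSchurMultiplier.right {φ : B H →L[ℂ] B H} (h : IsSchurMultiplier D φ) {a : B H}
    (ha : a ∈ D) (T : B H) : φ (T * a) = φ T * a := by
  simpa using h.2 1 (one_mem D) a ha T

lemma exists_one_dimensional (hD : IsMasa D) {E : Submodule ℂ H} {x : H} (hx : x ∈ E)
    (hx1 : ‖x‖ = 1)
    (h : ∀ a ∈ D, ∃ c : ℝ, ∀ z ∈ E, ‖z‖ = 1 → ‖a z‖ = c) :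
    ∀ y ∈ E, ∃ c : ℂ, y = c • x := by
  have h' : ∀ a ∈ D, ∃ c : ℝ, ∀ z ∈ E, ‖a z‖ = c * ‖z‖ := by
    intro a ha
    obtain ⟨c, hc⟩ := h a ha
    refine ⟨c, fun z hz => ?_⟩
    rcases eq_or_ne z 0 with rfl | hz0
    · simp
    have hz1 : ‖z‖ ≠ 0 := norm_ne_zero_iff.2 hz0
    have := hc (((‖z‖⁻¹ : ℝ) : ℂ) • z) (E.smul_mem _ hz) (by rw [norm_smul]; simp [hz1])
    rw [map_smul, norm_smul] at this
    simp at this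
    field_simp at this
    linarith
  have horth : ∀ y ∈ E, ⟪x, y⟫_ℂ = 0 → y = 0 := by
    intro y hy hxy
    have h1 : ∀ a ∈ D, ⟪a x, a y⟫_ℂ = 0 := by
      intro a ha
      obtain ⟨c, hc⟩ := h' a ha
      have key : ∀ w ∈ E, ⟪x, w⟫_ℂ = 0 → RCLike.re ⟪a x, a w⟫_ℂ = 0 := by
        intro w hw hxw
        have h2 := hc (x + w) (E.add_mem hx hw)
        have h3 := congrArg (fun r => r ^ 2) h2
        simp only [map_add, mul_pow] at h3
        rw [@norm_add_sq ℂ, @norm_add_sq ℂ, hc x hx, hc w hw, hxw] at h3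
        simp at h3
        have : RCLike.re ⟪a x, a w⟫_ℂ = (⟪a x, a w⟫_ℂ).re := rfl
        rw [this]
        nlinarith
      have h4 := key y hy hxy
      have h5 := key (Complex.I • y) (E.smul_mem _ hy) (by rw [inner_smul_right, hxy, mul_zero])
      rw [map_smul, inner_smul_right] at h5
      simp at h5 h4
      exact Complex.ext h4 (by simpa using h5)
    have hns : ∀ b ∈ D, ⟪x, (star b) (b y)⟫_ℂ = 0 := fun b hb => by
      rw [inner_star_apply_right]; exact h1 b hb
    have h2 : ∀ b ∈ D, ⟪x, b y⟫_ℂ = 0 := by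
      intro b hb
      have h3 := hns (1 + b) (add_mem (one_mem D) hb)
      have h4 := hns (1 + Complex.I • b) (add_mem (one_mem D) (D.toSubalgebra.smul_mem hb _))
      have h5 := hns b hb
      simp [inner_smul_right, hxy, h5] at h3 h4
      have h6 : Complex.I * (⟪x, b y⟫_ℂ - ⟪x, (star b) y⟫_ℂ) = 0 := by linear_combination h4
      have h7 := (mul_eq_zero.1 h6).resolve_left Complex.I_ne_zero
      linear_combination (h3 + h7) / 2
    set p := (cyc D y).starProjection with hp
    have hpD : p ∈ D := starProjection_mem hD (inv_cyc y)
    have hpx : p x = 0 := by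
      rw [hp, Submodule.starProjection_apply_eq_zero_iff, Submodule.mem_orthogonal']
      intro z hz
      have hle : cyc D y ≤ (ℂ ∙ x)ᗮ := by
        have hz' : z ∈ closure {w | ∃ a ∈ D, a y = w} := by rw [← coe_cyc]; exact hz
        intro z hz
        have hz' : z ∈ closure {w | ∃ a ∈ D, a y = w} := by rw [← coe_cyc]; exact hz
        refine closure_minimal ?_ (Submodule.isClosed_orthogonal _) hz'
        rintro _ ⟨a, ha, rfl⟩
        exact Submodule.mem_orthogonal_singleton_iff_inner_right.2 (h2 a ha)
      exact Submodule.mem_orthogonal_singleton_iff_inner_right.1 (hle hz)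
    have hpy : p y = y := Submodule.starProjection_eq_self_iff.2 (self_mem_cyc y)
    obtain ⟨c, hc⟩ := h' p hpD
    have h3 := hc x hx
    have h4 := hc y hy
    rw [hpx, hx1, norm_zero, mul_one] at h3
    rw [hpy, ← h3, zero_mul] at h4
    exact norm_eq_zero.1 h4
  intro y hy
  refine ⟨⟪x, y⟫_ℂ, ?_⟩
  have := horth (y - ⟪x, y⟫_ℂ • x) (E.sub_mem hy (E.smul_mem _ hx)) (by
    rw [inner_sub_right, inner_smul_right, inner_self_of_norm_one hx1]; simp)
  exact sub_eq_zero.1 this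

lemma exists_rel_of_topSpace (hD : IsMasa D) {φ : B H →L[ℂ] B H} (hφ : IsSchurMultiplier D φ)
    (hc : ‖φ‖ ≤ 1) {S : B H} (hS : IsCompactOperator S) (hS1 : ‖S‖ ≤ 1) (hφS : φ S = S) (n : ℕ) :
    ∀ A : B H, IsCompactOperator A → ‖A‖ ≤ 1 → Module.finrank ℂ (topSpace A) ≤ n →
      topSpace A ≠ ⊥ → topSpace A ≤ topSpace S → (∀ x ∈ topSpace A, A x = S x) →
      (∀ z ∈ topSpace A, ‖z‖ = 1 → ⟪S z, φ A z⟫_ℂ = 1) →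
      ∃ x, x ≠ 0 ∧ x ∈ topSpace S ∧ Rel φ x (S x) := by
  induction n with
  | zero =>
    intro A hA _ hn hne
    have := finiteDimensional_topSpace hA
    exact absurd (Submodule.finrank_eq_zero.1 (Nat.le_zero.1 hn)) hne
  | succ n ih =>
    intro A hA hA1 hn hne hle hAS hωA
    have := finiteDimensional_topSpace hA
    set P := (topSpace A).starProjection with hP
    have hPmem : ∀ x, P x ∈ topSpace A := Submodule.starProjection_apply_mem _
    have hPself : ∀ x ∈ topSpace A, P x = x := fun x hx =>
      Submodule.starProjection_eq_self_iff.2 hx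
    have hPstar : star P = P := (isSelfAdjoint_starProjection (topSpace A)).star_eq
    have hPn : ‖P‖ ≤ 1 := Submodule.starProjection_norm_le _
    obtain ⟨x0, hx0, hx0n⟩ := Submodule.exists_mem_ne_zero_of_ne_bot hne
    have hωle : ∀ z ∈ topSpace A, ‖z‖ = 1 → ∀ T, ‖relFunctional φ z (S z) T‖ ≤ ‖T‖ :=
      fun z hz hz1 => norm_relFunctional_le hc hz1.le
        (by rw [norm_apply_of_mem (hle hz)]; exact hz1.le)
    by_cases hconst : ∀ a ∈ D, ∃ c : ℝ, ∀ z ∈ topSpace A, ‖z‖ = 1 → ‖a z‖ = c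
    · set x : H := ((‖x0‖⁻¹ : ℝ) : ℂ) • x0 with hx
      have hxm : x ∈ topSpace A := Submodule.smul_mem _ _ hx0
      have hx1 : ‖x‖ = 1 := by
        have : ‖x0‖ ≠ 0 := norm_ne_zero_iff.2 hx0n
        rw [hx, norm_smul]; simp [this]
      refine ⟨x, fun h => by simp [h] at hx1, hle hxm, fun T => ?_⟩
      have := functional_eq_of_topSpace hA hA1 (hωle x hxm hx1) (hωA x hxm hx1) hx1 hxm
        (exists_one_dimensional hD hxm hx1 hconst) T
      rwa [hAS x hxm] at this
    · push Not at hconst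
      obtain ⟨a, ha, hac⟩ := hconst
      have haP : a * P ≠ 0 := by
        intro h0
        obtain ⟨z, hz, -, hz2⟩ := hac 0
        apply hz2
        have := congrArg (fun T : B H => T z) h0
        simp only [mul_apply_eq_comp, hPself z hz, zero_apply] at this
        rw [this, norm_zero]
      have hPc : IsCompactOperator P := by
        have : P = (topSpace A).subtypeL ∘L (topSpace A).orthogonalProjectionOnto := rfl
        rw [this]
        have h : IsCompactOperator (topSpace A).subtypeL :=
          isCompactOperator_of_locallyCompactSpace_rng _
        exact h.comp_clm (topSpace A).orthogonalProjectionOnto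
      obtain ⟨w, hw1, hw⟩ := exists_norm_attained (hPc.clm_comp a : IsCompactOperator (a * P)) haP
      set b := ‖a * P‖ with hb
      have hb0 : 0 < b := norm_pos_iff.2 haP
      have hle_b : ∀ x ∈ topSpace A, ‖a x‖ ≤ b * ‖x‖ := fun x hx => by
        have := (a * P).le_opNorm x
        rwa [mul_apply_eq_comp, hPself x hx] at this
      set R : B H := ((b⁻¹ : ℝ) : ℂ) • (a * P) with hR
      have hR1 : ‖R‖ ≤ 1 := by
        rw [hR, norm_smul, Complex.norm_real, Real.norm_of_nonneg (by positivity), ← hb,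
          inv_mul_cancel₀ hb0.ne']
      set A' : B H := S * (star R * R) with hA'
      have hA'c : IsCompactOperator A' := hS.comp_clm (star R * R)
      have hA'1 : ‖A'‖ ≤ 1 := by
        calc ‖A'‖ ≤ ‖S‖ * (‖star R‖ * ‖R‖) :=
              (norm_mul_le _ _).trans (by gcongr; exact norm_mul_le _ _)
          _ ≤ 1 * (1 * 1) := by gcongr; exact norm_star_le hR1
          _ = 1 := by ring
      have hRx : ∀ x ∈ topSpace A, ‖R x‖ = b⁻¹ * ‖a x‖ := fun x hx => by
        rw [hR, smul_apply, norm_smul, mul_apply_eq_comp, hPself x hx,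
          Complex.norm_real, Real.norm_of_nonneg (by positivity)]
      have hmem : ∀ x, x ∈ topSpace A' ↔ x ∈ topSpace A ∧ ‖a x‖ = b * ‖x‖ := by
        intro x
        constructor
        · intro hx
          have h1 : ‖A' x‖ = ‖x‖ := norm_apply_of_mem hx
          have h2 : ‖A' x‖ ≤ ‖(star R) (R x)‖ := norm_apply_le hS1 _
          have h3 : ‖(star R) (R x)‖ ≤ ‖R x‖ := norm_apply_le (norm_star_le hR1) _
          have h4 : ‖R x‖ ≤ ‖x‖ := norm_apply_le hR1 _
          have h5 : ‖R x‖ = ‖x‖ := by linarith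
          have h6 := mem_topSpace.1 (mem_topSpace_of_norm hR1 h5)
          have h7 : x ∈ topSpace A := by
            rw [← h6]
            have : star R = ((b⁻¹ : ℝ) : ℂ) • (P * star a) := by
              rw [hR, star_smul, star_mul, hPstar]
              simp
            rw [this]
            exact Submodule.smul_mem _ _ (hPmem _)
          refine ⟨h7, ?_⟩
          rw [hRx x h7] at h5
          rw [← h5]; field_simp
        · rintro ⟨hx, hx2⟩
          have h1 : ‖R x‖ = ‖x‖ := by rw [hRx x hx, hx2]; field_simp
          have h2 := mem_topSpace.1 (mem_topSpace_of_norm hR1 h1)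
          refine mem_topSpace_of_norm hA'1 ?_
          have : A' x = S x := by rw [hA', mul_apply_eq_comp, mul_apply_eq_comp, h2]
          rw [this, norm_apply_of_mem (hle hx)]
      have hA'x : ∀ x ∈ topSpace A', A' x = S x := by
        intro x hx
        have h1 := (hmem x).1 hx
        have h2 : ‖R x‖ = ‖x‖ := by rw [hRx x h1.1, h1.2]; field_simp
        have h3 := mem_topSpace.1 (mem_topSpace_of_norm hR1 h2)
        rw [hA', mul_apply_eq_comp, mul_apply_eq_comp, h3]
      have hlt : topSpace A' < topSpace A := by
        refine lt_of_le_of_ne (fun x hx => ((hmem x).1 hx).1) fun heq => ?_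
        obtain ⟨z, hz, hz1, hz2⟩ := hac b
        rw [← heq] at hz
        apply hz2
        rw [((hmem z).1 hz).2, hz1, mul_one]
      refine ih A' hA'c hA'1 ?_ ?_ (hlt.le.trans hle) hA'x ?_
      · have := Submodule.finrank_lt_finrank_of_lt hlt
        omega
      · have h1 : P w ∈ topSpace A' := by
          refine (hmem _).2 ⟨hPmem w, le_antisymm (hle_b _ (hPmem w)) ?_⟩
          have h2 : ‖P w‖ ≤ 1 := by simpa [hw1] using norm_apply_le hPn w
          have h3 : ‖a (P w)‖ = b := hw
          rw [h3]
          nlinarith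
        intro hbot
        rw [hbot, Submodule.mem_bot] at h1
        have h3 : ‖a (P w)‖ = b := hw
        rw [h1, map_zero, norm_zero] at h3
        exact hb0.ne h3
      · intro z hz hz1
        obtain ⟨hzA, hzb⟩ := (hmem z).1 hz
        set ω := relFunctional φ z (S z) with hω
        have hω1 := hωle z hzA hz1
        have hωA1 : ω A = 1 := hωA z hzA hz1
        have k1 : ω (S * star a * a * (1 - P)) = 0 := by
          refine killing_right hA hA1 hω1 hωA1 fun x hx => ?_
          have : (1 - P) x = 0 := by simp [hPself x hx]
          rw [mul_apply_eq_comp, this, map_zero]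
        have k2 : ω (S * (1 - P) * (star a * a * P)) = 0 := by
          refine killing_left hA hA1 hω1 hωA1 fun x hx y => ?_
          rw [hAS x hx, mul_apply_eq_comp, mul_apply_eq_comp,
            inner_apply_apply_of_mem (hle hx)]
          exact Submodule.inner_right_of_mem_orthogonal hx
            (Submodule.sub_starProjection_mem_orthogonal _)
        have k3 : ω (S * (star a * a)) = ((b ^ 2 : ℝ) : ℂ) := by
          rw [hω, relFunctional_apply, hφ.right (mul_mem (star_mem ha) ha), hφS,
            mul_apply_eq_comp, inner_apply_apply_of_mem (hle hzA), mul_apply_eq_comp,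
            inner_star_apply_right, inner_self_eq_norm_sq_to_K, hzb, hz1]
          simp
        have k4 : ((b ^ 2 : ℝ) : ℂ) • A' = S * (star a * a) - S * star a * a * (1 - P)
            - S * (1 - P) * (star a * a * P) := by
          have : star R * R = ((b⁻¹ ^ 2 : ℝ) : ℂ) • (P * star a * (a * P)) := by
            rw [hR, star_smul, star_mul, hPstar, smul_mul_smul_comm]
            simp [sq]
          rw [hA', this, mul_smul_comm, smul_smul]
          have h1 : ((b ^ 2 : ℝ) : ℂ) * ((b⁻¹ ^ 2 : ℝ) : ℂ) = 1 := by
            rw [← Complex.ofReal_mul, ← mul_pow, mul_inv_cancel₀ hb0.ne']; simp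
          rw [h1, one_smul]
          noncomm_ring
        have k5 : ((b ^ 2 : ℝ) : ℂ) * ω A' = ((b ^ 2 : ℝ) : ℂ) := by
          rw [← smul_eq_mul, ← map_smul, k4, map_sub, map_sub, k1, k2, k3]; simp
        have hb2 : ((b ^ 2 : ℝ) : ℂ) ≠ 0 := by
          norm_cast; positivity
        exact mul_left_cancel₀ hb2 (by rw [mul_one]; exact k5)

/-- A nonzero compact operator fixed by a contractive Schur multiplier has a related pair
of vectors supported on it. -/
lemma exists_rel_of_fixed (hD : IsMasa D) {φ : B H →L[ℂ] B H} (hφ : IsSchurMultiplier D φ)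
    (hc : ‖φ‖ ≤ 1) {S : B H} (hS : IsCompactOperator S) (h0 : S ≠ 0) (hφS : φ S = S) :
    ∃ u v, u ≠ 0 ∧ v ≠ 0 ∧ Rel φ u v ∧ ⟪v, S u⟫_ℂ ≠ 0 := by
  have hn : 0 < ‖S‖ := norm_pos_iff.2 h0
  set S' : B H := ((‖S‖⁻¹ : ℝ) : ℂ) • S with hS'
  have hS'c : IsCompactOperator S' := hS.smul _
  have hS'1 : ‖S'‖ = 1 := by
    rw [hS', norm_smul, Complex.norm_real, Real.norm_of_nonneg (by positivity),
      inv_mul_cancel₀ hn.ne']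
  obtain ⟨w, hw1, hw⟩ := exists_norm_attained hS'c (norm_ne_zero_iff.1 (by rw [hS'1]; simp))
  have hwt : w ∈ topSpace S' := mem_topSpace_of_norm hS'1.le (by rw [hw, hw1, hS'1])
  have hfix : φ S' = S' := by rw [hS', map_smul, hφS]
  obtain ⟨x, hx0, hx, hr⟩ := exists_rel_of_topSpace hD hφ hc hS'c hS'1.le hfix _ S' hS'c hS'1.le
    le_rfl (fun h => by
      rw [h, Submodule.mem_bot] at hwt
      simp [hwt] at hw1) le_rfl (fun _ _ => rfl) (fun z hz hz1 => by
      rw [hfix, inner_apply_apply_of_mem hz, inner_self_of_norm_one hz1])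
  have h1 : S' x ≠ 0 := fun h => hx0 (norm_eq_zero.1 (by rw [← norm_apply_of_mem hx, h, norm_zero]))
  refine ⟨x, S' x, hx0, h1, hr, ?_⟩
  have h2 : ⟪S' x, S' x⟫_ℂ ≠ 0 := inner_self_ne_zero.2 h1
  intro h3
  apply h2
  have h4 : S' x = ((‖S‖⁻¹ : ℝ) : ℂ) • S x := rfl
  rw [h4, inner_smul_right, ← h4, h3, mul_zero]

end Rel

section Blocks

universe u

variable {H : Type u} [NormedAddCommGroup H] [InnerProductSpace ℂ H] [CompleteSpace H]
variable {D : StarSubalgebra ℂ (B H)}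

/-- The vectors related to `v` on the left. -/
def relLeft (φ : B H →L[ℂ] B H) (v : H) : Submodule ℂ H where
  carrier := {u | Rel φ u v}
  add_mem' {a b} ha hb T := by rw [map_add, inner_add_right, ha, hb, map_add, inner_add_right]
  zero_mem' T := by simp
  smul_mem' c a ha T := by rw [map_smul, inner_smul_right, ha, map_smul, inner_smul_right]

/-- The vectors related to `u` on the right. -/
def relRight (φ : B H →L[ℂ] B H) (u : H) : Submodule ℂ H where
  carrier := {v | Rel φ u v}
  add_mem' {a b} ha hb T := by rw [inner_add_left, ha, hb, inner_add_left]
  zero_mem' T := by simp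
  smul_mem' c a ha T := by rw [inner_smul_left, ha, inner_smul_left]

@[simp] lemma mem_relLeft {φ : B H →L[ℂ] B H} {u v : H} : u ∈ relLeft φ v ↔ Rel φ u v := Iff.rfl

@[simp] lemma mem_relRight {φ : B H →L[ℂ] B H} {u v : H} : v ∈ relRight φ u ↔ Rel φ u v := Iff.rfl

lemma isClosed_relLeft (φ : B H →L[ℂ] B H) (v : H) : IsClosed (relLeft φ v : Set H) := by
  have : (relLeft φ v : Set H) = ⋂ T, {u | ⟪v, φ T u⟫_ℂ = ⟪v, T u⟫_ℂ} := by
    ext; simp [Rel]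
  rw [this]
  exact isClosed_iInter fun T => isClosed_eq (by fun_prop) (by fun_prop)

lemma isClosed_relRight (φ : B H →L[ℂ] B H) (u : H) : IsClosed (relRight φ u : Set H) := by
  have : (relRight φ u : Set H) = ⋂ T, {v | ⟪v, φ T u⟫_ℂ = ⟪v, T u⟫_ℂ} := by
    ext; simp [Rel]
  rw [this]
  exact isClosed_iInter fun T => isClosed_eq (by fun_prop) (by fun_prop)

lemma inv_relLeft {φ : B H →L[ℂ] B H} (hφ : IsSchurMultiplier D φ) (v : H) :
    Inv D (relLeft φ v) := by
  intro a ha u hu T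
  have := hu (T * a)
  rwa [hφ.right ha] at this

lemma inv_relRight {φ : B H →L[ℂ] B H} (hφ : IsSchurMultiplier D φ) (u : H) :
    Inv D (relRight φ u) := by
  intro a ha v hv T
  have := hv (star a * T)
  rw [hφ.left (star_mem ha), mul_apply_eq_comp, mul_apply_eq_comp,
    inner_star_apply_right, inner_star_apply_right] at this
  exact this

lemma cyc_le_orthogonal {x y : H} (h : y ∈ (cyc D x)ᗮ) : cyc D y ≤ (cyc D x)ᗮ :=
  cyc_le (inv_cyc x).orthogonal (Submodule.isClosed_orthogonal _) h

lemma starProjection_cyc_eq_zero {x y : H} (h : y ∈ (cyc D x)ᗮ) :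
    (cyc D y).starProjection x = 0 := by
  rw [Submodule.starProjection_apply_eq_zero_iff, Submodule.mem_orthogonal]
  intro z hz
  exact Submodule.inner_left_of_mem_orthogonal (self_mem_cyc x) (cyc_le_orthogonal h hz)

lemma starProjection_mul_rk_mul (P Q : Submodule ℂ H) [P.HasOrthogonalProjection]
    [Q.HasOrthogonalProjection] (v u : H) :
    Q.starProjection * rk v u * P.starProjection = rk (Q.starProjection v) (P.starProjection u) := by
  rw [rankOne_apply_apply, (isSelfAdjoint_starProjection P).star_eq]

lemma norm_rotation_le {u v u' v' : H} (hu : ‖u‖ = 1) (hv : ‖v‖ = 1) (hu' : ‖u'‖ = 1)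
    (hv' : ‖v'‖ = 1) (huu : ⟪u, u'⟫_ℂ = 0) (hvv : ⟪v, v'⟫_ℂ = 0) {s r : ℝ}
    (hsr : s ^ 2 + r ^ 2 = 1) :
    ‖(s : ℂ) • rk v u + (r : ℂ) • rk v' u + (r : ℂ) • rk v u' - (s : ℂ) • rk v' u'‖ ≤ 1 := by
  refine ContinuousLinearMap.opNorm_le_bound _ zero_le_one fun x => ?_
  rw [one_mul]
  set a := ⟪u, x⟫_ℂ with ha
  set b := ⟪u', x⟫_ℂ with hb
  have h1 : ((s : ℂ) • rk v u + (r : ℂ) • rk v' u + (r : ℂ) • rk v u' - (s : ℂ) • rk v' u') x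
      = (s * a + r * b) • v + (r * a - s * b) • v' := by
    simp only [add_apply, sub_apply, smul_apply, rk_apply, ← ha, ← hb]
    module
  have pyth : ∀ (c d : ℂ) (y z : H), ‖y‖ = 1 → ‖z‖ = 1 → ⟪y, z⟫_ℂ = 0 →
      ‖c • y + d • z‖ ^ 2 = ‖c‖ ^ 2 + ‖d‖ ^ 2 := by
    intro c d y z hy hz hyz
    rw [@norm_add_sq ℂ, inner_smul_left, inner_smul_right, hyz, norm_smul, norm_smul, hy, hz]
    simp
  have bessel : ‖a‖ ^ 2 + ‖b‖ ^ 2 ≤ ‖x‖ ^ 2 := by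
    have h2 : ‖x - (a • u + b • u')‖ ^ 2 = ‖x‖ ^ 2 - (‖a‖ ^ 2 + ‖b‖ ^ 2) := by
      rw [@norm_sub_sq ℂ, pyth a b u u' hu hu' huu, inner_add_right, inner_smul_right,
        inner_smul_right, ← inner_conj_symm x u, ← inner_conj_symm x u', ← ha, ← hb,
        Complex.mul_conj', Complex.mul_conj']
      have : RCLike.re ((‖a‖ : ℂ) ^ 2 + (‖b‖ : ℂ) ^ 2) = ‖a‖ ^ 2 + ‖b‖ ^ 2 := by
        norm_cast
      rw [this]
      ring
    have := sq_nonneg ‖x - (a • u + b • u')‖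
    linarith
  have h3 : ‖(s * a + r * b : ℂ)‖ ^ 2 + ‖(r * a - s * b : ℂ)‖ ^ 2 = ‖a‖ ^ 2 + ‖b‖ ^ 2 := by
    rw [← Complex.normSq_eq_norm_sq, ← Complex.normSq_eq_norm_sq, ← Complex.normSq_eq_norm_sq,
      ← Complex.normSq_eq_norm_sq]
    simp only [Complex.normSq_apply, Complex.add_re, Complex.add_im, Complex.sub_re,
      Complex.sub_im, Complex.mul_re, Complex.mul_im, Complex.ofReal_re, Complex.ofReal_im]
    linear_combination (a.re ^ 2 + a.im ^ 2 + b.re ^ 2 + b.im ^ 2) * hsr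
  rw [h1]
  refine (sq_le_sq₀ (norm_nonneg _) (norm_nonneg _)).1 ?_
  rw [pyth _ _ _ _ hv hv' hvv, h3]
  exact bessel

lemma rel_of_corner_aux (hD : IsMasa D) {φ : B H →L[ℂ] B H} (hφ : IsSchurMultiplier D φ)
    (hc : ‖φ‖ ≤ 1) {u v u' v' : H} (hu : ‖u‖ = 1) (hv : ‖v‖ = 1) (hu' : ‖u'‖ = 1)
    (hv' : ‖v'‖ = 1) (hou : u' ∈ (cyc D u)ᗮ) (hov : v' ∈ (cyc D v)ᗮ)
    (h1 : Rel φ u v) (h2 : Rel φ u v') (h3 : Rel φ u' v) : Rel φ u' v' := by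
  have huu : ⟪u, u'⟫_ℂ = 0 := Submodule.inner_right_of_mem_orthogonal (self_mem_cyc u) hou
  have hvv : ⟪v, v'⟫_ℂ = 0 := Submodule.inner_right_of_mem_orthogonal (self_mem_cyc v) hov
  have huu' : ⟪u', u⟫_ℂ = 0 := inner_eq_zero_symm.1 huu
  have hvv' : ⟪v', v⟫_ℂ = 0 := inner_eq_zero_symm.1 hvv
  set s : ℝ := 3 / 5 with hs
  set r : ℝ := 4 / 5 with hr
  have hsr : s ^ 2 + r ^ 2 = 1 := by norm_num [hs, hr]
  set T : B H := (s : ℂ) • rk v u + (r : ℂ) • rk v' u + (r : ℂ) • rk v u' - (s : ℂ) • rk v' u'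
    with hT
  have hT1 : ‖T‖ ≤ 1 := norm_rotation_le hu hv hu' hv' huu hvv hsr
  have hφT : ‖φ T‖ ≤ 1 := (by simpa using φ.le_of_opNorm_le hc T : ‖φ T‖ ≤ ‖T‖).trans hT1
  have hTu : T u = (s : ℂ) • v + (r : ℂ) • v' := by
    simp [hT, huu', hu]
  have hTu' : T u' = (r : ℂ) • v - (s : ℂ) • v' := by
    simp [hT, huu, hu']
  have i1 : ⟪v, φ T u⟫_ℂ = s := by
    rw [h1, hTu, inner_add_right, inner_smul_right, inner_smul_right, hvv,
      inner_self_of_norm_one hv]; simp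
  have i2 : ⟪v', φ T u⟫_ℂ = r := by
    rw [h2, hTu, inner_add_right, inner_smul_right, inner_smul_right, hvv',
      inner_self_of_norm_one hv']; simp
  have i3 : ⟪v, φ T u'⟫_ℂ = r := by
    rw [h3, hTu', inner_sub_right, inner_smul_right, inner_smul_right, hvv,
      inner_self_of_norm_one hv]; simp
  have hn : ‖(s : ℂ) • v + (r : ℂ) • v'‖ ^ 2 = 1 := by
    rw [@norm_add_sq ℂ, inner_smul_left, inner_smul_right, hvv, norm_smul, norm_smul, hv, hv']
    simp [hsr]
  have i4 : φ T u = (s : ℂ) • v + (r : ℂ) • v' := by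
    have hle : ‖φ T u‖ ≤ 1 := by simpa [hu] using norm_apply_le hφT u
    have : ‖φ T u - ((s : ℂ) • v + (r : ℂ) • v')‖ ^ 2 ≤ 0 := by
      rw [norm_sub_rev, @norm_sub_sq ℂ, hn, inner_add_left, inner_smul_left, inner_smul_left,
        i1, i2]
      have : RCLike.re ((starRingEnd ℂ) (s : ℂ) * (s : ℂ) + (starRingEnd ℂ) (r : ℂ) * (r : ℂ))
          = s ^ 2 + r ^ 2 := by
        simp [sq]
      rw [this, hsr]
      nlinarith [norm_nonneg (φ T u)]
    have h0 := le_antisymm this (by positivity)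
    exact sub_eq_zero.1 (norm_eq_zero.1 (sq_eq_zero_iff.1 h0))
  have i5 : ⟪φ T u, φ T u'⟫_ℂ = 0 := by
    rw [inner_apply_apply_of_mem, huu]
    refine mem_topSpace_of_norm hφT ?_
    rw [i4, hu]
    exact (sq_eq_sq₀ (norm_nonneg _) zero_le_one).1 (by rw [hn]; simp)
  have i6 : ⟪v', φ T u'⟫_ℂ = -(s : ℂ) := by
    rw [i4, inner_add_left, inner_smul_left, inner_smul_left, i3] at i5
    simp only [Complex.conj_ofReal] at i5
    have hr0 : (r : ℂ) ≠ 0 := by norm_num [hr]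
    have : (r : ℂ) * (⟪v', φ T u'⟫_ℂ + s) = 0 := by linear_combination i5
    linear_combination (mul_eq_zero.1 this).resolve_left hr0
  set p := (cyc D u').starProjection with hp
  set q := (cyc D v').starProjection with hq
  have hpD : p ∈ D := starProjection_mem hD (inv_cyc _)
  have hqD : q ∈ D := starProjection_mem hD (inv_cyc _)
  have hpu' : p u' = u' := Submodule.starProjection_eq_self_iff.2 (self_mem_cyc _)
  have hqv' : q v' = v' := Submodule.starProjection_eq_self_iff.2 (self_mem_cyc _)
  have hpu : p u = 0 := starProjection_cyc_eq_zero hou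
  have hqv : q v = 0 := starProjection_cyc_eq_zero hov
  have hqTp : q * T * p = -(s : ℂ) • rk v' u' := by
    rw [hT]
    simp only [mul_add, add_mul, mul_sub, sub_mul, mul_smul_comm, smul_mul_assoc, hp, hq,
      starProjection_mul_rk_mul]
    simp only [← hp, ← hq, hpu, hqv, hpu', hqv']
    ext x
    simp
  have i7 : ⟪v', φ T u'⟫_ℂ = -(s : ℂ) * ⟪v', φ (rk v' u') u'⟫_ℂ := by
    have e : ⟪v', φ (q * T * p) u'⟫_ℂ = ⟪v', φ T u'⟫_ℂ := by
      rw [hφ.2 q hqD p hpD, mul_apply_eq_comp, mul_apply_eq_comp, hpu', hq,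
        ← Submodule.inner_starProjection_left_eq_right, ← hq, hqv']
    rw [← e, hqTp, map_smul, smul_apply, inner_smul_right]
  have hs0 : -(s : ℂ) ≠ 0 := by norm_num [hs]
  have i8 : relFunctional φ u' v' (rk v' u') = 1 := by
    rw [relFunctional_apply]
    rw [i6] at i7
    exact (mul_left_cancel₀ hs0 (by rw [← i7, mul_one]))
  exact functional_eq_of_rk (norm_relFunctional_le hc hu'.le hv'.le) hv' hu' i8

lemma rel_smul_iff {φ : B H →L[ℂ] B H} {u v : H} {c d : ℂ} (hc : c ≠ 0) (hd : d ≠ 0) :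
    Rel φ (c • u) (d • v) ↔ Rel φ u v := by
  have h1 : ∀ w, Rel φ (c • u) w ↔ Rel φ u w := fun w => (relLeft φ w).smul_mem_iff hc
  exact (h1 _).trans ((relRight φ u).smul_mem_iff hd)

lemma rel_of_corner (hD : IsMasa D) {φ : B H →L[ℂ] B H} (hφ : IsSchurMultiplier D φ)
    (hc : ‖φ‖ ≤ 1) {u v u' v' : H} (hu : u ≠ 0) (hv : v ≠ 0)
    (h1 : Rel φ u v) (h2 : Rel φ u v') (h3 : Rel φ u' v) : Rel φ u' v' := by
  have hcycL : ∀ w, Rel φ u w → cyc D u ≤ relLeft φ w := fun w hw =>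
    cyc_le (inv_relLeft hφ w) (isClosed_relLeft φ w) hw
  have hcycR : ∀ w, Rel φ w v → cyc D v ≤ relRight φ w := fun w hw =>
    cyc_le (inv_relRight hφ w) (isClosed_relRight φ w) hw
  set a := (cyc D u).starProjection u' with ha
  set b := (cyc D v).starProjection v' with hb
  have ham : a ∈ cyc D u := Submodule.starProjection_apply_mem _ _
  have hbm : b ∈ cyc D v := Submodule.starProjection_apply_mem _ _
  have hao : u' - a ∈ (cyc D u)ᗮ := Submodule.sub_starProjection_mem_orthogonal _
  have hbo : v' - b ∈ (cyc D v)ᗮ := Submodule.sub_starProjection_mem_orthogonal _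
  have j1 : Rel φ (u' - a) v := (relLeft φ v).sub_mem h3 (hcycL v h1 ham)
  have j2 : Rel φ u (v' - b) := (relRight φ u).sub_mem h2 (hcycR u h1 hbm)
  have main : Rel φ (u' - a) (v' - b) := by
    rcases eq_or_ne (u' - a) 0 with h0 | h0
    · rw [h0]; exact (relLeft φ (v' - b)).zero_mem
    rcases eq_or_ne (v' - b) 0 with k0 | k0
    · rw [k0]; exact (relRight φ (u' - a)).zero_mem
    have hne : ∀ {x : H}, x ≠ 0 → (((‖x‖⁻¹ : ℝ) : ℂ)) ≠ 0 := fun hx => by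
      simpa using hx
    have hnn : ∀ {x : H}, x ≠ 0 → ‖((‖x‖⁻¹ : ℝ) : ℂ) • x‖ = 1 := fun {x} hx => by
      have : ‖x‖ ≠ 0 := norm_ne_zero_iff.2 hx
      rw [norm_smul]; simp [this]
    have hcyc : ∀ {x y : H} (c d : ℂ), y ∈ (cyc D x)ᗮ → d • y ∈ (cyc D (c • x))ᗮ := by
      intro x y c d hy
      refine Submodule.smul_mem _ _ (Submodule.orthogonal_le ?_ hy)
      exact cyc_le (inv_cyc x) (isClosed_cyc x) (Submodule.smul_mem _ _ (self_mem_cyc x))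
    refine (rel_smul_iff (hne h0) (hne k0)).1 (rel_of_corner_aux hD hφ hc (hnn hu) (hnn hv)
      (hnn h0) (hnn k0) (hcyc _ _ hao) (hcyc _ _ hbo) ((rel_smul_iff (hne hu) (hne hv)).2 h1)
      ((rel_smul_iff (hne hu) (hne k0)).2 j2) ((rel_smul_iff (hne h0) (hne hv)).2 j1))
  have m2 : Rel φ (u' - a) v' := by
    have := (relRight φ (u' - a)).add_mem main (hcycR _ j1 hbm)
    simpa using this
  have := (relLeft φ v').add_mem m2 (hcycL _ h2 ham)
  simpa using this

/-- A contractive Schur multiplier has an orthogonal family of blocks `qᵢ B(H) pᵢ` on which it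
is the identity, and which carries all related pairs. -/
lemma exists_blocks (hD : IsMasa D) {φ : B H →L[ℂ] B H} (hφ : IsSchurMultiplier D φ)
    (hc : ‖φ‖ ≤ 1) : ∃ (ι : Type u) (P Q : ι → Submodule ℂ H),
      (∀ i, IsClosed (P i : Set H)) ∧ (∀ i, IsClosed (Q i : Set H)) ∧
      (∀ i, Inv D (P i)) ∧ (∀ i, Inv D (Q i)) ∧
      (∀ i j, i ≠ j → P i ≤ (P j)ᗮ) ∧ (∀ i j, i ≠ j → Q i ≤ (Q j)ᗮ) ∧
      (∀ i, ∀ u ∈ P i, ∀ v ∈ Q i, Rel φ u v) ∧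
      (∀ u v, u ≠ 0 → v ≠ 0 → Rel φ u v → ∃ i, u ∈ P i ∧ v ∈ Q i) := by
  let ι := {PQ : Submodule ℂ H × Submodule ℂ H //
    ∃ u v, u ≠ 0 ∧ v ≠ 0 ∧ Rel φ u v ∧ PQ = (relLeft φ v, relRight φ u)}
  have hclP : ∀ i : ι, IsClosed (i.1.1 : Set H) := by
    rintro ⟨_, u, v, -, -, -, rfl⟩; exact isClosed_relLeft _ _
  have hclQ : ∀ i : ι, IsClosed (i.1.2 : Set H) := by
    rintro ⟨_, u, v, -, -, -, rfl⟩; exact isClosed_relRight _ _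
  have hinvP : ∀ i : ι, Inv D i.1.1 := by
    rintro ⟨_, u, v, -, -, -, rfl⟩; exact inv_relLeft hφ _
  have hinvQ : ∀ i : ι, Inv D i.1.2 := by
    rintro ⟨_, u, v, -, -, -, rfl⟩; exact inv_relRight hφ _
  have hrel : ∀ i : ι, ∀ u ∈ i.1.1, ∀ v ∈ i.1.2, Rel φ u v := by
    rintro ⟨_, u, v, hu, hv, h, rfl⟩ u1 hu1 v1 hv1
    exact rel_of_corner hD hφ hc hu hv h hv1 hu1
  have hP : ∀ i : ι, ∀ v ∈ i.1.2, v ≠ 0 → i.1.1 = relLeft φ v := by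
    rintro ⟨_, u, v, hu, hv, h, rfl⟩ v1 hv1 hv10
    ext w
    exact ⟨fun hw => rel_of_corner hD hφ hc hu hv h hv1 hw,
      fun hw => rel_of_corner hD hφ hc hu hv10 hv1 h hw⟩
  have hQ : ∀ i : ι, ∀ u ∈ i.1.1, u ≠ 0 → i.1.2 = relRight φ u := by
    rintro ⟨_, u, v, hu, hv, h, rfl⟩ u1 hu1 hu10
    ext w
    exact ⟨fun hw => rel_of_corner hD hφ hc hu hv h hw hu1,
      fun hw => rel_of_corner hD hφ hc hu10 hv hu1 hw h⟩
  have hneP : ∀ i : ι, ∃ u ∈ i.1.1, u ≠ 0 := by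
    rintro ⟨_, u, v, hu, hv, h, rfl⟩; exact ⟨u, h, hu⟩
  have hneQ : ∀ i : ι, ∃ v ∈ i.1.2, v ≠ 0 := by
    rintro ⟨_, u, v, hu, hv, h, rfl⟩; exact ⟨v, h, hv⟩
  have hinterP : ∀ i j : ι, ∀ u ∈ i.1.1, u ∈ j.1.1 → u ≠ 0 → i = j := by
    intro i j u hi hj h0
    have h1 : i.1.2 = j.1.2 := (hQ i u hi h0).trans (hQ j u hj h0).symm
    obtain ⟨v, hv, hv0⟩ := hneQ i
    have h2 : i.1.1 = j.1.1 := (hP i v hv hv0).trans (hP j v (h1 ▸ hv) hv0).symm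
    exact Subtype.ext (Prod.ext h2 h1)
  have hinterQ : ∀ i j : ι, ∀ u ∈ i.1.2, u ∈ j.1.2 → u ≠ 0 → i = j := by
    intro i j u hi hj h0
    have h1 : i.1.1 = j.1.1 := (hP i u hi h0).trans (hP j u hj h0).symm
    obtain ⟨v, hv, hv0⟩ := hneP i
    have h2 : i.1.2 = j.1.2 := (hQ i v hv hv0).trans (hQ j v (h1 ▸ hv) hv0).symm
    exact Subtype.ext (Prod.ext h1 h2)
  have horth : ∀ S S' : Submodule ℂ H, IsClosed (S' : Set H) → Inv D S → Inv D S' →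
      (∀ u ∈ S, u ∈ S' → u = 0) → S ≤ S'ᗮ := by
    intro S S' hcl hS hS' h u hu
    have : CompleteSpace S' := hcl.completeSpace_coe
    rw [← Submodule.starProjection_apply_eq_zero_iff]
    exact h _ (hS _ (starProjection_mem hD hS') _ hu) (Submodule.starProjection_apply_mem _ _)
  refine ⟨ι, fun i => i.1.1, fun i => i.1.2, hclP, hclQ, hinvP, hinvQ, ?_, ?_, hrel, ?_⟩
  · intro i j hij
    refine horth _ _ (hclP j) (hinvP i) (hinvP j) fun u hi hj => ?_
    by_contra h0
    exact hij (hinterP i j u hi hj h0)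
  · intro i j hij
    refine horth _ _ (hclQ j) (hinvQ i) (hinvQ j) fun u hi hj => ?_
    by_contra h0
    exact hij (hinterQ i j u hi hj h0)
  · intro u v hu hv h
    exact ⟨⟨(relLeft φ v, relRight φ u), u, v, hu, hv, h, rfl⟩, h, h⟩

end Blocks

section OrthoProj

universe u

variable {H : Type u} [NormedAddCommGroup H] [InnerProductSpace ℂ H] [CompleteSpace H]
variable {D : StarSubalgebra ℂ (B H)}

/-- A family of mutually orthogonal projections. -/
structure OrthoProj {ι : Type*} (p : ι → B H) : Prop where
  star_eq : ∀ i, star (p i) = p i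
  mul_self : ∀ i, p i * p i = p i
  mul_eq_zero : ∀ i j, i ≠ j → p i * p j = 0

namespace OrthoProj

variable {ι : Type*} {p : ι → B H}

lemma apply_self (h : OrthoProj p) (i : ι) (x : H) : p i (p i x) = p i x := by
  rw [← mul_apply_eq_comp, h.mul_self]

lemma apply_ne (h : OrthoProj p) {i j : ι} (hij : i ≠ j) (x : H) : p i (p j x) = 0 := by
  rw [← mul_apply_eq_comp, h.mul_eq_zero i j hij, zero_apply]

lemma inner_left (h : OrthoProj p) (i : ι) (x y : H) : ⟪p i x, y⟫_ℂ = ⟪x, p i y⟫_ℂ := by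
  rw [← inner_star_apply, h.star_eq]

lemma inner_apply (h : OrthoProj p) (i : ι) (x : H) : ⟪x, p i x⟫_ℂ = ((‖p i x‖ ^ 2 : ℝ) : ℂ) := by
  rw [← h.apply_self, ← h.inner_left, inner_self_eq_norm_sq_to_K, h.apply_self]; simp

lemma sum_mul_self (h : OrthoProj p) (s : Finset ι) : (∑ i ∈ s, p i) * ∑ i ∈ s, p i = ∑ i ∈ s, p i := by
  rw [Finset.sum_mul_sum]
  refine Finset.sum_congr rfl fun i hi => ?_
  rw [Finset.sum_eq_single i (fun j _ hj => h.mul_eq_zero i j hj.symm) (fun hn => absurd hi hn),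
    h.mul_self]

lemma star_sum (h : OrthoProj p) (s : Finset ι) : star (∑ i ∈ s, p i) = ∑ i ∈ s, p i := by
  rw [_root_.star_sum]; exact Finset.sum_congr rfl fun i _ => h.star_eq i

lemma norm_sum_apply_sq (h : OrthoProj p) (s : Finset ι) (x : H) :
    ‖(∑ i ∈ s, p i) x‖ ^ 2 = ∑ i ∈ s, ‖p i x‖ ^ 2 := by
  have h1 : ⟪(∑ i ∈ s, p i) x, (∑ i ∈ s, p i) x⟫_ℂ = ((∑ i ∈ s, ‖p i x‖ ^ 2 : ℝ) : ℂ) := by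
    rw [← inner_star_apply_right, h.star_sum, ← mul_apply_eq_comp, h.sum_mul_self,
      _root_.sum_apply, inner_sum, Complex.ofReal_sum]
    exact Finset.sum_congr rfl fun i _ => h.inner_apply i x
  rw [inner_self_eq_norm_sq_to_K] at h1
  exact Complex.ofReal_injective (by simpa using h1)

lemma norm_sum_apply_le (h : OrthoProj p) (s : Finset ι) (x : H) : ‖(∑ i ∈ s, p i) x‖ ≤ ‖x‖ := by
  set P := ∑ i ∈ s, p i with hP
  have h1 : ‖P x‖ * ‖P x‖ ≤ ‖x‖ * ‖P x‖ := by
    calc ‖P x‖ * ‖P x‖ = ‖⟪P x, P x⟫_ℂ‖ := by rw [inner_self_eq_norm_sq_to_K]; simp [sq]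
      _ = ‖⟪x, P x⟫_ℂ‖ := by
          rw [← inner_star_apply_right, hP, h.star_sum, ← mul_apply_eq_comp, h.sum_mul_self]
      _ ≤ _ := norm_inner_le_norm _ _
  rcases eq_or_lt_of_le (norm_nonneg (P x)) with h0 | h0
  · rw [← h0]; positivity
  · exact le_of_mul_le_mul_right h1 h0

lemma norm_sum_le (h : OrthoProj p) (s : Finset ι) : ‖∑ i ∈ s, p i‖ ≤ 1 :=
  ContinuousLinearMap.opNorm_le_bound _ zero_le_one fun x => by
    rw [one_mul]; exact h.norm_sum_apply_le s x

lemma norm_le (h : OrthoProj p) (i : ι) : ‖p i‖ ≤ 1 := by simpa using h.norm_sum_le {i}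

lemma sum_norm_sq_le (h : OrthoProj p) (s : Finset ι) (x : H) : ∑ i ∈ s, ‖p i x‖ ^ 2 ≤ ‖x‖ ^ 2 := by
  rw [← h.norm_sum_apply_sq]
  exact pow_le_pow_left₀ (norm_nonneg _) (h.norm_sum_apply_le s x) 2

lemma summable_norm_sq (h : OrthoProj p) (x : H) : Summable fun i => ‖p i x‖ ^ 2 :=
  summable_of_sum_le (fun _ => by positivity) fun s => h.sum_norm_sq_le s x

lemma summable_apply (h : OrthoProj p) (x : H) : Summable fun i => p i x := by
  rw [summable_iff_vanishing_norm]
  intro ε hε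
  obtain ⟨s, hs⟩ := summable_iff_vanishing_norm.1 (h.summable_norm_sq x) (ε ^ 2) (by positivity)
  refine ⟨s, fun t ht => ?_⟩
  have h1 := hs t ht
  rw [Real.norm_of_nonneg (by positivity), ← h.norm_sum_apply_sq] at h1
  rw [← _root_.sum_apply]
  exact lt_of_pow_lt_pow_left₀ 2 hε.le h1

lemma sum_mul_le (h : OrthoProj p) {q : ι → B H} (hq : OrthoProj q) (s : Finset ι) (x y : H) :
    ∑ i ∈ s, ‖q i y‖ * ‖p i x‖ ≤ ‖y‖ * ‖x‖ := by
  refine (Real.sum_mul_le_sqrt_mul_sqrt s _ _).trans ?_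
  gcongr
  · exact (Real.sqrt_le_sqrt (hq.sum_norm_sq_le s y)).trans (by rw [Real.sqrt_sq (norm_nonneg _)])
  · exact (Real.sqrt_le_sqrt (h.sum_norm_sq_le s x)).trans (by rw [Real.sqrt_sq (norm_nonneg _)])

lemma summable_mul (h : OrthoProj p) {q : ι → B H} (hq : OrthoProj q) (x y : H) :
    Summable fun i => ‖q i y‖ * ‖p i x‖ :=
  summable_of_sum_le (fun _ => by positivity) fun s => h.sum_mul_le hq s x y

/-- The projection onto the common kernel of a family of projections. -/
lemma exists_kernel_projection (h : OrthoProj p) (hD : IsMasa D) (hpD : ∀ i, p i ∈ D) :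
    ∃ e ∈ D, ‖e‖ ≤ 1 ∧ (∀ i, p i * e = 0) ∧ (∀ i, e * p i = 0) ∧
      ∀ x, HasSum (fun i => p i x) (x - e x) := by
  let S : Submodule ℂ H := ⨅ i, LinearMap.ker (p i : H →ₗ[ℂ] H)
  have hmem : ∀ x, x ∈ S ↔ ∀ i, p i x = 0 := fun x => by simp [S]
  have hcl : IsClosed (S : Set H) := by
    have : (S : Set H) = ⋂ i, {x | p i x = 0} := by
      ext x; simp [hmem]
    rw [this]
    exact isClosed_iInter fun i => isClosed_eq (p i).continuous continuous_const
  have hinv : Inv D S := by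
    intro a ha x hx
    rw [hmem] at hx ⊢
    intro i
    rw [← mul_apply_eq_comp, hD.1 _ (hpD i) _ ha, mul_apply_eq_comp, hx i, map_zero]
  have : CompleteSpace S := hcl.completeSpace_coe
  have heD := starProjection_mem hD hinv
  have h0 : ∀ i, p i * S.starProjection = 0 := fun i => by
    ext x
    exact (hmem _).1 (Submodule.starProjection_apply_mem S x) i
  refine ⟨S.starProjection, heD, Submodule.starProjection_norm_le S, h0,
    fun i => by rw [hD.1 _ heD _ (hpD i), h0], fun x => ?_⟩
  have hs := (h.summable_apply x).hasSum
  set y := ∑' i, p i x with hy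
  have hyx : S.starProjection x = x - y := by
    refine (Submodule.eq_starProjection_of_mem_orthogonal ?_ ?_)
    · rw [hmem]
      intro j
      have h1 := hs.mapL (p j)
      have h2 : HasSum (fun i => p j (p i x)) (p j x) := by
        have := hasSum_single (f := fun i => p j (p i x)) j fun i hi => h.apply_ne hi.symm x
        rwa [h.apply_self] at this
      rw [map_sub, h1.unique h2, sub_self]
    · rw [sub_sub_cancel, Submodule.mem_orthogonal]
      intro z hz
      have h1 := hs.mapL (innerSL ℂ z)
      have h2 : ∀ i, innerSL ℂ z (p i x) = 0 := fun i => by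
        rw [innerSL_apply_apply, ← h.inner_left, (hmem z).1 hz i, inner_zero_left]
      simp only [h2] at h1
      exact h1.unique hasSum_zero
  rw [hyx, sub_sub_cancel]
  exact hs

end OrthoProj

lemma exists_orthoProj (hD : IsMasa D) {φ : B H →L[ℂ] B H} (hφ : IsSchurMultiplier D φ)
    (hc : ‖φ‖ ≤ 1) : ∃ (ι : Type u) (p q : ι → B H), OrthoProj p ∧ OrthoProj q ∧
      (∀ i, p i ∈ D) ∧ (∀ i, q i ∈ D) ∧ (∀ i T, φ (q i * T * p i) = q i * T * p i) ∧
      (∀ u v, u ≠ 0 → v ≠ 0 → Rel φ u v → ∃ i, p i u = u ∧ q i v = v) := by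
  obtain ⟨ι, P, Q, hPcl, hQcl, hPi, hQi, hPo, hQo, hrel, hcov⟩ := exists_blocks hD hφ hc
  have hP : ∀ i, CompleteSpace (P i) := fun i => (hPcl i).completeSpace_coe
  have hQ : ∀ i, CompleteSpace (Q i) := fun i => (hQcl i).completeSpace_coe
  have ortho : ∀ (S : ι → Submodule ℂ H) [∀ i, CompleteSpace (S i)],
      (∀ i j, i ≠ j → S i ≤ (S j)ᗮ) → OrthoProj fun i => (S i).starProjection := by
    intro S _ hS
    refine ⟨fun i => (isSelfAdjoint_starProjection (S i)).star_eq, fun i => ?_, fun i j hij => ?_⟩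
    · ext x
      exact Submodule.starProjection_eq_self_iff.2 (Submodule.starProjection_apply_mem _ _)
    · ext x
      exact (Submodule.starProjection_apply_eq_zero_iff _).2
        (hS j i hij.symm (Submodule.starProjection_apply_mem _ _))
  have hpD : ∀ i, (P i).starProjection ∈ D := fun i => starProjection_mem hD (hPi i)
  have hqD : ∀ i, (Q i).starProjection ∈ D := fun i => starProjection_mem hD (hQi i)
  refine ⟨ι, fun i => (P i).starProjection, fun i => (Q i).starProjection, ortho P hPo,
    ortho Q hQo, hpD, hqD, fun i T => ?_, fun u v hu hv h => ?_⟩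
  · refine ContinuousLinearMap.ext fun x => ext_inner_left ℂ fun y => ?_
    rw [hφ.2 _ (hqD i) _ (hpD i)]
    simp only [mul_apply_eq_comp]
    rw [← Submodule.inner_starProjection_left_eq_right,
      ← Submodule.inner_starProjection_left_eq_right]
    exact hrel i _ (Submodule.starProjection_apply_mem _ _) _
      (Submodule.starProjection_apply_mem _ _) T
  · obtain ⟨i, hi, hi'⟩ := hcov u v hu hv h
    exact ⟨i, Submodule.starProjection_eq_self_iff.2 hi, Submodule.starProjection_eq_self_iff.2 hi'⟩

lemma isCompactOperator_sum {ι : Type*} (s : Finset ι) (f : ι → B H)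
    (hf : ∀ i, IsCompactOperator (f i)) : IsCompactOperator (∑ i ∈ s, f i : B H) := by
  classical
  induction s using Finset.induction_on with
  | empty => simpa using (isCompactOperator_zero : IsCompactOperator (0 : H → H))
  | insert a s ha ih => rw [Finset.sum_insert ha]; exact (hf a).add ih

lemma map_rk_eq (hD : IsMasa D) {φ : B H →L[ℂ] B H} (hφ : IsSchurIdempotent D φ)
    (hc : ‖φ‖ ≤ 1) {ι : Type*} {p q : ι → B H} (hp : OrthoProj p) (hq : OrthoProj q)
    (hfix : ∀ i T, φ (q i * T * p i) = q i * T * p i)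
    (hrel : ∀ u v, u ≠ 0 → v ≠ 0 → Rel φ u v → ∃ i, p i u = u ∧ q i v = v) (v u : H) :
    HasSum (fun i => rk (q i v) (p i u)) (φ (rk v u)) := by
  have hs : Summable fun i => (rk (q i v) (p i u) : B H) := by
    refine Summable.of_norm ?_
    simp only [norm_rk]
    exact hp.summable_mul hq u v
  have hF := hs.hasSum
  set F : B H := ∑' i, rk (q i v) (p i u) with hFdef
  have hrk : ∀ i, (rk (q i v) (p i u) : B H) = q i * rk v u * p i := fun i => by
    rw [rankOne_apply_apply, hp.star_eq]
  have hFc : IsCompactOperator F :=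
    isCompactOperator_of_tendsto hF (Filter.Eventually.of_forall fun s =>
      isCompactOperator_sum s _ fun i => isCompactOperator_rankOne _ _)
  have hφF : φ F = F := by
    have h1 := hF.mapL φ
    simp only [hrk, hfix] at h1 hF
    exact h1.unique hF
  suffices h0 : φ (rk v u) - F = 0 by rw [sub_eq_zero.1 h0]; exact hF
  by_contra h0
  have hφφ : φ (φ (rk v u)) = φ (rk v u) := congrArg (fun f : B H →L[ℂ] B H => f (rk v u)) hφ.2
  have hScomp : IsCompactOperator (φ (rk v u) - F) :=
    (isCompactOperator_map_rankOne hD hφ.1 v u).sub hFc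
  obtain ⟨x, y, hx, hy, hxy, hne⟩ := exists_rel_of_fixed hD hφ.1 hc hScomp h0
    (by rw [map_sub, hφφ, hφF])
  apply hne
  obtain ⟨i, hpi, hqi⟩ := hrel x y hx hy hxy
  have h1 : HasSum (fun j => ⟪y, rk (q j v) (p j u) x⟫_ℂ) ⟪y, F x⟫_ℂ :=
    (hF.mapL (ContinuousLinearMap.apply ℂ H x)).mapL (innerSL ℂ y)
  have h2 := hasSum_single (f := fun j => ⟪y, rk (q j v) (p j u) x⟫_ℂ) i fun j hj => by
    rw [rk_apply, ← hpi, hp.inner_left, hp.apply_ne hj]; simp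
  rw [sub_apply, inner_sub_right, hxy, h1.unique h2]
  simp only [rk_apply, inner_smul_right]
  rw [hp.inner_left, ← hq.inner_left, hpi, hqi, sub_self]

lemma hasSum_inner_map (hD : IsMasa D) {φ : B H →L[ℂ] B H} (hφ : IsSchurIdempotent D φ)
    (hc : ‖φ‖ ≤ 1) {ι : Type*} {p q : ι → B H} (hp : OrthoProj p) (hq : OrthoProj q)
    (hfix : ∀ i T, φ (q i * T * p i) = q i * T * p i)
    (hrel : ∀ u v, u ≠ 0 → v ≠ 0 → Rel φ u v → ∃ i, p i u = u ∧ q i v = v)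
    (T : B H) (x y : H) :
    HasSum (fun i => ⟪q i y, T (p i x)⟫_ℂ) ⟪y, φ T x⟫_ℂ := by
  obtain ⟨l, hl, hspan, hbd, hlim⟩ := exists_finiteRank_filter T
  have hfin : ∀ R ∈ Submodule.span ℂ {R : B H | ∃ u v, R = rk v u},
      HasSum (fun i => ⟪q i y, R (p i x)⟫_ℂ) ⟪y, φ R x⟫_ℂ := by
    intro R hR
    induction hR using Submodule.span_induction with
    | mem R hR =>
      obtain ⟨u, v, rfl⟩ := hR
      have h1 : HasSum (fun j => ⟪y, rk (q j v) (p j u) x⟫_ℂ) ⟪y, φ (rk v u) x⟫_ℂ :=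
        ((map_rk_eq hD hφ hc hp hq hfix hrel v u).mapL
          (ContinuousLinearMap.apply ℂ H x)).mapL (innerSL ℂ y)
      refine h1.congr_fun fun i => ?_
      simp only [rk_apply, inner_smul_right, hp.inner_left, hq.inner_left, map_smul]
    | zero => simp
    | add R R' _ _ h h' => simpa [inner_add_right] using h.add h'
    | smul c R _ h => simpa [inner_smul_right] using h.mul_left c
  have hdom := (hp.summable_mul hq x y).mul_left ‖T‖
  have hT : Summable fun i => ⟪q i y, T (p i x)⟫_ℂ := by
    refine Summable.of_norm_bounded hdom fun i => ?_
    calc _ ≤ ‖q i y‖ * (‖T‖ * ‖p i x‖) :=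
          (norm_inner_le_norm _ _).trans (by gcongr; exact T.le_opNorm _)
      _ = _ := by ring
  have h1 : Filter.Tendsto (fun R : B H => ∑' i, ⟪q i y, R (p i x)⟫_ℂ) l
      (nhds (∑' i, ⟪q i y, T (p i x)⟫_ℂ)) := by
    refine tendsto_tsum_of_dominated_convergence hdom (fun i => ?_) ?_
    · exact ((innerSL ℂ (q i y)).continuous.tendsto _).comp (hlim (p i x))
    · filter_upwards [hbd] with R hR i
      calc _ ≤ ‖q i y‖ * (‖T‖ * ‖p i x‖) :=
            (norm_inner_le_norm _ _).trans (by gcongr; exact (hR _).trans (T.le_opNorm _))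
        _ = _ := by ring
  have h2 : Filter.Tendsto (fun R : B H => ⟪y, φ R x⟫_ℂ) l (nhds ⟪y, φ T x⟫_ℂ) := by
    let _ := weakStarTopology H
    have h3 := le_nhds_weakStar hbd hlim
    have h4 : Continuous fun R : B H => ⟪y, φ R x⟫_ℂ :=
      (continuous_weakStar_inner x y).comp hφ.1.1
    exact (h4.tendsto T).mono_left h3
  have h5 : Filter.Tendsto (fun R : B H => ∑' i, ⟪q i y, R (p i x)⟫_ℂ) l (nhds ⟪y, φ T x⟫_ℂ) := by
    refine h2.congr' ?_
    filter_upwards [hspan] with R hR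
    exact (hfin R hR).tsum_eq.symm
  rw [tendsto_nhds_unique h5 h1]
  exact hT.hasSum

end OrthoProj

section Combinatorics

variable {ι E : Type*} [DecidableEq ι] [AddCommGroup E]

lemma two_smul_sum_powerset (J : Finset ι) (g : ι → E) :
    2 • ∑ σ ∈ J.powerset, ∑ i ∈ σ, g i = 2 ^ J.card • ∑ i ∈ J, g i := by
  induction J using Finset.induction_on with
  | empty => simp
  | insert a J ha ih =>
    rw [Finset.sum_powerset_insert ha]
    have h1 : ∑ σ ∈ J.powerset, ∑ i ∈ insert a σ, g i
        = 2 ^ J.card • g a + ∑ σ ∈ J.powerset, ∑ i ∈ σ, g i := by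
      rw [← Finset.card_powerset, ← Finset.sum_const, ← Finset.sum_add_distrib]
      refine Finset.sum_congr rfl fun σ hσ => Finset.sum_insert fun h => ha ?_
      exact Finset.mem_powerset.1 hσ h
    rw [h1, Finset.sum_insert ha, Finset.card_insert_of_notMem ha, smul_add, smul_add, ih, smul_add,
      pow_succ]
    module

lemma two_smul_sum_powerset_sdiff (J : Finset ι) (g : ι → E) :
    2 • ∑ σ ∈ J.powerset, ∑ i ∈ J \ σ, g i = 2 ^ J.card • ∑ i ∈ J, g i := by
  have h1 : ∑ σ ∈ J.powerset, ∑ i ∈ J \ σ, g i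
      = 2 ^ J.card • ∑ i ∈ J, g i - ∑ σ ∈ J.powerset, ∑ i ∈ σ, g i := by
    rw [← Finset.card_powerset, ← Finset.sum_const, ← Finset.sum_sub_distrib]
    refine Finset.sum_congr rfl fun σ hσ => ?_
    rw [← Finset.sum_sdiff (Finset.mem_powerset.1 hσ), add_sub_cancel_right]
  rw [h1, smul_sub, two_smul_sum_powerset]
  module

/-- Averaging over all ways to split the index set recovers the off-diagonal part of a matrix. -/
lemma four_smul_sum_powerset (J : Finset ι) (f : ι → ι → E) (hf : ∀ i, f i i = 0) :
    4 • ∑ σ ∈ J.powerset, ∑ i ∈ σ, ∑ j ∈ J \ σ, f i j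
      = 2 ^ J.card • ∑ i ∈ J, ∑ j ∈ J, f i j := by
  induction J using Finset.induction_on with
  | empty => simp
  | insert a J ha ih =>
    rw [Finset.sum_powerset_insert ha]
    have hn : ∀ σ ∈ J.powerset, a ∉ σ := fun σ hσ h => ha (Finset.mem_powerset.1 hσ h)
    have h1 : ∑ σ ∈ J.powerset, ∑ i ∈ σ, ∑ j ∈ insert a J \ σ, f i j
        = ∑ σ ∈ J.powerset, ∑ i ∈ σ, f i a
          + ∑ σ ∈ J.powerset, ∑ i ∈ σ, ∑ j ∈ J \ σ, f i j := by
      rw [← Finset.sum_add_distrib]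
      refine Finset.sum_congr rfl fun σ hσ => ?_
      rw [← Finset.sum_add_distrib]
      refine Finset.sum_congr rfl fun i _ => ?_
      rw [Finset.insert_sdiff_of_notMem _ (hn σ hσ), Finset.sum_insert (by simp [ha])]
    have h2 : ∑ σ ∈ J.powerset, ∑ i ∈ insert a σ, ∑ j ∈ insert a J \ insert a σ, f i j
        = ∑ σ ∈ J.powerset, ∑ j ∈ J \ σ, f a j
          + ∑ σ ∈ J.powerset, ∑ i ∈ σ, ∑ j ∈ J \ σ, f i j := by
      rw [← Finset.sum_add_distrib]
      refine Finset.sum_congr rfl fun σ hσ => ?_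
      have : insert a J \ insert a σ = J \ σ := by
        ext x
        simp only [Finset.mem_sdiff, Finset.mem_insert]
        constructor
        · tauto
        · rintro ⟨h, h'⟩
          exact ⟨Or.inr h, fun h'' => h''.elim (fun e => ha (e ▸ h)) h'⟩
      rw [this, Finset.sum_insert (hn σ hσ)]
    have h3 := two_smul_sum_powerset J fun i => f i a
    have h4 := two_smul_sum_powerset_sdiff J fun j => f a j
    have h5 : ∑ i ∈ insert a J, ∑ j ∈ insert a J, f i j
        = ∑ j ∈ J, f a j + ∑ i ∈ J, f i a + ∑ i ∈ J, ∑ j ∈ J, f i j := by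
      have h6 : ∑ i ∈ J, ∑ j ∈ insert a J, f i j = ∑ i ∈ J, f i a + ∑ i ∈ J, ∑ j ∈ J, f i j := by
        rw [← Finset.sum_add_distrib]
        exact Finset.sum_congr rfl fun i _ => Finset.sum_insert (f := f i) ha
      rw [Finset.sum_insert ha, Finset.sum_insert ha, hf, zero_add, h6, add_assoc]
    rw [h1, h2, h5, Finset.card_insert_of_notMem ha]
    generalize ∑ σ ∈ J.powerset, ∑ i ∈ σ, ∑ j ∈ J \ σ, f i j = A at *
    generalize ∑ σ ∈ J.powerset, ∑ i ∈ σ, f i a = A₁ at *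
    generalize ∑ σ ∈ J.powerset, ∑ j ∈ J \ σ, f a j = A₂ at *
    calc 4 • (A₁ + A + (A₂ + A)) = 2 • (2 • A₁) + 2 • (2 • A₂) + 2 • (4 • A) := by module
      _ = _ := by rw [ih, h3, h4]; module

end Combinatorics

section Good

variable {H : Type*} [NormedAddCommGroup H] [InnerProductSpace ℂ H] [CompleteSpace H]
variable {D : StarSubalgebra ℂ (B H)}

lemma opNorm_le_of_inner {A : B H} {C : ℝ} (hC : 0 ≤ C)
    (h : ∀ x y, ‖⟪y, A x⟫_ℂ‖ ≤ C * (‖y‖ * ‖x‖)) : ‖A‖ ≤ C := by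
  refine ContinuousLinearMap.opNorm_le_bound _ hC fun x => ?_
  have h1 := h x (A x)
  rw [inner_self_eq_norm_sq_to_K] at h1
  have h2 : ‖A x‖ * ‖A x‖ ≤ (C * ‖x‖) * ‖A x‖ := by
    calc _ = ‖((‖A x‖ : ℂ)) ^ 2‖ := by simp [sq]
      _ ≤ _ := h1
      _ = _ := by ring
  rcases eq_or_lt_of_le (norm_nonneg (A x)) with h0 | h0
  · rw [← h0]; positivity
  · exact le_of_mul_le_mul_right h2 h0

/-- A rectangle `(Q, P)` of contractions in the masa, contained in the support of `Ψ`. -/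
structure Supp (D : StarSubalgebra ℂ (B H)) (Ψ : B H →L[ℂ] B H) (Q P : B H) : Prop where
  left_mem : Q ∈ D
  right_mem : P ∈ D
  norm_left : ‖Q‖ ≤ 1
  norm_right : ‖P‖ ≤ 1
  map_eq : ∀ T, Ψ (Q * T * P) = Q * T * P

/-- `Ψ T` is controlled by the rectangular blocks of `T` in the support of `Ψ`. -/
def Good (D : StarSubalgebra ℂ (B H)) (Ψ : B H →L[ℂ] B H) : Prop :=
  ∃ C : ℝ, 0 ≤ C ∧ ∀ (T : B H) (M : ℝ), 0 ≤ M →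
    (∀ Q P, Supp D Ψ Q P → ‖Q * T * P‖ ≤ M) → ‖Ψ T‖ ≤ C * M

lemma good_of_contractive (hD : IsMasa D) {φ : B H →L[ℂ] B H} (hφ : IsSchurIdempotent D φ)
    (hc : ‖φ‖ ≤ 1) : Good D φ := by
  obtain ⟨ι, p, q, hp, hq, hpD, hqD, hfix, hrel⟩ := exists_orthoProj hD hφ.1 hc
  refine ⟨1, zero_le_one, fun T M hM h => ?_⟩
  rw [one_mul]
  refine opNorm_le_of_inner hM fun x y => ?_
  refine le_of_tendsto (hasSum_inner_map hD hφ hc hp hq hfix hrel T x y).norm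
    (Filter.Eventually.of_forall fun s => ?_)
  have hi : ∀ i, ‖⟪q i y, T (p i x)⟫_ℂ‖ ≤ M * (‖q i y‖ * ‖p i x‖) := fun i => by
    have h1 : ⟪q i y, T (p i x)⟫_ℂ = ⟪q i y, (q i * T * p i) (p i x)⟫_ℂ := by
      simp only [mul_apply_eq_comp]
      rw [hp.apply_self, ← hq.inner_left, hq.apply_self]
    rw [h1]
    refine (norm_inner_le_norm _ _).trans ?_
    have h2 := ((q i * T * p i).le_opNorm (p i x)).trans
      (mul_le_mul_of_nonneg_right (h _ _ ⟨hqD i, hpD i, hq.norm_le i, hp.norm_le i, hfix i⟩)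
        (norm_nonneg _))
    calc _ ≤ ‖q i y‖ * (M * ‖p i x‖) := by gcongr
      _ = _ := by ring
  calc _ ≤ ∑ i ∈ s, ‖⟪q i y, T (p i x)⟫_ℂ‖ := norm_sum_le _ _
    _ ≤ ∑ i ∈ s, M * (‖q i y‖ * ‖p i x‖) := Finset.sum_le_sum fun i _ => hi i
    _ = M * ∑ i ∈ s, ‖q i y‖ * ‖p i x‖ := by rw [Finset.mul_sum]
    _ ≤ _ := by gcongr; exact hp.sum_mul_le hq s x y

lemma good_compl_of_contractive (hD : IsMasa D) {φ : B H →L[ℂ] B H} (hφ : IsSchurIdempotent D φ)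
    (hc : ‖φ‖ ≤ 1) : Good D (ContinuousLinearMap.id ℂ (B H) - φ) := by
  classical
  obtain ⟨ι, p, q, hp, hq, hpD, hqD, hfix, hrel⟩ := exists_orthoProj hD hφ.1 hc
  obtain ⟨e, heD, hen, -, hep, hes⟩ := hp.exists_kernel_projection hD hpD
  obtain ⟨f, hfD, hfn, hqf, -, hfs⟩ := hq.exists_kernel_projection hD hqD
  have hzero : ∀ A : B H, (∀ i, q i * A * p i = 0) → φ A = 0 := fun A hA => by
    refine ContinuousLinearMap.ext fun x => ext_inner_left ℂ fun y => ?_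
    have h1 := hasSum_inner_map hD hφ hc hp hq hfix hrel A x y
    have h2 : ∀ i, ⟪q i y, A (p i x)⟫_ℂ = 0 := fun i => by
      rw [hq.inner_left, ← mul_apply_eq_comp, ← mul_apply_eq_comp, hA i,
        zero_apply, inner_zero_right]
    simp only [h2] at h1
    rw [h1.unique hasSum_zero, zero_apply, inner_zero_right]
  have hfq : ∀ i, q i * star f = star f * q i := fun i => hD.1 _ (hqD i) _ (star_mem hfD)
  have hqf' : ∀ i, q i * star f = 0 := fun i => by
    rw [hfq, ← hq.star_eq i, ← star_mul, hqf, star_zero]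
  have hsupp : ∀ Q P, Q ∈ D → P ∈ D → ‖Q‖ ≤ 1 → ‖P‖ ≤ 1 → (∀ i, q i * Q = 0 ∨ P * p i = 0) →
      Supp D (ContinuousLinearMap.id ℂ (B H) - φ) Q P := by
    intro Q P hQ hP hQn hPn h
    refine ⟨hQ, hP, hQn, hPn, fun T => ?_⟩
    rw [sub_apply, hzero, sub_zero, ContinuousLinearMap.id_apply]
    intro i
    rcases h i with h | h
    · simp only [← mul_assoc, h, zero_mul]
    · simp only [mul_assoc, h, mul_zero]
  have hone : ‖(1 : B H)‖ ≤ 1 := ContinuousLinearMap.norm_id_le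
  refine ⟨7, by norm_num, fun T M hM h => ?_⟩
  have hblock : ∀ Q P, Supp D (ContinuousLinearMap.id ℂ (B H) - φ) Q P →
      ‖Q * (T - φ T) * P‖ ≤ M := fun Q P hQP => by
    have h1 := hQP.map_eq T
    rw [sub_apply, hφ.1.2 _ hQP.left_mem _ hQP.right_mem, ContinuousLinearMap.id_apply,
      sub_eq_self] at h1
    rw [mul_sub, sub_mul, h1, sub_zero]
    exact h Q P hQP
  set X : B H := T - φ T with hX
  have hXe : (ContinuousLinearMap.id ℂ (B H) - φ) T = X := by
    rw [sub_apply, ContinuousLinearMap.id_apply]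
  rw [hXe]
  have hdiag : ∀ i, q i * X * p i = 0 := fun i => by
    rw [hX, mul_sub, sub_mul, ← hφ.1.2 _ (hqD i) _ (hpD i), hfix, sub_self]
  have hJ : ∀ J : Finset ι, ‖(∑ i ∈ J, q i) * X * ∑ i ∈ J, p i‖ ≤ 4 * M := fun J => by
    have h1 := four_smul_sum_powerset J (fun i j => q i * X * p j) hdiag
    have h2 : ∀ s t : Finset ι, (∑ i ∈ s, q i) * X * ∑ i ∈ t, p i
        = ∑ i ∈ s, ∑ j ∈ t, q i * X * p j := fun s t => by
      rw [Finset.sum_mul, Finset.sum_mul_sum]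
    simp only [← h2] at h1
    have h3 : ∀ σ ∈ J.powerset, ‖(∑ i ∈ σ, q i) * X * ∑ i ∈ J \ σ, p i‖ ≤ M := fun σ _ => by
      refine hblock _ _ (hsupp _ _ (sum_mem fun i _ => hqD i) (sum_mem fun i _ => hpD i)
        (hq.norm_sum_le _) (hp.norm_sum_le _) fun i => ?_)
      by_cases hi : i ∈ σ
      · right
        rw [Finset.sum_mul]
        refine Finset.sum_eq_zero fun j hj => hp.mul_eq_zero j i fun hji => ?_
        exact (Finset.mem_sdiff.1 hj).2 (hji ▸ hi)
      · left
        rw [Finset.mul_sum]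
        exact Finset.sum_eq_zero fun j hj => hq.mul_eq_zero i j fun hij => hi (hij ▸ hj)
    have h4 : ‖(2 ^ J.card) • ((∑ i ∈ J, q i) * X * ∑ i ∈ J, p i)‖ ≤ 4 * (2 ^ J.card * M) := by
      rw [← h1, ← Nat.cast_smul_eq_nsmul ℝ, norm_smul]
      norm_num
      refine (norm_sum_le_of_le _ h3).trans ?_
      simp
    rw [← Nat.cast_smul_eq_nsmul ℝ, norm_smul] at h4
    have h5 : (0 : ℝ) < 2 ^ J.card := by positivity
    norm_num at h4
    nlinarith
  have hlim : ∀ x y, ‖⟪y - f y, X (x - e x)⟫_ℂ‖ ≤ 4 * M * (‖y‖ * ‖x‖) := fun x y => by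
    have h1 : Filter.Tendsto (fun J : Finset ι => ⟪∑ i ∈ J, q i y, X (∑ i ∈ J, p i x)⟫_ℂ)
        Filter.atTop (nhds ⟪y - f y, X (x - e x)⟫_ℂ) :=
      (hfs y).inner ((X.continuous.tendsto _).comp (hes x))
    refine le_of_tendsto h1.norm (Filter.Eventually.of_forall fun J => ?_)
    have h2 : ⟪∑ i ∈ J, q i y, X (∑ i ∈ J, p i x)⟫_ℂ
        = ⟪y, ((∑ i ∈ J, q i) * X * ∑ i ∈ J, p i) x⟫_ℂ := by
      rw [← _root_.sum_apply, ← _root_.sum_apply, mul_apply_eq_comp, mul_apply_eq_comp,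
        ← inner_star_apply (∑ i ∈ J, q i), hq.star_sum]
    rw [h2]
    refine (norm_inner_le_norm _ _).trans ?_
    calc _ ≤ ‖y‖ * (4 * M * ‖x‖) := by
          gcongr
          exact (ContinuousLinearMap.le_opNorm _ _).trans
            (mul_le_mul_of_nonneg_right (hJ J) (norm_nonneg _))
      _ = _ := by ring
  refine opNorm_le_of_inner (by positivity) fun x y => ?_
  have hsplit : ⟪y, X x⟫_ℂ = ⟪y, (star f * X * 1) x⟫_ℂ + ⟪y - f y, (1 * X * e) x⟫_ℂ
      + ⟪y - f y, X (x - e x)⟫_ℂ := by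
    simp only [mul_apply_eq_comp, one_apply_eq_self, inner_star_apply_right, map_sub,
      inner_sub_left, inner_sub_right]
    ring
  have h1 : ‖⟪y, (star f * X * 1) x⟫_ℂ‖ ≤ M * (‖y‖ * ‖x‖) := by
    have := hblock _ _ (hsupp (star f) 1 (star_mem hfD) (one_mem D) (by rwa [norm_star]) hone
      fun i => Or.inl (hqf' i))
    calc _ ≤ ‖y‖ * (M * ‖x‖) := (norm_inner_le_norm _ _).trans (by
          gcongr
          exact (ContinuousLinearMap.le_opNorm _ _).trans
            (mul_le_mul_of_nonneg_right this (norm_nonneg _)))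
      _ = _ := by ring
  have h2 : ‖⟪y - f y, (1 * X * e) x⟫_ℂ‖ ≤ 2 * M * (‖y‖ * ‖x‖) := by
    have := hblock _ _ (hsupp 1 e (one_mem D) heD hone hen fun i => Or.inr (hep i))
    have hy : ‖y - f y‖ ≤ 2 * ‖y‖ := by
      have := (f.le_opNorm y).trans (mul_le_mul_of_nonneg_right hfn (norm_nonneg _))
      linarith [norm_sub_le y (f y)]
    calc _ ≤ (2 * ‖y‖) * (M * ‖x‖) := (norm_inner_le_norm _ _).trans (by
          gcongr
          exact (ContinuousLinearMap.le_opNorm _ _).trans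
            (mul_le_mul_of_nonneg_right this (norm_nonneg _)))
      _ = _ := by ring
  rw [hsplit]
  calc _ ≤ M * (‖y‖ * ‖x‖) + 2 * M * (‖y‖ * ‖x‖) + 4 * M * (‖y‖ * ‖x‖) :=
        (norm_add₃_le).trans (add_le_add (add_le_add h1 h2) (hlim x y))
    _ = _ := by ring

end Good

section Lattice

variable {H : Type*} [NormedAddCommGroup H] [InnerProductSpace ℂ H] [CompleteSpace H]
variable {D : StarSubalgebra ℂ (B H)} {Φ Ψ : B H →L[ℂ] B H}

lemma isSchurMultiplier_id : IsSchurMultiplier D (ContinuousLinearMap.id ℂ (B H)) :=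
  ⟨by unfold WStarContinuous; exact @continuous_id _ (weakStarTopology H), fun _ _ _ _ _ => rfl⟩

lemma IsSchurMultiplier.comp (hΦ : IsSchurMultiplier D Φ) (hΨ : IsSchurMultiplier D Ψ) :
    IsSchurMultiplier D (Φ.comp Ψ) := by
  refine ⟨?_, fun A hA C hC T => ?_⟩
  · let _ := weakStarTopology H
    exact Continuous.comp (f := Ψ) (g := Φ) hΦ.1 hΨ.1
  · simp only [ContinuousLinearMap.comp_apply, hΨ.2 A hA C hC, hΦ.2 A hA C hC]

lemma WStarContinuous.sub (hΦ : WStarContinuous H Φ) (hΨ : WStarContinuous H Ψ) :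
    WStarContinuous H (Φ - Ψ) := by
  let _ := weakStarTopology H
  refine continuous_weakStar_of_normal _ fun ω hω => ?_
  simp only [sub_apply, map_sub]
  exact (hω.continuous.comp hΦ).sub (hω.continuous.comp hΨ)

lemma IsSchurMultiplier.sub (hΦ : IsSchurMultiplier D Φ) (hΨ : IsSchurMultiplier D Ψ) :
    IsSchurMultiplier D (Φ - Ψ) := by
  refine ⟨hΦ.1.sub hΨ.1, fun A hA C hC T => ?_⟩
  simp only [sub_apply, hΨ.2 A hA C hC, hΦ.2 A hA C hC, mul_sub, sub_mul]

lemma supp_compl_iff {Q P : B H} : Supp D (ContinuousLinearMap.id ℂ (B H) - Φ) Q P ↔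
    Q ∈ D ∧ P ∈ D ∧ ‖Q‖ ≤ 1 ∧ ‖P‖ ≤ 1 ∧ ∀ T, Φ (Q * T * P) = 0 := by
  constructor
  · rintro ⟨a, b, c, d, e⟩
    refine ⟨a, b, c, d, fun T => ?_⟩
    have := e T
    rwa [sub_apply, ContinuousLinearMap.id_apply, sub_eq_self] at this
  · rintro ⟨a, b, c, d, e⟩
    refine ⟨a, b, c, d, fun T => ?_⟩
    rw [sub_apply, ContinuousLinearMap.id_apply, e, sub_zero]

lemma Supp.mul (hD : IsMasa D) {Q P Q' P' : B H} (h : Supp D Φ Q P) (h' : Supp D Ψ Q' P') :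
    Supp D (Φ.comp Ψ) (Q * Q') (P' * P) := by
  refine ⟨mul_mem h.left_mem h'.left_mem, mul_mem h'.right_mem h.right_mem,
    (norm_mul_le _ _).trans (mul_le_one₀ h.norm_left (norm_nonneg _) h'.norm_left),
    (norm_mul_le _ _).trans (mul_le_one₀ h'.norm_right (norm_nonneg _) h.norm_right), fun T => ?_⟩
  have h1 : Q * Q' * T * (P' * P) = Q' * (Q * T * P) * P' := by
    rw [hD.1 _ h.left_mem _ h'.left_mem, hD.1 _ h'.right_mem _ h.right_mem]
    noncomm_ring
  have h2 : Q' * (Q * T * P) * P' = Q * (Q' * T * P') * P := by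
    rw [← h1]; noncomm_ring
  rw [ContinuousLinearMap.comp_apply, h1, h'.map_eq, h2, h.map_eq]

lemma Good.comp (hD : IsMasa D) (hΨ : IsSchurMultiplier D Ψ)
    (h : Good D Φ) (h' : Good D Ψ) : Good D (Φ.comp Ψ) := by
  obtain ⟨C, hC, h⟩ := h
  obtain ⟨C', hC', h'⟩ := h'
  refine ⟨C * C', by positivity, fun T M hM hT => ?_⟩
  rw [mul_assoc, ContinuousLinearMap.comp_apply]
  refine h _ _ (by positivity) fun Q P hQP => ?_
  rw [← hΨ.2 _ hQP.left_mem _ hQP.right_mem]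
  refine h' _ _ hM fun Q' P' hQP' => ?_
  have h1 : Q' * (Q * T * P) * P' = Q * Q' * T * (P' * P) := by
    rw [hD.1 _ hQP.left_mem _ hQP'.left_mem, hD.1 _ hQP'.right_mem _ hQP.right_mem]
    noncomm_ring
  rw [h1]
  exact hT _ _ (hQP.mul hD hQP')

lemma Good.compl_comp (hΨ : IsSchurMultiplier D Ψ)
    (h : Good D (ContinuousLinearMap.id ℂ (B H) - Φ))
    (h' : Good D (ContinuousLinearMap.id ℂ (B H) - Ψ)) :
    Good D (ContinuousLinearMap.id ℂ (B H) - Φ.comp Ψ) := by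
  obtain ⟨C, hC, h⟩ := h
  obtain ⟨C', hC', h'⟩ := h'
  refine ⟨C + ‖Φ‖ * C', by positivity, fun T M hM hT => ?_⟩
  have h1 : (ContinuousLinearMap.id ℂ (B H) - Φ.comp Ψ) T
      = (ContinuousLinearMap.id ℂ (B H) - Φ) T
        + Φ ((ContinuousLinearMap.id ℂ (B H) - Ψ) T) := by
    simp only [sub_apply, ContinuousLinearMap.comp_apply, ContinuousLinearMap.id_apply, map_sub]
    abel
  rw [h1]
  have h2 := h T M hM fun Q P hQP => hT Q P (by
    obtain ⟨a, b, c, d, e⟩ := supp_compl_iff.1 hQP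
    refine supp_compl_iff.2 ⟨a, b, c, d, fun S => ?_⟩
    rw [ContinuousLinearMap.comp_apply, hΨ.2 _ a _ b, e])
  have h3 := h' T M hM fun Q P hQP => hT Q P (by
    obtain ⟨a, b, c, d, e⟩ := supp_compl_iff.1 hQP
    refine supp_compl_iff.2 ⟨a, b, c, d, fun S => ?_⟩
    rw [ContinuousLinearMap.comp_apply, e, map_zero])
  calc _ ≤ C * M + ‖Φ‖ * (C' * M) :=
        (norm_add_le _ _).trans (add_le_add h2 ((Φ.le_opNorm _).trans (by gcongr)))
    _ = _ := by ring

lemma InC.good (hD : IsMasa D) (h : InC D Φ) : IsSchurMultiplier D Φ ∧ Good D Φ ∧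
    Good D (ContinuousLinearMap.id ℂ (B H) - Φ) := by
  induction h with
  | base Φ h hc => exact ⟨h.1, good_of_contractive hD h hc, good_compl_of_contractive hD h hc⟩
  | compl Φ _ ih =>
    refine ⟨isSchurMultiplier_id.sub ih.1, ih.2.2, ?_⟩
    rw [sub_sub_cancel]
    exact ih.2.1
  | meet Φ Ψ _ _ ih ih' =>
    exact ⟨ih.1.comp ih'.1, ih.2.1.comp hD ih'.1 ih'.2.1,
      Good.compl_comp ih'.1 ih.2.2 ih'.2.2⟩
  | join Φ Ψ _ _ ih ih' =>
    have h1 := (isSchurMultiplier_id (D := D)).sub ih.1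
    have h2 := (isSchurMultiplier_id (D := D)).sub ih'.1
    have h3 : Φ + Ψ - Φ.comp Ψ = ContinuousLinearMap.id ℂ (B H)
        - (ContinuousLinearMap.id ℂ (B H) - Φ).comp (ContinuousLinearMap.id ℂ (B H) - Ψ) := by
      refine ContinuousLinearMap.ext fun T => ?_
      simp only [sub_apply, add_apply, ContinuousLinearMap.comp_apply,
        ContinuousLinearMap.id_apply, map_sub]
      abel
    rw [h3]
    refine ⟨isSchurMultiplier_id.sub (h1.comp h2), Good.compl_comp h2 ?_ ?_, ?_⟩
    · rw [sub_sub_cancel]; exact ih.2.1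
    · rw [sub_sub_cancel]; exact ih'.2.1
    · rw [sub_sub_cancel]; exact ih.2.2.comp hD h2 ih'.2.2

/-- Every map in the lattice `𝔠(H)` is idempotent. -/
lemma InC.comp_self (hD : IsMasa D) (h : InC D Φ) : Φ.comp Φ = Φ := by
  obtain ⟨hΦ, -, C, hC, hg⟩ := h.good hD
  refine ContinuousLinearMap.ext fun T => ?_
  have h1 := hg (Φ T) 0 le_rfl fun Q P hQP => by
    obtain ⟨a, b, c, d, e⟩ := supp_compl_iff.1 hQP
    rw [← hΦ.2 _ a _ b, e, norm_zero]
  rw [mul_zero, norm_le_zero_iff, sub_apply, sub_eq_zero] at h1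
  exact h1.symm

end Lattice

section Normalization

variable {H : Type*} [NormedAddCommGroup H] [InnerProductSpace ℂ H] [CompleteSpace H]
variable {D : StarSubalgebra ℂ (B H)}

lemma norm_apply_sq (A : B H) (z : H) : ((‖A z‖ ^ 2 : ℝ) : ℂ) = ⟪z, (star A * A) z⟫_ℂ := by
  rw [mul_apply_eq_comp, inner_star_apply_right, inner_self_eq_norm_sq_to_K]
  simp

/-- A positive invertible square root, inside the masa, of `ε² + ∑ dⱼ* dⱼ`. -/
lemma exists_sqrt_sum (hD : IsMasa D) {ι : Type*} (s : Finset ι) (d : ι → B H) (hd : ∀ j, d j ∈ D)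
    {ε : ℝ} (hε : 0 < ε) : ∃ g ∈ D, ∃ g' ∈ D, g * g' = 1 ∧ g' * g = 1 ∧
      ∀ z, ‖g z‖ ^ 2 = ε ^ 2 * ‖z‖ ^ 2 + ∑ j ∈ s, ‖d j z‖ ^ 2 := by
  set c : B H := (ε : ℂ) • (1 : B H) with hc
  have hcu : IsUnit c := by
    rw [hc]
    exact (Units.mk0 (ε : ℂ) (by exact_mod_cast hε.ne') • (1 : (B H)ˣ)).isUnit
  have hcD : c ∈ D := D.smul_mem (one_mem D) _
  set a : B H := star c * c + ∑ j ∈ s, star (d j) * d j with ha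
  have haD : a ∈ D := add_mem (mul_mem (star_mem hcD) hcD)
    (sum_mem fun j _ => mul_mem (star_mem (hd j)) (hd j))
  have hb0 : 0 ≤ ∑ j ∈ s, star (d j) * d j := Finset.sum_nonneg fun j _ => star_mul_self_nonneg _
  have ha0 : 0 ≤ a := add_nonneg (star_mul_self_nonneg _) hb0
  have hau : IsUnit a := CStarAlgebra.isUnit_of_le (star c * c)
    (le_add_of_nonneg_right hb0) ⟨star_mul_self_nonneg _, hcu.star.mul hcu⟩
  set g := CFC.sqrt a with hg
  have hgg : g * g = a := CFC.sqrt_mul_sqrt_self a ha0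
  have hgs : star g = g := (IsSelfAdjoint.of_nonneg (CFC.sqrt_nonneg a)).star_eq
  have hgcomm : ∀ b ∈ D, g * b = b * g := fun b hb =>
    (Commute.cfcₙ_nnreal (hD.1 a haD b hb : Commute a b) NNReal.sqrt)
  have hgD : g ∈ D := hD.2 g hgcomm
  have hgu : IsUnit g := by
    rw [← hgg] at hau
    exact ((Commute.refl g).isUnit_mul_iff.1 hau).1
  obtain ⟨u, hu⟩ := hgu
  have hg'D : (↑u⁻¹ : B H) ∈ D := hD.2 _ fun b hb => by
    have : Commute (u : B H) b := by rw [hu]; exact hgcomm b hb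
    exact this.units_inv_left
  refine ⟨g, hgD, ↑u⁻¹, hg'D, by rw [← hu, Units.mul_inv], by rw [← hu, Units.inv_mul], fun z => ?_⟩
  apply Complex.ofReal_injective
  rw [norm_apply_sq, hgs, hgg, ha, add_apply, inner_add_right, ← norm_apply_sq,
    _root_.sum_apply, inner_sum, Complex.ofReal_add, Complex.ofReal_sum]
  congr 1
  · rw [hc, smul_apply, one_apply_eq_self, norm_smul, mul_pow]
    simp
  · exact Finset.sum_congr rfl fun j _ => (norm_apply_sq _ _).symm

end Normalization

section Arveson

variable {H : Type*} [NormedAddCommGroup H] [InnerProductSpace ℂ H] {T : B H} {X : Set (B H)}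

lemma arveson_nonneg : 0 ≤ arveson T X :=
  Real.iSup_nonneg fun _ => Real.iInf_nonneg fun _ => norm_nonneg _

lemma bddAbove_arveson : BddAbove
    (Set.range fun ξ : {ξ : H // ‖ξ‖ = 1} => ⨅ S : X, ‖T ξ.1 - S.1 ξ.1‖) := by
  rcases X.eq_empty_or_nonempty with rfl | ⟨S, hS⟩
  · refine ⟨0, ?_⟩
    rintro _ ⟨ξ, rfl⟩
    simp
  · refine ⟨‖T - S‖, ?_⟩
    rintro _ ⟨ξ, rfl⟩
    refine (ciInf_le ⟨0, ?_⟩ (⟨S, hS⟩ : X)).trans ?_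
    · rintro _ ⟨S, rfl⟩
      exact norm_nonneg _
    · have := (T - S).le_opNorm ξ.1
      rwa [ξ.2, mul_one] at this

lemma le_arveson_mul_norm (hX : X.Nonempty) {c : ℝ} {ξ : H}
    (h : ∀ S ∈ X, c ≤ ‖T ξ - S ξ‖) : c ≤ arveson T X * ‖ξ‖ := by
  have : Nonempty X := hX.to_subtype
  rcases eq_or_ne ξ 0 with rfl | hξ
  · obtain ⟨S, hS⟩ := hX
    simpa using h S hS
  have h0 : 0 < ‖ξ‖ := norm_pos_iff.2 hξ
  rw [← div_le_iff₀ h0]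
  have hu : ‖((‖ξ‖⁻¹ : ℝ) : ℂ) • ξ‖ = 1 := by
    rw [norm_smul, Complex.norm_real, norm_inv, norm_norm, inv_mul_cancel₀ h0.ne']
  refine le_trans ?_ (le_ciSup (bddAbove_arveson (T := T) (X := X)) ⟨_, hu⟩)
  refine le_ciInf fun S => ?_
  rw [map_smul, map_smul, ← smul_sub, norm_smul, Complex.norm_real, norm_inv, norm_norm,
    div_eq_inv_mul]
  exact mul_le_mul_of_nonneg_left (h S.1 S.2) (by positivity)

lemma arveson_le {c : ℝ} (hc : 0 ≤ c)
    (h : ∀ ξ : H, ‖ξ‖ = 1 → ∀ ε > 0, ∃ S ∈ X, ‖T ξ - S ξ‖ ≤ c + ε) : arveson T X ≤ c := by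
  refine Real.iSup_le (fun ξ => ?_) hc
  refine le_of_forall_pos_le_add fun ε hε => ?_
  obtain ⟨S, hS, hle⟩ := h ξ.1 ξ.2 ε hε
  refine (ciInf_le ⟨0, ?_⟩ (⟨S, hS⟩ : X)).trans hle
  rintro _ ⟨S, rfl⟩
  exact norm_nonneg _

lemma exists_le_arveson (hX : X.Nonempty) (ξ : H) {ε : ℝ} (hε : 0 < ε) :
    ∃ S ∈ X, ‖T ξ - S ξ‖ ≤ arveson T X * ‖ξ‖ + ε := by
  by_contra hcon
  push Not at hcon
  have := le_arveson_mul_norm hX fun S hS => (hcon S hS).le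
  linarith

end Arveson

section ElemTensor

variable {H K L : Type*} [NormedAddCommGroup H] [InnerProductSpace ℂ H] [CompleteSpace H]
  [NormedAddCommGroup K] [InnerProductSpace ℂ K] [CompleteSpace K]
  [NormedAddCommGroup L] [InnerProductSpace ℂ L] [CompleteSpace L]
variable {t : H →ₗ[ℂ] K →ₗ[ℂ] L} {τ : B H →ₗ[ℂ] B K →ₗ[ℂ] B L}

lemma IsElemTensor.norm_apply (ht : IsElemTensor t) (x : H) (y : K) : ‖t x y‖ = ‖x‖ * ‖y‖ := by
  have h1 := ht.1 x x y y
  simp only [inner_self_eq_norm_sq_to_K] at h1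
  have h2 : ‖t x y‖ ^ 2 = (‖x‖ * ‖y‖) ^ 2 := by
    rw [mul_pow]
    exact_mod_cast h1
  exact (pow_left_inj₀ (norm_nonneg _) (by positivity) two_ne_zero).1 h2

/-- The operator `x ↦ x ⊗ y`. -/
def IsElemTensor.col (ht : IsElemTensor t) (y : K) : H →L[ℂ] L :=
  (t.flip y).mkContinuous ‖y‖ fun x => by
    rw [LinearMap.flip_apply, ht.norm_apply, mul_comm]

@[simp] lemma IsElemTensor.col_apply (ht : IsElemTensor t) (x : H) (y : K) : ht.col y x = t x y :=
  rfl

lemma IsElemTensor.continuous_right (ht : IsElemTensor t) (x : H) : Continuous (t x) :=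
  AddMonoidHomClass.continuous_of_bound (t x) ‖x‖ fun y => (ht.norm_apply x y).le

lemma IsElemTensor.adjoint_col_apply (ht : IsElemTensor t) (x : H) (y y' : K) :
    (ht.col y).adjoint (t x y') = ⟪y, y'⟫_ℂ • x :=
  ext_inner_left ℂ fun z => by
    rw [ContinuousLinearMap.adjoint_inner_right, ht.col_apply, ht.1, inner_smul_right, mul_comm]

lemma IsElemTensor.ext (ht : IsElemTensor t) {M : Type*} [NormedAddCommGroup M] [NormedSpace ℂ M]
    {A C : L →L[ℂ] M} (h : ∀ x y, A (t x y) = C (t x y)) : A = C :=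
  ContinuousLinearMap.ext_on ht.2 (by rintro _ ⟨x, y, rfl⟩; exact h x y)

lemma rk_tensor (ht : IsElemTensor t) (hτ : IsOpTensor t τ) (x x' : H) (y y' : K) :
    (rk (t x y) (t x' y') : B L) = τ (rk x x') (rk y y') := by
  refine ht.ext fun a b => ?_
  rw [hτ]
  simp only [rk_apply, ht.1, map_smul, LinearMap.smul_apply, smul_smul, mul_comm]

/-- Two weak* and norm continuous linear maps agreeing on elementary tensors are equal. -/
lemma map_eq_of_eq_tensor (ht : IsElemTensor t) (hτ : IsOpTensor t τ) {F : Type*}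
    [NormedAddCommGroup F] [InnerProductSpace ℂ F] [CompleteSpace F] {f g : B L →L[ℂ] B F}
    (h : @Continuous _ _ (weakStarTopology L) (weakStarTopology F) f)
    (h' : @Continuous _ _ (weakStarTopology L) (weakStarTopology F) g)
    (heq : ∀ A C, f (τ A C) = g (τ A C)) (T : B L) : f T = g T := by
  refine map_eq_of_eq_rankOne (f := f.toLinearMap) (g := g.toLinearMap) h h' (fun u v => ?_) T
  change f (rk v u) = g (rk v u)
  have hcl : ∀ u, IsClosed {v | f (rk v u) = g (rk v u)} := fun u =>
    isClosed_eq (f.continuous.comp (continuous_rk.comp (continuous_id.prodMk continuous_const)))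
      (g.continuous.comp (continuous_rk.comp (continuous_id.prodMk continuous_const)))
  have hcl' : ∀ v, IsClosed {u | f (rk v u) = g (rk v u)} := fun v =>
    isClosed_eq (f.continuous.comp (continuous_rk.comp (continuous_const.prodMk continuous_id)))
      (g.continuous.comp (continuous_rk.comp (continuous_const.prodMk continuous_id)))
  have hsmul : ∀ (c : ℂ) (v u : L), (rk (c • v) u : B L) = c • rk v u := fun c v u => by
    ext x; simp [smul_smul, mul_comm]
  have hsmul' : ∀ (c : ℂ) (v u : L), (rk v (c • u) : B L) = star c • rk v u := fun c v u => by
    ext x; simp [smul_smul, mul_comm]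
  have hz : ∀ u : L, (rk 0 u : B L) = 0 := fun u => by ext x; simp
  have hz' : ∀ v : L, (rk v 0 : B L) = 0 := fun v => by ext x; simp
  have hmem : ∀ {P : L → Prop}, IsClosed {v | P v} → (∀ x y, P (t x y)) → P 0 →
      (∀ a b, P a → P b → P (a + b)) → (∀ (c : ℂ) a, P a → P (c • a)) → ∀ v, P v := by
    intro P hP h1 h0 hadd hsm v
    have hv : v ∈ closure ((Submodule.span ℂ {z : L | ∃ x y, z = t x y} : Submodule ℂ L) : Set L) :=
      ht.2 v
    refine closure_minimal (fun z hz => ?_) hP hv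
    induction hz using Submodule.span_induction with
    | mem z hz => obtain ⟨x, y, rfl⟩ := hz; exact h1 x y
    | zero => exact h0
    | add a b _ _ ha hb => exact hadd a b ha hb
    | smul c a _ ha => exact hsm c a ha
  refine hmem (P := fun v => f (rk v u) = g (rk v u)) (hcl u) (fun x y => ?_) (by rw [hz]; simp)
    (fun a b ha hb => by rw [rk_add_left, map_add, map_add, ha, hb])
    (fun c a ha => by rw [hsmul, map_smul, map_smul, ha]) v
  refine hmem (P := fun u => f (rk (t x y) u) = g (rk (t x y) u)) (hcl' _) (fun x' y' => ?_)
    (by rw [hz']; simp) (fun a b ha hb => by rw [rk_add_right, map_add, map_add, ha, hb])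
    (fun c a ha => by rw [hsmul', map_smul, map_smul, ha]) u
  rw [rk_tensor ht hτ]
  exact heq _ _

end ElemTensor

section Compress

variable {E F : Type*} [NormedAddCommGroup E] [InnerProductSpace ℂ E] [CompleteSpace E]
  [NormedAddCommGroup F] [InnerProductSpace ℂ F] [CompleteSpace F]

/-- The map `T ↦ A T C`. -/
def compress (A : E →L[ℂ] F) (C : F →L[ℂ] E) : B E →L[ℂ] B F :=
  (ContinuousLinearMap.compL ℂ F E F A) ∘L ((ContinuousLinearMap.compL ℂ F E E).flip C)

@[simp] lemma compress_apply (A : E →L[ℂ] F) (C : F →L[ℂ] E) (T : B E) :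
    compress A C T = A ∘L T ∘L C := rfl

lemma continuous_compress (A : E →L[ℂ] F) (C : F →L[ℂ] E) :
    @Continuous _ _ (weakStarTopology E) (weakStarTopology F) (compress A C) :=
  continuous_weakStar_compress A C

end Compress

section Ampliation

variable {H K L : Type*} [NormedAddCommGroup H] [InnerProductSpace ℂ H] [CompleteSpace H]
  [NormedAddCommGroup K] [InnerProductSpace ℂ K] [CompleteSpace K]
  [NormedAddCommGroup L] [InnerProductSpace ℂ L] [CompleteSpace L]
variable {t : H →ₗ[ℂ] K →ₗ[ℂ] L} {τ : B H →ₗ[ℂ] B K →ₗ[ℂ] B L}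
variable {D : StarSubalgebra ℂ (B H)} {ι : Type*}

lemma IsElemTensor.adjoint_col_comp (ht : IsElemTensor t) (hτ : IsOpTensor t τ) (A : B H) (C : B K)
    (y y' : K) :
    (ht.col y).adjoint ∘L τ A C ∘L ht.col y' = ⟪y, C y'⟫_ℂ • A := by
  ext x
  simp only [ContinuousLinearMap.comp_apply, ht.col_apply, hτ A C, ht.adjoint_col_apply, smul_apply]

/-- Slices of the ampliation of `Φ` are images under `Φ` of slices. -/
lemma adjoint_col_comp_map (ht : IsElemTensor t) (hτ : IsOpTensor t τ) {Φ : B H →L[ℂ] B H}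
    (hΦ : WStarContinuous H Φ) {Φc : B L →L[ℂ] B L} (hΦc : WStarContinuous L Φc)
    (hmap : ∀ A C, Φc (τ A C) = τ (Φ A) C) (y y' : K) (T : B L) :
    (ht.col y).adjoint ∘L Φc T ∘L ht.col y' = Φ ((ht.col y).adjoint ∘L T ∘L ht.col y') := by
  refine map_eq_of_eq_tensor ht hτ (f := compress (ht.col y).adjoint (ht.col y') ∘L Φc)
    (g := Φ ∘L compress (ht.col y).adjoint (ht.col y')) ?_ ?_ (fun A C => ?_) T
  · exact @Continuous.comp _ _ _ (weakStarTopology L) (weakStarTopology L) (weakStarTopology H)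
      Φc (compress (ht.col y).adjoint (ht.col y')) (continuous_compress _ _) hΦc
  · exact @Continuous.comp _ _ _ (weakStarTopology L) (weakStarTopology H) (weakStarTopology H)
      (compress (ht.col y).adjoint (ht.col y')) Φ hΦ (continuous_compress _ _)
  · simp only [ContinuousLinearMap.comp_apply, compress_apply, hmap, ht.adjoint_col_comp hτ,
      map_smul]

/-- The column operator with entries `d j` in the rows `j ∈ s`. -/
def column (ht : IsElemTensor t) (b : ι → K) (s : Finset ι) (d : ι → B H) : H →L[ℂ] L :=
  ∑ j ∈ s, ht.col (b j) ∘L d j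

lemma column_apply (ht : IsElemTensor t) (b : ι → K) (s : Finset ι) (d : ι → B H) (x : H) :
    column ht b s d x = ∑ j ∈ s, t (d j x) (b j) := by
  rw [column, _root_.sum_apply]; rfl

lemma column_comp (ht : IsElemTensor t) (b : ι → K) (s : Finset ι) (d : ι → B H) (g : B H) :
    column ht b s d ∘L g = column ht b s fun j => d j * g := by
  ext x
  simp only [ContinuousLinearMap.comp_apply, column_apply, mul_apply_eq_comp]

lemma norm_column_apply_sq (ht : IsElemTensor t) {b : ι → K} (hb : Orthonormal ℂ b) (s : Finset ι)
    (d : ι → B H) (x : H) : ‖column ht b s d x‖ ^ 2 = ∑ j ∈ s, ‖d j x‖ ^ 2 := by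
  classical
  apply Complex.ofReal_injective
  have h1 : ((‖column ht b s d x‖ ^ 2 : ℝ) : ℂ) = ⟪column ht b s d x, column ht b s d x⟫_ℂ := by
    rw [inner_self_eq_norm_sq_to_K]; simp
  rw [h1, column_apply, sum_inner, Complex.ofReal_sum]
  refine Finset.sum_congr rfl fun i hi => ?_
  rw [inner_sum, Finset.sum_eq_single i]
  · rw [ht.1, orthonormal_iff_ite.1 hb, if_pos rfl, mul_one, inner_self_eq_norm_sq_to_K]; simp
  · intro j _ hj
    rw [ht.1, orthonormal_iff_ite.1 hb, if_neg hj.symm, mul_zero]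
  · exact fun h => absurd hi h

lemma adjoint_column_comp_map (ht : IsElemTensor t) (hτ : IsOpTensor t τ) {Φ : B H →L[ℂ] B H}
    (hΦ : IsSchurMultiplier D Φ) {Φc : B L →L[ℂ] B L} (hΦc : WStarContinuous L Φc)
    (hmap : ∀ A C, Φc (τ A C) = τ (Φ A) C) (b : ι → K) (s s' : Finset ι) {d d' : ι → B H}
    (hd : ∀ j, d j ∈ D) (hd' : ∀ j, d' j ∈ D) (T : B L) :
    (column ht b s d).adjoint ∘L Φc T ∘L column ht b s' d'
      = Φ ((column ht b s d).adjoint ∘L T ∘L column ht b s' d') := by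
  have key : ∀ S : B L, (column ht b s d).adjoint ∘L S ∘L column ht b s' d'
      = ∑ i ∈ s, ∑ j ∈ s', star (d i) * ((ht.col (b i)).adjoint ∘L S ∘L ht.col (b j)) * d' j := by
    intro S
    refine ContinuousLinearMap.ext fun x => ext_inner_left ℂ fun y => ?_
    simp only [ContinuousLinearMap.comp_apply, ContinuousLinearMap.adjoint_inner_right,
      column_apply, _root_.sum_apply, inner_sum, sum_inner, map_sum, mul_apply_eq_comp,
      inner_star_apply_right, ht.col_apply]
    rw [Finset.sum_comm]
  rw [key, key, map_sum]
  refine Finset.sum_congr rfl fun i _ => ?_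
  rw [map_sum]
  refine Finset.sum_congr rfl fun j _ => ?_
  rw [hΦ.2 _ (star_mem (hd i)) _ (hd' j), adjoint_col_comp_map ht hτ hΦ.1 hΦc hmap]

lemma dense_columns (ht : IsElemTensor t) (b : HilbertBasis ι ℂ K) (z : L) {δ : ℝ} (hδ : 0 < δ) :
    ∃ (s : Finset ι) (x : ι → H), ‖∑ j ∈ s, t (x j) (b j) - z‖ < δ := by
  let S : Submodule ℂ L := LinearMap.range (Finsupp.lsum ℂ fun j => t.flip (b j) : (ι →₀ H) →ₗ[ℂ] L)
  have hcol : ∀ j x, t x (b j) ∈ S := fun j x => ⟨Finsupp.single j x, by simp⟩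
  have hS : ∀ x y, t x y ∈ S.topologicalClosure := by
    intro x y
    have h1 : HasSum (fun j => t x (b.repr y j • b j)) (t x y) :=
      (b.hasSum_repr y).map (t x) (ht.continuous_right x)
    refine S.isClosed_topologicalClosure.mem_of_tendsto h1 (Filter.Eventually.of_forall fun s => ?_)
    refine Submodule.le_topologicalClosure _ (sum_mem fun j _ => ?_)
    rw [map_smul]
    exact S.smul_mem _ (hcol j x)
  have hz : z ∈ closure (S : Set L) := by
    have h1 : Submodule.span ℂ {z : L | ∃ x y, z = t x y} ≤ S.topologicalClosure :=
      Submodule.span_le.2 (by rintro _ ⟨x, y, rfl⟩; exact hS x y)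
    have h2 := closure_mono (show _ ⊆ (S.topologicalClosure : Set L) from h1) (ht.2 z)
    rwa [S.isClosed_topologicalClosure.closure_eq] at h2
  obtain ⟨_, ⟨f, rfl⟩, hf⟩ := Metric.mem_closure_iff.1 hz δ hδ
  refine ⟨f.support, f, ?_⟩
  rw [dist_comm, dist_eq_norm] at hf
  exact hf

/-- Every vector is approximately the image of a vector of `H` of nearly the same norm under a
contractive column over the masa. -/
lemma exists_column (hD : IsMasa D) (ht : IsElemTensor t) (b : HilbertBasis ι ℂ K) (z : L) {δ : ℝ}
    (hδ : 0 < δ) : ∃ (s : Finset ι) (d : ι → B H) (x : H), (∀ j, d j ∈ D) ∧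
      ‖column ht b s d‖ ≤ 1 ∧ ‖x‖ ≤ ‖z‖ + δ ∧ ‖column ht b s d x - z‖ ≤ δ := by
  obtain ⟨s, x, hx⟩ := dense_columns ht b z (δ := δ / 4) (by positivity)
  obtain ⟨e, he⟩ := exists_cyc hD s x
  have hex : ∀ j, ∃ d ∈ D, j ∈ s → ‖d e - x j‖ ≤ δ / (4 * (s.card + 1)) := by
    intro j
    by_cases hj : j ∈ s
    · have h1 : x j ∈ closure {y | ∃ a ∈ D, a e = y} := by rw [← coe_cyc]; exact he j hj
      obtain ⟨_, ⟨d, hd, rfl⟩, hdist⟩ := Metric.mem_closure_iff.1 h1 (δ / (4 * (s.card + 1)))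
        (by positivity)
      refine ⟨d, hd, fun _ => ?_⟩
      rw [dist_comm, dist_eq_norm] at hdist
      exact hdist.le
    · exact ⟨0, zero_mem D, fun h => absurd h hj⟩
  choose d hd hdx using hex
  have hde : ‖column ht b s d e - z‖ ≤ δ / 2 := by
    have h1 : ‖column ht b s d e - ∑ j ∈ s, t (x j) (b j)‖ ≤ δ / 4 := by
      rw [column_apply, ← Finset.sum_sub_distrib]
      calc _ ≤ ∑ j ∈ s, ‖t (d j e) (b j) - t (x j) (b j)‖ := norm_sum_le _ _
        _ ≤ ∑ j ∈ s, δ / (4 * (s.card + 1)) := Finset.sum_le_sum fun j hj => by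
            rw [← LinearMap.sub_apply, ← map_sub, ht.norm_apply, b.orthonormal.norm_eq_one j,
              mul_one]
            exact hdx j hj
        _ = s.card * δ / (4 * (s.card + 1)) := by rw [Finset.sum_const, nsmul_eq_mul]; ring
        _ ≤ δ / 4 := by
            rw [div_le_div_iff₀ (by positivity) (by norm_num)]
            nlinarith
    calc _ = ‖(column ht b s d e - ∑ j ∈ s, t (x j) (b j)) + (∑ j ∈ s, t (x j) (b j) - z)‖ := by
          rw [sub_add_sub_cancel]
      _ ≤ δ / 4 + δ / 4 := (norm_add_le _ _).trans (add_le_add h1 hx.le)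
      _ = _ := by ring
  set ε : ℝ := δ / (2 * (‖e‖ + 1)) with hε
  have hε0 : 0 < ε := by positivity
  have hεe : ε * ‖e‖ ≤ δ / 2 := by
    rw [hε, div_mul_eq_mul_div, div_le_div_iff₀ (by positivity) (by norm_num)]
    nlinarith [norm_nonneg e]
  obtain ⟨g, hg, g', hg', hgg', hg'g, hnorm⟩ := exists_sqrt_sum hD s d hd hε0
  refine ⟨s, fun j => d j * g', g e, fun j => mul_mem (hd j) hg', ?_, ?_, ?_⟩
  · refine ContinuousLinearMap.opNorm_le_bound _ zero_le_one fun y => ?_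
    rw [one_mul]
    refine (pow_le_pow_iff_left₀ (norm_nonneg _) (norm_nonneg _) two_ne_zero).1 ?_
    have h1 := hnorm (g' y)
    rw [← mul_apply_eq_comp, hgg', one_apply_eq_self] at h1
    rw [norm_column_apply_sq ht b.orthonormal, h1]
    simp only [mul_apply_eq_comp]
    exact le_add_of_nonneg_left (by positivity)
  · have h1 : ‖g e‖ ≤ ε * ‖e‖ + ‖column ht b s d e‖ := by
      refine (pow_le_pow_iff_left₀ (norm_nonneg _) (by positivity) two_ne_zero).1 ?_
      rw [hnorm, ← norm_column_apply_sq ht b.orthonormal]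
      have : 0 ≤ ε * ‖e‖ * ‖column ht b s d e‖ := by positivity
      nlinarith
    have h2 : ‖column ht b s d e‖ ≤ ‖z‖ + δ / 2 := by
      have := norm_le_norm_add_norm_sub' (column ht b s d e) z
      linarith
    linarith
  · rw [← column_comp, ContinuousLinearMap.comp_apply, ← mul_apply_eq_comp, hg'g, one_apply_eq_self]
    linarith

/-- The norm of an operator is determined by its compressions to contractive columns. -/
lemma norm_le_of_columns (hD : IsMasa D) (ht : IsElemTensor t) (b : HilbertBasis ι ℂ K) {A : B L}
    {C : ℝ} (hC : 0 ≤ C) (h : ∀ (s s' : Finset ι) (d d' : ι → B H), (∀ j, d j ∈ D) →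
      (∀ j, d' j ∈ D) → ‖column ht b s d‖ ≤ 1 → ‖column ht b s' d'‖ ≤ 1 →
      ‖(column ht b s d).adjoint ∘L A ∘L column ht b s' d'‖ ≤ C) : ‖A‖ ≤ C := by
  refine opNorm_le_of_inner hC fun ξ η => ?_
  have hδ : ∀ n : ℕ, (0 : ℝ) < 1 / ((n : ℝ) + 1) := fun n => by positivity
  choose s d x hd hn hx hlim using fun n : ℕ => exists_column hD ht b ξ (hδ n)
  choose s' d' y hd' hn' hy hlim' using fun n : ℕ => exists_column hD ht b η (hδ n)
  have h0 := tendsto_one_div_add_atTop_nhds_zero_nat (𝕜 := ℝ)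
  have h1 : Filter.Tendsto (fun n => column ht b (s n) (d n) (x n)) Filter.atTop (nhds ξ) :=
    tendsto_iff_norm_sub_tendsto_zero.2 (squeeze_zero (fun _ => norm_nonneg _) hlim h0)
  have h2 : Filter.Tendsto (fun n => column ht b (s' n) (d' n) (y n)) Filter.atTop (nhds η) :=
    tendsto_iff_norm_sub_tendsto_zero.2 (squeeze_zero (fun _ => norm_nonneg _) hlim' h0)
  have h3 := (h2.inner (𝕜 := ℂ) ((A.continuous.tendsto _).comp h1)).norm
  have h4 : Filter.Tendsto (fun n : ℕ => C * ((‖η‖ + 1 / ((n : ℝ) + 1)) * (‖ξ‖ + 1 / ((n : ℝ) + 1))))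
      Filter.atTop (nhds (C * ((‖η‖ + 0) * (‖ξ‖ + 0)))) :=
    ((h0.const_add _).mul (h0.const_add _)).const_mul _
  rw [add_zero, add_zero] at h4
  refine le_of_tendsto_of_tendsto h3 h4 (Filter.Eventually.of_forall fun n => ?_)
  have h5 : ⟪column ht b (s' n) (d' n) (y n), A (column ht b (s n) (d n) (x n))⟫_ℂ
      = ⟪y n, ((column ht b (s' n) (d' n)).adjoint ∘L A ∘L column ht b (s n) (d n)) (x n)⟫_ℂ := by
    rw [ContinuousLinearMap.comp_apply, ContinuousLinearMap.adjoint_inner_right]; rfl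
  change ‖⟪column ht b (s' n) (d' n) (y n), A (column ht b (s n) (d n) (x n))⟫_ℂ‖ ≤ _
  rw [h5]
  have h6 := h _ _ _ _ (hd' n) (hd n) (hn' n) (hn n)
  calc _ ≤ ‖y n‖ * (C * ‖x n‖) := (norm_inner_le_norm _ _).trans (by
        gcongr
        exact (ContinuousLinearMap.le_opNorm _ _).trans
          (mul_le_mul_of_nonneg_right h6 (norm_nonneg _)))
    _ = C * (‖y n‖ * ‖x n‖) := by ring
    _ ≤ C * ((‖η‖ + 1 / ((n : ℝ) + 1)) * (‖ξ‖ + 1 / ((n : ℝ) + 1))) := by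
        have := hδ n
        gcongr
        · exact hy n
        · exact hx n

lemma norm_adjoint_comp_comp_le {R R' : H →L[ℂ] L} (hR : ‖R‖ ≤ 1) (hR' : ‖R'‖ ≤ 1) (A : B L) :
    ‖R.adjoint ∘L A ∘L R'‖ ≤ ‖A‖ := by
  calc _ ≤ ‖R.adjoint‖ * (‖A‖ * ‖R'‖) := (ContinuousLinearMap.opNorm_comp_le _ _).trans
        (by gcongr; exact ContinuousLinearMap.opNorm_comp_le _ _)
    _ ≤ 1 * (‖A‖ * 1) := by
        gcongr
        rwa [LinearIsometryEquiv.norm_map]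
    _ = _ := by ring

/-- Schur multipliers are completely bounded, with the same norm. -/
lemma norm_ampliation_le (hD : IsMasa D) (ht : IsElemTensor t) (hτ : IsOpTensor t τ)
    {Φ : B H →L[ℂ] B H} (hΦ : IsSchurMultiplier D Φ) {Φc : B L →L[ℂ] B L}
    (hΦc : WStarContinuous L Φc) (hmap : ∀ A C, Φc (τ A C) = τ (Φ A) C) (T : B L) :
    ‖Φc T‖ ≤ ‖Φ‖ * ‖T‖ := by
  obtain ⟨w, b, -⟩ := exists_hilbertBasis ℂ K
  refine norm_le_of_columns hD ht b (by positivity) fun s s' d d' hd hd' hR hR' => ?_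
  rw [adjoint_column_comp_map ht hτ hΦ hΦc hmap b s s' hd hd']
  exact (Φ.le_opNorm _).trans (by gcongr; exact norm_adjoint_comp_comp_le hR hR' T)

/-- The ampliation of a lattice element satisfies a distance estimate with respect to its range. -/
lemma lamSet_ampliation_nonempty (hD : IsMasa D) (ht : IsElemTensor t) (hτ : IsOpTensor t τ)
    {Φ : B H →L[ℂ] B H} (hΦ : InC D Φ) {Φc : B L →L[ℂ] B L}
    (hΦc : WStarContinuous L Φc) (hmap : ∀ A C, Φc (τ A C) = τ (Φ A) C) :
    (lamSet Φc).Nonempty := by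
  obtain ⟨hS, -, C, hC, hg⟩ := hΦ.good hD
  obtain ⟨w, b, -⟩ := exists_hilbertBasis ℂ K
  suffices h : ∀ T, ‖T - Φc T‖ ≤ C * arveson T (Set.range Φc) by
    refine ⟨C + 1, by positivity, fun T => (h T).trans ?_⟩
    have := arveson_nonneg (T := T) (X := Set.range Φc)
    linarith
  intro T
  have hα := arveson_nonneg (T := T) (X := Set.range Φc)
  refine norm_le_of_columns hD ht b (by positivity) fun s s' d d' hd hd' hR hR' => ?_
  set R := column ht b s d
  set R' := column ht b s' d'
  have key : ∀ S, R.adjoint ∘L Φc S ∘L R' = Φ (R.adjoint ∘L S ∘L R') := fun S =>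
    adjoint_column_comp_map ht hτ hS hΦc hmap b s s' hd hd' S
  have h1 : R.adjoint ∘L (T - Φc T) ∘L R'
      = (ContinuousLinearMap.id ℂ (B H) - Φ) (R.adjoint ∘L T ∘L R') := by
    rw [sub_apply, ← key, ContinuousLinearMap.id_apply, ContinuousLinearMap.sub_comp,
      ContinuousLinearMap.comp_sub]
  rw [h1]
  refine hg _ _ hα fun Q P hQP => ?_
  obtain ⟨hQ, hP, hQn, hPn, h0⟩ := supp_compl_iff.1 hQP
  refine ContinuousLinearMap.opNorm_le_bound _ hα fun x => ?_
  have h2 : ‖(Q * (R.adjoint ∘L T ∘L R') * P) x‖ ≤ arveson T (Set.range Φc) * ‖R' (P x)‖ := by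
    refine le_arveson_mul_norm (Set.range_nonempty _) ?_
    rintro _ ⟨A, rfl⟩
    have h3 : Q * (R.adjoint ∘L Φc A ∘L R') * P = 0 := by
      rw [key, ← hS.2 _ hQ _ hP, h0]
    have h4 : (Q * (R.adjoint ∘L T ∘L R') * P) x
        = Q (R.adjoint (T (R' (P x)) - Φc A (R' (P x)))) := by
      have h5 : (Q * (R.adjoint ∘L Φc A ∘L R') * P) x = 0 := by rw [h3]; rfl
      rw [map_sub, map_sub]
      exact (sub_eq_self.2 h5).symm
    rw [h4]
    calc _ ≤ 1 * ‖R.adjoint (T (R' (P x)) - Φc A (R' (P x)))‖ :=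
          Q.le_of_opNorm_le hQn _
      _ ≤ 1 * (1 * ‖T (R' (P x)) - Φc A (R' (P x))‖) := by
          gcongr
          exact ContinuousLinearMap.le_of_opNorm_le _ (by rwa [LinearIsometryEquiv.norm_map]) _
      _ = _ := by ring
  refine h2.trans (mul_le_mul_of_nonneg_left ?_ hα)
  calc _ ≤ 1 * ‖P x‖ := R'.le_of_opNorm_le hR' _
    _ ≤ 1 * (1 * ‖x‖) := by gcongr; exact P.le_of_opNorm_le hPn _
    _ = _ := by ring

end Ampliation

section TensorIsometry

/-- Separable Hilbert spaces embed isometrically into `ℓ²`. -/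
lemma exists_isometry_ell2 (K : Type*) [NormedAddCommGroup K] [InnerProductSpace ℂ K]
    [CompleteSpace K] [TopologicalSpace.SeparableSpace K] : Nonempty (K →ₗᵢ[ℂ] ell2) := by
  obtain ⟨w, b, hb⟩ := exists_hilbertBasis ℂ K
  have hw : w.Countable := by
    have ho : Orthonormal ℂ ((↑) : w → K) := hb ▸ b.orthonormal
    refine Set.PairwiseDisjoint.countable_of_isOpen (s := fun x : K => Metric.ball x (1 / 2))
      (fun x hx y hy hxy => Metric.ball_disjoint_ball ?_) (fun _ _ => Metric.isOpen_ball)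
      fun x _ => ⟨x, Metric.mem_ball_self (by norm_num)⟩
    have h0 : ⟪x, y⟫_ℂ = 0 := ho.2 (i := ⟨x, hx⟩) (j := ⟨y, hy⟩) fun h => hxy (Subtype.ext_iff.1 h)
    have hx1 : ‖x‖ = 1 := ho.1 ⟨x, hx⟩
    have h1 := norm_sub_sq (𝕜 := ℂ) x y
    have hy1 : ‖y‖ = 1 := ho.1 ⟨y, hy⟩
    rw [h0, hx1, hy1] at h1
    rw [dist_eq_norm]
    simp only [map_zero] at h1
    nlinarith [norm_nonneg (x - y)]
  have := hw.to_subtype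
  obtain ⟨f, hf⟩ := exists_injective_nat w
  have he : Orthonormal ℂ (HilbertBasis.ofRepr (LinearIsometryEquiv.refl ℂ ell2)) :=
    HilbertBasis.orthonormal _
  exact ⟨((he.comp f hf).orthogonalFamily.linearIsometry).comp b.repr.toLinearIsometry⟩

variable {H K L N M : Type*} [NormedAddCommGroup H] [InnerProductSpace ℂ H] [CompleteSpace H]
  [NormedAddCommGroup K] [InnerProductSpace ℂ K] [CompleteSpace K]
  [NormedAddCommGroup L] [InnerProductSpace ℂ L] [CompleteSpace L]
  [NormedAddCommGroup N] [InnerProductSpace ℂ N] [CompleteSpace N]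
  [NormedAddCommGroup M] [InnerProductSpace ℂ M] [CompleteSpace M]
variable {t : H →ₗ[ℂ] K →ₗ[ℂ] L} {τ : B H →ₗ[ℂ] B K →ₗ[ℂ] B L}
variable {s : H →ₗ[ℂ] N →ₗ[ℂ] M} {σ : B H →ₗ[ℂ] B N →ₗ[ℂ] B M}

lemma IsElemTensor.flip (ht : IsElemTensor t) : IsElemTensor t.flip := by
  refine ⟨fun x₁ x₂ y₁ y₂ => by simp [ht.1, mul_comm], ?_⟩
  have : {z : L | ∃ x y, z = t.flip x y} = {z : L | ∃ x y, z = t x y} := by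
    ext z
    exact exists_comm
  rw [this]
  exact ht.2

lemma IsOpTensor.flip (hτ : IsOpTensor t τ) : IsOpTensor t.flip τ.flip :=
  fun A C x y => hτ C A y x

/-- An isometry `V` of the second factor induces the isometry `1 ⊗ V`. -/
lemma exists_tensor_isometry (ht : IsElemTensor t) (hs : IsElemTensor s) (V : K →ₗᵢ[ℂ] N) :
    ∃ W : L →L[ℂ] M, (∀ x y, W (t x y) = s x (V y)) ∧ ∀ z, ‖W z‖ = ‖z‖ := by
  set e : TensorProduct ℂ H K →ₗ[ℂ] L := TensorProduct.lift t with he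
  set f : TensorProduct ℂ H K →ₗ[ℂ] M := TensorProduct.lift (s.compl₂ V.toLinearMap) with hf
  have hinner : ∀ a b, ⟪f a, f b⟫_ℂ = ⟪e a, e b⟫_ℂ := by
    intro a b
    induction a using TensorProduct.induction_on with
    | zero => simp
    | add a a' h h' => rw [map_add, map_add, inner_add_left, inner_add_left, h, h']
    | tmul x y =>
      induction b using TensorProduct.induction_on with
      | zero => simp
      | add b b' h h' => rw [map_add, map_add, inner_add_right, inner_add_right, h, h']
      | tmul x' y' => simp [he, hf, ht.1, hs.1]
  have hnorm : ∀ a, ‖f a‖ = ‖e a‖ := fun a => by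
    have h := hinner a a
    rw [inner_self_eq_norm_sq_to_K, inner_self_eq_norm_sq_to_K] at h
    exact (pow_left_inj₀ (norm_nonneg _) (norm_nonneg _) two_ne_zero).1 (by exact_mod_cast h)
  have hd : DenseRange e := by
    refine ht.2.mono ?_
    rw [← LinearMap.coe_range]
    refine SetLike.coe_subset_coe.2 (Submodule.span_le.2 ?_)
    rintro _ ⟨x, y, rfl⟩
    exact ⟨x ⊗ₜ y, by simp [he]⟩
  have hb : ∃ C, ∀ a, ‖f a‖ ≤ C * ‖e a‖ := ⟨1, fun a => by rw [one_mul, hnorm]⟩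
  have hW := fun a => LinearMap.extendOfNorm_eq hd hb a
  refine ⟨f.extendOfNorm e, fun x y => ?_, fun z => ?_⟩
  · simpa [he, hf] using hW (x ⊗ₜ y)
  · refine hd.induction_on z (isClosed_eq (by fun_prop) (by fun_prop)) fun a => ?_
    rw [hW, hnorm]

lemma adjoint_tensor_isometry_apply (ht : IsElemTensor t) (hs : IsElemTensor s) {V : K →L[ℂ] N}
    {W : L →L[ℂ] M} (hW : ∀ x y, W (t x y) = s x (V y)) (x : H) (z : N) :
    W.adjoint (s x z) = t x (V.adjoint z) := by
  have h : innerSL ℂ (W.adjoint (s x z)) = innerSL ℂ (t x (V.adjoint z)) := ht.ext fun a b => by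
    rw [innerSL_apply_apply, innerSL_apply_apply, ContinuousLinearMap.adjoint_inner_left, hW, hs.1,
      ht.1, ContinuousLinearMap.adjoint_inner_left]
  exact ext_inner_right ℂ fun v => congrArg (fun g => g v) h

lemma compress_adjoint_tensor (ht : IsElemTensor t) (hs : IsElemTensor s) (hτ : IsOpTensor t τ)
    (hσ : IsOpTensor s σ) {V : K →L[ℂ] N} {W : L →L[ℂ] M} (hW : ∀ x y, W (t x y) = s x (V y))
    (A : B H) (C : B N) : compress W.adjoint W (σ A C) = τ A (compress V.adjoint V C) := by
  refine ht.ext fun x y => ?_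
  simp only [compress_apply, ContinuousLinearMap.comp_apply]
  rw [hW, hσ, adjoint_tensor_isometry_apply ht hs hW, hτ]
  rfl

lemma compress_tensor (ht : IsElemTensor t) (hs : IsElemTensor s) (hτ : IsOpTensor t τ)
    (hσ : IsOpTensor s σ) {V : K →L[ℂ] N} {W : L →L[ℂ] M} (hW : ∀ x y, W (t x y) = s x (V y))
    (A : B H) (C : B K) : compress W W.adjoint (τ A C) = σ A (compress V V.adjoint C) := by
  refine hs.ext fun x y => ?_
  simp only [compress_apply, ContinuousLinearMap.comp_apply]
  rw [adjoint_tensor_isometry_apply ht hs hW, hτ, hW, hσ]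
  rfl

end TensorIsometry

section Isometry

variable {E F : Type*} [NormedAddCommGroup E] [InnerProductSpace ℂ E] [CompleteSpace E]
  [NormedAddCommGroup F] [InnerProductSpace ℂ F] [CompleteSpace F] {W : E →L[ℂ] F}

lemma compress_adjoint_compress (hW : ∀ x, ‖W x‖ = ‖x‖) (T : B E) :
    compress W.adjoint W (compress W W.adjoint T) = T := by
  have h := (ContinuousLinearMap.norm_map_iff_adjoint_comp_self W).1 hW
  have h' : ∀ x, W.adjoint (W x) = x := fun x => congrArg (fun g => g x) h
  ext x
  simp [h']

lemma norm_adjoint_apply_le (hW : ∀ x, ‖W x‖ = ‖x‖) (y : F) : ‖W.adjoint y‖ ≤ ‖y‖ := by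
  refine (ContinuousLinearMap.le_of_opNorm_le _ ?_ y).trans_eq (one_mul _)
  rw [LinearIsometryEquiv.norm_map]
  exact ContinuousLinearMap.opNorm_le_bound _ zero_le_one fun x => by rw [hW, one_mul]

lemma norm_compress_adjoint_le (hW : ∀ x, ‖W x‖ = ‖x‖) (T : B F) :
    ‖compress W.adjoint W T‖ ≤ ‖T‖ := by
  refine ContinuousLinearMap.opNorm_le_bound _ (norm_nonneg _) fun x => ?_
  rw [← hW x]
  exact (norm_adjoint_apply_le hW _).trans (T.le_opNorm _)

lemma norm_compress_le (hW : ∀ x, ‖W x‖ = ‖x‖) (T : B E) :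
    ‖compress W W.adjoint T‖ ≤ ‖T‖ := by
  refine ContinuousLinearMap.opNorm_le_bound _ (norm_nonneg _) fun y => ?_
  change ‖W (T (W.adjoint y))‖ ≤ _
  rw [hW]
  exact (T.le_opNorm _).trans (by gcongr; exact norm_adjoint_apply_le hW y)

lemma arveson_compress_le (hW : ∀ x, ‖W x‖ = ‖x‖) {X : Set (B E)} {Y : Set (B F)}
    (hX : X.Nonempty) (h : ∀ S ∈ X, compress W W.adjoint S ∈ Y) (T : B E) :
    arveson (compress W W.adjoint T) Y ≤ arveson T X := by
  refine arveson_le arveson_nonneg fun ξ hξ ε hε => ?_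
  obtain ⟨S, hS, hle⟩ := exists_le_arveson (T := T) hX (W.adjoint ξ) hε
  refine ⟨_, h S hS, ?_⟩
  have h1 : ‖W.adjoint ξ‖ ≤ 1 := hξ ▸ norm_adjoint_apply_le hW ξ
  calc _ = ‖W (T (W.adjoint ξ) - S (W.adjoint ξ))‖ := by rw [map_sub]; rfl
    _ ≤ arveson T X * ‖W.adjoint ξ‖ + ε := by rwa [hW]
    _ ≤ _ := by
      have := mul_le_mul_of_nonneg_left h1 (arveson_nonneg (T := T) (X := X))
      linarith

end Isometry

section Constants

variable {H : Type*} [NormedAddCommGroup H] [InnerProductSpace ℂ H] [CompleteSpace H]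

lemma le_sInf_mul {A : Set ℝ} (hA : A.Nonempty) {a c : ℝ} (hc : 0 ≤ c) (h : ∀ k ∈ A, a ≤ k * c) :
    a ≤ sInf A * c := by
  obtain ⟨k, hk⟩ := hA
  rcases hc.eq_or_lt with rfl | hc
  · simpa using h k hk
  · rw [← div_le_iff₀ hc]
    exact le_csInf ⟨k, hk⟩ fun k hk => (div_le_iff₀ hc).2 (h k hk)

lemma norm_sub_le_lam {Φ : B H →L[ℂ] B H} (h : (lamSet Φ).Nonempty) (T : B H) :
    ‖T - Φ T‖ ≤ lam Φ * arveson T (Set.range Φ) :=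
  le_sInf_mul h arveson_nonneg fun _ hk => hk.2 T

lemma lam_nonneg (Φ : B H →L[ℂ] B H) : 0 ≤ lam Φ :=
  Real.sInf_nonneg fun _ hk => hk.1.le

lemma infDist_le_hyperConst {X : Set (B H)} (h : Hyperreflexive X) (T : B H) :
    Metric.infDist T X ≤ hyperConst X * arveson T X :=
  le_sInf_mul h arveson_nonneg fun _ hk => hk.2 T

lemma hyperConst_nonneg (X : Set (B H)) : 0 ≤ hyperConst X :=
  Real.sInf_nonneg fun _ hk => hk.1.le

lemma hyperreflexive_of_le {X : Set (B H)} {k : ℝ} (hk : 0 ≤ k)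
    (h : ∀ T, Metric.infDist T X ≤ k * arveson T X) : Hyperreflexive X ∧ hyperConst X ≤ k := by
  have hmem : ∀ ε > 0, k + ε ∈ hyperSet X := fun ε hε => ⟨by positivity, fun T =>
    (h T).trans (mul_le_mul_of_nonneg_right (by linarith) arveson_nonneg)⟩
  exact ⟨⟨_, hmem 1 one_pos⟩, le_of_forall_pos_le_add fun ε hε =>
    csInf_le ⟨0, fun _ hx => hx.1.le⟩ (hmem ε hε)⟩

lemma one_le_norm_of_idempotent {E : Type*} [NormedAddCommGroup E] [NormedSpace ℂ E]
    {P : E →L[ℂ] E} (h : P.comp P = P) (h0 : P ≠ 0) : 1 ≤ ‖P‖ := by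
  have h1 : ‖P‖ ≤ ‖P‖ * ‖P‖ := by
    conv_lhs => rw [← h]
    exact ContinuousLinearMap.opNorm_comp_le _ _
  have := norm_pos_iff.2 h0
  nlinarith

end Constants

section WeakStarSpan

variable {H K L F : Type*} [NormedAddCommGroup H] [InnerProductSpace ℂ H] [CompleteSpace H]
  [NormedAddCommGroup K] [InnerProductSpace ℂ K] [CompleteSpace K]
  [NormedAddCommGroup L] [InnerProductSpace ℂ L] [CompleteSpace L]
  [NormedAddCommGroup F] [InnerProductSpace ℂ F] [CompleteSpace F]
  {τ : B H →ₗ[ℂ] B K →ₗ[ℂ] B L} {X : Set (B H)} {Y : Set (B K)}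

lemma map_mem_wStarClosure {f : B L →L[ℂ] B F} {Z : Submodule ℂ (B F)}
    (hf : @Continuous _ _ (weakStarTopology L) (weakStarTopology F) f)
    (h : ∀ a ∈ X, ∀ c ∈ Y, f (τ a c) ∈ Z) {S : B L}
    (hS : S ∈ wStarClosure L (tensorSpan τ X Y)) : f S ∈ wStarClosure F (Z : Set (B F)) := by
  refine @map_mem_closure _ _ (weakStarTopology L) (weakStarTopology F) _ _ _ _ hf hS fun T hT => ?_
  have hle : Submodule.span ℂ {z : B L | ∃ a ∈ X, ∃ c ∈ Y, z = τ a c} ≤ Z.comap f.toLinearMap :=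
    Submodule.span_le.2 (by rintro _ ⟨a, ha, c, hc, rfl⟩; exact h a ha c hc)
  exact hle hT

lemma eq_of_mem_wStarClosure {f g : B L →L[ℂ] B F}
    (hf : @Continuous _ _ (weakStarTopology L) (weakStarTopology F) f)
    (hg : @Continuous _ _ (weakStarTopology L) (weakStarTopology F) g)
    (h : ∀ a ∈ X, ∀ c ∈ Y, f (τ a c) = g (τ a c)) {S : B L}
    (hS : S ∈ wStarClosure L (tensorSpan τ X Y)) : f S = g S := by
  have hle : Submodule.span ℂ {z : B L | ∃ a ∈ X, ∃ c ∈ Y, z = τ a c} ≤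
      LinearMap.eqLocus f.toLinearMap g.toLinearMap :=
    Submodule.span_le.2 (by rintro _ ⟨a, ha, c, hc, rfl⟩; exact h a ha c hc)
  exact @closure_minimal _ (weakStarTopology L) _ {T | f T = g T} (fun T hT => hle hT)
    (isClosed_weakStar_eq hf hg) _ hS

lemma subset_wStarClosure (X : Set (B L)) : X ⊆ wStarClosure L X :=
  @subset_closure _ (weakStarTopology L) X

end WeakStarSpan

end SchurHyper

set_option maxHeartbeats 1000000 in
/-- if `Φ ∈ 𝔠(H)` with `X = ran Φ` and `U ⊆ B(K)` is a completely
hyperreflexive weak* closed subspace, then the weak* closed span `W` of `X ⊗ U`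
in `B(H⊗K)` is hyperreflexive and `k(W) ≤ λ_c(Φ)·‖id − Φ‖ + k_c(U)·‖Φ‖`.
Here `HL` and `KL` realise `H ⊗ ℓ²` and `K ⊗ ℓ²`, `Φc = Φ ⊗ id` is the induced
Schur idempotent on `B(H ⊗ ℓ²)` so that `λ_c(Φ) = λ(Φc)`, and `k_c(U)` is the
hyperreflexivity constant of the weak* closed span of `U ⊗ B(ℓ²)`. -/
theorem stmt18 {H K HK : Type*}
    [NormedAddCommGroup H] [InnerProductSpace ℂ H] [CompleteSpace H]
    [TopologicalSpace.SeparableSpace H]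
    [NormedAddCommGroup K] [InnerProductSpace ℂ K] [CompleteSpace K]
    [TopologicalSpace.SeparableSpace K]
    [NormedAddCommGroup HK] [InnerProductSpace ℂ HK] [CompleteSpace HK]
    {HL KL : Type*}
    [NormedAddCommGroup HL] [InnerProductSpace ℂ HL] [CompleteSpace HL]
    [NormedAddCommGroup KL] [InnerProductSpace ℂ KL] [CompleteSpace KL]
    (DH : StarSubalgebra ℂ (B H)) (hDH : IsMasa DH)
    (DK : StarSubalgebra ℂ (B K)) (hDK : IsMasa DK)
    (t : H →ₗ[ℂ] K →ₗ[ℂ] HK) (τ : B H →ₗ[ℂ] B K →ₗ[ℂ] B HK)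
    (ht : IsElemTensor t) (hτ : IsOpTensor t τ)
    (tH : H →ₗ[ℂ] ell2 →ₗ[ℂ] HL) (τH : B H →ₗ[ℂ] B ell2 →ₗ[ℂ] B HL)
    (htH : IsElemTensor tH) (hτH : IsOpTensor tH τH)
    (tK : K →ₗ[ℂ] ell2 →ₗ[ℂ] KL) (τK : B K →ₗ[ℂ] B ell2 →ₗ[ℂ] B KL)
    (htK : IsElemTensor tK) (hτK : IsOpTensor tK τK)
    (Φ : B H →L[ℂ] B H) (hΦ : InC DH Φ)
    (Φc : B HL →L[ℂ] B HL) (hΦc : WStarContinuous HL Φc)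
    (hΦcT : ∀ (A : B H) (C : B ell2), Φc (τH A C) = τH (Φ A) C)
    (U : Submodule ℂ (B K)) (hUcl : WStarClosed K (U : Set (B K)))
    (hUc : Hyperreflexive
      (wStarClosure KL (tensorSpan τK (U : Set (B K)) Set.univ))) :
    Hyperreflexive (wStarClosure HK (tensorSpan τ (Set.range ⇑Φ) (U : Set (B K)))) ∧
    hyperConst (wStarClosure HK (tensorSpan τ (Set.range ⇑Φ) (U : Set (B K)))) ≤
      lam Φc * ‖ContinuousLinearMap.id ℂ (B H) - Φ‖ +
        hyperConst (wStarClosure KL (tensorSpan τK (U : Set (B K)) Set.univ)) * ‖Φ‖ := by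
  obtain ⟨VK⟩ := exists_isometry_ell2 K
  obtain ⟨VH⟩ := exists_isometry_ell2 H
  obtain ⟨W, hW, hWn⟩ := exists_tensor_isometry ht htH VK
  obtain ⟨W', hW', hWn'⟩ := exists_tensor_isometry ht.flip htK VH
  have hW2 : ∀ x y, W (t x y) = tH x (VK.toContinuousLinearMap y) := hW
  have hW2' : ∀ x y, W' (t.flip x y) = tK x (VH.toContinuousLinearMap y) := hW'
  have hidem : ∀ T, Φ (Φ T) = Φ T := fun T => congrArg (fun g => g T) (hΦ.comp_self hDH)
  set 𝒲 := wStarClosure HK (tensorSpan τ (Set.range ⇑Φ) (U : Set (B K))) with h𝒲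
  set 𝒰 := wStarClosure KL (tensorSpan τK (U : Set (B K)) Set.univ) with h𝒰
  have h0 : (0 : B HK) ∈ 𝒲 := subset_wStarClosure _ (Submodule.zero_mem _)
  have h0' : (0 : B KL) ∈ 𝒰 := subset_wStarClosure _ (Submodule.zero_mem _)
  -- the ampliation of `Φ` to `B(H ⊗ K)`
  set Ψ : B HK →L[ℂ] B HK := compress W.adjoint W ∘L Φc ∘L compress W W.adjoint with hΨ
  have hΦcW : @Continuous _ _ (weakStarTopology HK) (weakStarTopology HL)
      (Φc ∘L compress W W.adjoint) :=
    @Continuous.comp _ _ _ (weakStarTopology HK) (weakStarTopology HL) (weakStarTopology HL)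
      _ _ hΦc (continuous_compress W W.adjoint)
  have hΨc : @Continuous _ _ (weakStarTopology HK) (weakStarTopology HK) Ψ :=
    @Continuous.comp _ _ _ (weakStarTopology HK) (weakStarTopology HL) (weakStarTopology HK)
      _ _ (continuous_compress W.adjoint W) hΦcW
  have hΨτ : ∀ A C, Ψ (τ A C) = τ (Φ A) C := fun A C => by
    change compress W.adjoint W (Φc (compress W W.adjoint (τ A C))) = _
    rw [compress_tensor ht htH hτ hτH hW2, hΦcT, compress_adjoint_tensor ht htH hτ hτH hW2,
      compress_adjoint_compress (W := VK.toContinuousLinearMap) VK.norm_map]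
  have hΨn : ∀ T, ‖Ψ T‖ ≤ ‖Φ‖ * ‖T‖ := fun T =>
    (norm_compress_adjoint_le hWn _).trans <|
      (norm_ampliation_le hDH htH hτH (hΦ.good hDH).1 hΦc hΦcT _).trans
        (by gcongr; exact norm_compress_le hWn T)
  have hlam := lamSet_ampliation_nonempty hDH htH hτH hΦ hΦc hΦcT
  have h𝒲Φ : ∀ S ∈ 𝒲, compress W W.adjoint S ∈ Set.range Φc := fun S hS => by
    refine ⟨compress W W.adjoint S, ?_⟩
    refine eq_of_mem_wStarClosure (f := Φc ∘L compress W W.adjoint) (g := compress W W.adjoint)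
      hΦcW (continuous_compress W W.adjoint) ?_ hS
    rintro _ ⟨A, rfl⟩ c -
    rw [ContinuousLinearMap.comp_apply, compress_tensor ht htH hτ hτH hW2, hΦcT, hidem]
  have hfirst : ∀ T, ‖T - Ψ T‖ ≤ lam Φc * ‖ContinuousLinearMap.id ℂ (B H) - Φ‖ * arveson T 𝒲 := by
    intro T
    have hT : T - Ψ T = compress W.adjoint W
        (compress W W.adjoint T - Φc (compress W W.adjoint T)) := by
      rw [map_sub, compress_adjoint_compress hWn]
      rfl
    have hα := arveson_nonneg (T := T) (X := 𝒲)
    rw [hT]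
    refine (norm_compress_adjoint_le hWn _).trans ?_
    rcases eq_or_ne (ContinuousLinearMap.id ℂ (B H) - Φ) 0 with h | h
    · have h1 := norm_ampliation_le hDH htH hτH (isSchurMultiplier_id.sub (hΦ.good hDH).1)
        (isSchurMultiplier_id (D := (⊤ : StarSubalgebra ℂ (B HL))).1.sub hΦc)
        (fun A C => by simp [hΦcT]) (compress W W.adjoint T)
      rw [h, norm_zero, zero_mul] at h1
      rw [h, norm_zero, mul_zero, zero_mul]
      exact h1
    · have h1 := one_le_norm_of_idempotent (hΦ.compl.comp_self hDH) h
      calc _ ≤ lam Φc * arveson (compress W W.adjoint T) (Set.range Φc) := norm_sub_le_lam hlam _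
        _ ≤ lam Φc * arveson T 𝒲 :=
          mul_le_mul_of_nonneg_left (arveson_compress_le hWn ⟨0, h0⟩ h𝒲Φ T) (lam_nonneg _)
        _ ≤ _ := mul_le_mul_of_nonneg_right (le_mul_of_one_le_right (lam_nonneg _) h1) hα
  -- passage to `B(K ⊗ ℓ²)`
  have h𝒲𝒰 : ∀ S ∈ 𝒲, compress W' W'.adjoint S ∈ 𝒰 := fun S hS => by
    refine map_mem_wStarClosure (continuous_compress W' W'.adjoint) (fun A _ c hc => ?_) hS
    rw [← LinearMap.flip_apply τ, compress_tensor ht.flip htK hτ.flip hτK hW2']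
    exact Submodule.subset_span ⟨c, hc, _, trivial, rfl⟩
  have h𝒰𝒲 : ∀ S ∈ 𝒰, Ψ (compress W'.adjoint W' S) ∈ 𝒲 := fun S hS => by
    refine map_mem_wStarClosure (f := Ψ ∘L compress W'.adjoint W')
      (@Continuous.comp _ _ _ (weakStarTopology KL) (weakStarTopology HK) (weakStarTopology HK)
        _ _ hΨc (continuous_compress W'.adjoint W')) (fun c hc C _ => ?_) hS
    rw [ContinuousLinearMap.comp_apply, compress_adjoint_tensor ht.flip htK hτ.flip hτK hW2',
      LinearMap.flip_apply, hΨτ]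
    exact Submodule.subset_span ⟨_, ⟨_, rfl⟩, c, hc, rfl⟩
  have hdist : ∀ T, Metric.infDist T 𝒲 ≤
      ‖T - Ψ T‖ + Metric.infDist (compress W' W'.adjoint T) 𝒰 * ‖Φ‖ := by
    intro T
    set T' := compress W' W'.adjoint T
    rw [← sub_le_iff_le_add']
    refine le_of_forall_pos_le_add fun ε hε => ?_
    have hε' : 0 < ε / (‖Φ‖ + 1) := by positivity
    obtain ⟨S, hS, hlt⟩ := (Metric.infDist_lt_iff (x := T') ⟨0, h0'⟩).1
      (lt_add_of_pos_right (Metric.infDist T' 𝒰) hε')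
    have h1 : T - Ψ (compress W'.adjoint W' S) = (T - Ψ T) + Ψ (compress W'.adjoint W' (T' - S)) := by
      rw [map_sub, map_sub, compress_adjoint_compress hWn']
      abel
    have h2 : Metric.infDist T 𝒲 ≤ ‖T - Ψ T‖ + ‖Φ‖ * ‖T' - S‖ := by
      refine (Metric.infDist_le_dist_of_mem (h𝒰𝒲 S hS)).trans ?_
      rw [dist_eq_norm, h1]
      refine (norm_add_le _ _).trans (add_le_add le_rfl ((hΨn _).trans ?_))
      gcongr
      exact norm_compress_adjoint_le hWn' _
    rw [dist_eq_norm] at hlt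
    have h3 : ‖Φ‖ * ‖T' - S‖ ≤ ‖Φ‖ * (Metric.infDist T' 𝒰 + ε / (‖Φ‖ + 1)) := by gcongr
    have h4 : ‖Φ‖ * (ε / (‖Φ‖ + 1)) ≤ ε := by
      rw [mul_div_assoc', div_le_iff₀ (by positivity)]
      nlinarith [norm_nonneg Φ]
    linarith
  have hk := hyperConst_nonneg 𝒰
  refine hyperreflexive_of_le (add_nonneg (mul_nonneg (lam_nonneg _) (norm_nonneg _))
    (mul_nonneg hk (norm_nonneg _))) fun T => (hdist T).trans ?_
  rw [add_mul]
  refine add_le_add (hfirst T) ?_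
  calc _ ≤ hyperConst 𝒰 * arveson (compress W' W'.adjoint T) 𝒰 * ‖Φ‖ := by
        gcongr
        exact infDist_le_hyperConst hUc _
    _ ≤ hyperConst 𝒰 * arveson T 𝒲 * ‖Φ‖ := by
        gcongr
        exact arveson_compress_le hWn' ⟨0, h0⟩ h𝒲𝒰 T
    _ = _ := by ring
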